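/- Let U be an open neighborhood of the origin in ℝⁿ and let f : U → ℝ be C^∞ with f(0)=0, ∇f(0)=0 and Γ₊(f) ≠ ∅, satisfying condition (C), and suppose at least one of: (a) d(f) > 1; (b) f is nonnegative or nonpositive on U; (c) 1/d(f) is not an odd integer and f_{τ_*} does not vanish on U ∩ (ℝ∖{0})ⁿ. If the support of φ is contained in a sufficiently small neighborhood of the origin, then lim_{t→∞} t^{1/d(f)} (log t)^{−m(f)+1} · I(t;φ) = (Γ(1/d(f))/(m(f)−1)!) · [e^{iπ/(2d(f))} C_+ + e^{−iπ/(2d(f))} C_−], where Γ is the Gamma function and C_± = lim_{s→−1/d(f)} (s+1/d(f))^{m(f)} Z_±(s;φ). -/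

import Mathlib

open scoped BigOperators Topology
open Filter MeasureTheory Set

namespace KN

variable {n : ℕ}

/-- The standard inner product on `ℝⁿ`. -/
def dot (a x : Fin n → ℝ) : ℝ := ∑ i, a i * x i

/-- The hyperplane `H(a,l) = {x | ⟨a,x⟩ = l}`. -/
def Hplane (a : Fin n → ℝ) (l : ℝ) : Set (Fin n → ℝ) := {x | dot a x = l}

/-- The closed half-space `H⁺(a,l) = {x | ⟨a,x⟩ ≥ l}`. -/
def Hhalf (a : Fin n → ℝ) (l : ℝ) : Set (Fin n → ℝ) := {x | l ≤ dot a x}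

/-- View an integer vector as a real vector. -/
def intPt (a : Fin n → ℤ) : Fin n → ℝ := fun i => (a i : ℝ)

/-- View a vector of naturals as a real vector. -/
def natPt (a : Fin n → ℕ) : Fin n → ℝ := fun i => (a i : ℝ)

/-- The nonnegative octant `ℝ₊ⁿ`. -/
def octant (n : ℕ) : Set (Fin n → ℝ) := {x | ∀ i, 0 ≤ x i}

/-- A (convex rational) polyhedron: a finite intersection of closed half-spaces with
integral data. -/
def IsPolyhedron (P : Set (Fin n → ℝ)) : Prop :=
  ∃ (N : ℕ) (a : Fin N → Fin n → ℤ) (l : Fin N → ℤ),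
    P = ⋂ j, Hhalf (intPt (a j)) ((l j : ℝ))

/-- `(a,l) ∈ ℤⁿ × ℤ` is valid for `P` if `P ⊆ H⁺(a,l)`. -/
def ValidPair (P : Set (Fin n → ℝ)) (a : Fin n → ℤ) (l : ℤ) : Prop :=
  P ⊆ Hhalf (intPt a) (l : ℝ)

/-- A face of a polyhedron `P`: a set of the form `P ∩ H(a,l)` with `(a,l)` valid for `P`. -/
def IsFaceOf (P F : Set (Fin n → ℝ)) : Prop :=
  ∃ (a : Fin n → ℤ) (l : ℤ), ValidPair P a l ∧ F = P ∩ Hplane (intPt a) (l : ℝ)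

/-- Dimension of a subset of `ℝⁿ`: the dimension of its affine hull. -/
noncomputable def setDim (s : Set (Fin n → ℝ)) : ℕ :=
  Module.finrank ℝ (affineSpan ℝ s).direction

/-- First-order partial derivative in the `i`-th coordinate direction. -/
noncomputable def pderiv1 (i : Fin n) (f : (Fin n → ℝ) → ℝ) : (Fin n → ℝ) → ℝ :=
  fun x => fderiv ℝ f x (Pi.single i 1)

/-- Iterated partial derivative `∂^α` for a multi-index `α ∈ ℤ₊ⁿ`. -/
noncomputable def mderiv (α : Fin n → ℕ) (f : (Fin n → ℝ) → ℝ) : (Fin n → ℝ) → ℝ :=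
  (List.finRange n).foldr (fun i g => (pderiv1 i)^[α i] g) f

/-- Taylor coefficient `c_α = ∂^α f(0)/α!`. -/
noncomputable def taylorCoeff (f : (Fin n → ℝ) → ℝ) (α : Fin n → ℕ) : ℝ :=
  mderiv α f 0 / ((∏ i, Nat.factorial (α i) : ℕ) : ℝ)

/-- The Newton polyhedron `Γ₊(f)`: the convex hull of `⋃ {α + ℝ₊ⁿ : c_α ≠ 0}`. -/
def NewtonPolyhedron (f : (Fin n → ℝ) → ℝ) : Set (Fin n → ℝ) :=
  convexHull ℝ {x | ∃ α : Fin n → ℕ, taylorCoeff f α ≠ 0 ∧ ∀ i, (α i : ℝ) ≤ x i}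

/-- The pair `(a,l) ∈ ℤ₊ⁿ × ℤ₊` is valid for `P` and defines the face `γ = P ∩ H(a,l)`. -/
def DefinesFace (P : Set (Fin n → ℝ)) (a : Fin n → ℕ) (l : ℕ) (γ : Set (Fin n → ℝ)) : Prop :=
  P ⊆ Hhalf (natPt a) (l : ℝ) ∧ γ = P ∩ Hplane (natPt a) (l : ℝ)

/-- The anisotropic dilation `x ↦ (t^{a₁}x₁, …, t^{aₙ}xₙ)`. -/
def scaleAction (a : Fin n → ℕ) (t : ℝ) (x : Fin n → ℝ) : Fin n → ℝ :=
  fun i => t ^ (a i) * x i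

/-- `f` admits the `γ`-part on `U` (w.r.t. the polyhedron `P`): for every `x ∈ U` the limit
`lim_{t→0⁺} f(t^{a₁}x₁,…,t^{aₙ}xₙ)/t^l` exists for all valid pairs `(a,l) ∈ ℤ₊ⁿ×ℤ₊`
defining `γ`. -/
def AdmitsGammaPartOn (f : (Fin n → ℝ) → ℝ) (U P γ : Set (Fin n → ℝ)) : Prop :=
  ∀ x ∈ U, ∀ (a : Fin n → ℕ) (l : ℕ), DefinesFace P a l γ →
    ∃ c : ℝ, Filter.Tendsto (fun t : ℝ => f (scaleAction a t x) / t ^ l) (𝓝[>] (0:ℝ)) (𝓝 c)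

/-- Membership in the class `Ê[P](U)`. -/
def MemEhatP (P U : Set (Fin n → ℝ)) (f : (Fin n → ℝ) → ℝ) : Prop :=
  ContDiffOn ℝ (⊤ : ℕ∞) f U ∧ NewtonPolyhedron f ⊆ P ∧
    ∀ γ, IsFaceOf P γ → AdmitsGammaPartOn f U P γ

/-- Membership in the class `Ê(U) = {f : f ∈ Ê[Γ₊(f)](U)}`, where `Ê[∅](U) = {0}`. -/
def MemEhat (U : Set (Fin n → ℝ)) (f : (Fin n → ℝ) → ℝ) : Prop :=
  (NewtonPolyhedron f = ∅ ∧ ∀ x ∈ U, f x = 0) ∨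
  (NewtonPolyhedron f ≠ ∅ ∧ MemEhatP (NewtonPolyhedron f) U f)

/-- The polynomial `γ`-part `Σ_{α ∈ γ ∩ ℤ₊ⁿ} c_α x^α`. -/
noncomputable def gammaPartPoly (f : (Fin n → ℝ) → ℝ) (γ : Set (Fin n → ℝ))
    (x : Fin n → ℝ) : ℝ :=
  ∑' α : {α : Fin n → ℕ // natPt α ∈ γ}, taylorCoeff f α.1 * ∏ i, x i ^ (α.1 i)

/-- `V(γ) = {k : γ + ℝ₊ e_k ⊆ γ}`. -/
def Vset (γ : Set (Fin n → ℝ)) : Set (Fin n) :=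
  {k | ∀ x ∈ γ, ∀ r : ℝ, 0 ≤ r → x + r • (Pi.single k (1:ℝ) : Fin n → ℝ) ∈ γ}

/-- `W(γ) = {1,…,n} \ V(γ)`. -/
def Wset (γ : Set (Fin n → ℝ)) : Set (Fin n) := (Vset γ)ᶜ

open Classical in
/-- `T_I` replaces the coordinates indexed by `I` with `0`. -/
noncomputable def TI (I : Set (Fin n)) (x : Fin n → ℝ) : Fin n → ℝ :=
  fun i => if i ∈ I then 0 else x i

open Classical in
/-- `T_I^r` replaces the coordinates indexed by `I` with `r`. -/
noncomputable def TIr (I : Set (Fin n)) (r : ℝ) (x : Fin n → ℝ) : Fin n → ℝ :=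
  fun i => if i ∈ I then r else x i

/-- The canonical `γ`-part function
`f_γ(x) = Σ_{α ∈ γ_V} (1/α!) (∂^α f)(T_{W(γ)}(x)) x^α`, with `γ_V = T_{V(γ)}(γ) ∩ ℤ₊ⁿ`. -/
noncomputable def gammaFn (f : (Fin n → ℝ) → ℝ) (γ : Set (Fin n → ℝ)) (x : Fin n → ℝ) : ℝ :=
  ∑' α : {α : Fin n → ℕ // natPt α ∈ TI (Vset γ) '' γ},
    mderiv α.1 f (TI (Wset γ) x) * (∏ i, x i ^ (α.1 i)) /
      ((∏ i, Nat.factorial (α.1 i) : ℕ) : ℝ)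

/-- `f` is nondegenerate over `ℝ` w.r.t. its Newton polyhedron: for every nonempty compact
face `γ` of `Γ₊(f)` the gradient of the polynomial `f_γ` does not vanish on
`U ∩ (ℝ \ {0})ⁿ`. -/
def Nondegenerate (f : (Fin n → ℝ) → ℝ) (U : Set (Fin n → ℝ)) : Prop :=
  ∀ γ, IsFaceOf (NewtonPolyhedron f) γ → γ.Nonempty → IsCompact γ →
    ∀ x ∈ U, (∀ i, x i ≠ 0) → fderiv ℝ (gammaPartPoly f γ) x ≠ 0

/-- Condition (C): `f ∈ Ê(U)` and `f` is nondegenerate over `ℝ` w.r.t. `Γ₊(f)`. -/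
def ConditionC (U : Set (Fin n → ℝ)) (f : (Fin n → ℝ) → ℝ) : Prop :=
  MemEhat U f ∧ Nondegenerate f U

/-- The Newton distance `d(f)`: the coordinate of the point where the diagonal meets
the boundary of `Γ₊(f)`. -/
noncomputable def newtonDist (f : (Fin n → ℝ) → ℝ) : ℝ :=
  sInf {t : ℝ | (fun _ : Fin n => t) ∈ NewtonPolyhedron f}

/-- `τ` is the principal face of `Γ₊(f)`: its relative interior contains
`q_* = (d(f),…,d(f))`. -/
def IsPrincipalFace (f : (Fin n → ℝ) → ℝ) (τ : Set (Fin n → ℝ)) : Prop :=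
  IsFaceOf (NewtonPolyhedron f) τ ∧
    (fun _ : Fin n => newtonDist f) ∈ intrinsicInterior ℝ τ

/-- The oscillatory integral `I(t;φ) = ∫ e^{itf(x)} φ(x) dx`. -/
noncomputable def oscInt (f : (Fin n → ℝ) → ℝ) (φ : (Fin n → ℝ) → ℂ) (t : ℝ) : ℂ :=
  ∫ x : Fin n → ℝ, Complex.exp (Complex.I * t * f x) * φ x

/-- `Z₊(s;φ) = ∫ f(x)₊^s φ(x) dx`. -/
noncomputable def zetaPlus (f : (Fin n → ℝ) → ℝ) (φ : (Fin n → ℝ) → ℂ) (s : ℂ) : ℂ :=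
  ∫ x : Fin n → ℝ, ((max (f x) 0 : ℝ) : ℂ) ^ s * φ x

/-- `Z₋(s;φ) = ∫ f(x)₋^s φ(x) dx`. -/
noncomputable def zetaMinus (f : (Fin n → ℝ) → ℝ) (φ : (Fin n → ℝ) → ℂ) (s : ℂ) : ℂ :=
  ∫ x : Fin n → ℝ, ((max (-f x) 0 : ℝ) : ℂ) ^ s * φ x

/-- The local zeta function `Z(s;φ) = ∫ |f(x)|^s φ(x) dx`. -/
noncomputable def zetaAbs (f : (Fin n → ℝ) → ℝ) (φ : (Fin n → ℝ) → ℂ) (s : ℂ) : ℂ :=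
  ∫ x : Fin n → ℝ, ((|f x| : ℝ) : ℂ) ^ s * φ x

/-- An amplitude: a `C^∞` function with compact support contained in `U ∩ V`. -/
def IsAmplitude (U V : Set (Fin n → ℝ)) (φ : (Fin n → ℝ) → ℂ) : Prop :=
  ContDiff ℝ (⊤ : ℕ∞) φ ∧ HasCompactSupport φ ∧ tsupport φ ⊆ U ∩ V

/-- Partial sum `Σ_{α ∈ E, α ≥ -M} Σ_{k=1}^n C_{αk} t^α (log t)^{k-1}`. -/
noncomputable def partialSum (n : ℕ) (E : Set ℝ) (C : ℝ → ℕ → ℂ) (M t : ℝ) : ℂ :=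
  ∑ᶠ α ∈ {β ∈ E | -M ≤ β}, ∑ k ∈ Finset.Icc 1 n,
    C α k * ((t ^ α : ℝ) : ℂ) * (((Real.log t) ^ (k - 1) : ℝ) : ℂ)

/-- `g(t)` admits the asymptotic expansion `Σ_{α ∈ E} Σ_{k=1}^n C_{αk} t^α (log t)^{k-1}`
as `t → +∞`. -/
def HasAsympExpansion (n : ℕ) (g : ℝ → ℂ) (E : Set ℝ) (C : ℝ → ℕ → ℂ) : Prop :=
  (∀ α k, C α k ≠ 0 → α ∈ E ∧ 1 ≤ k ∧ k ≤ n) ∧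
  ∀ M : ℝ, ∃ K : ℝ, ∀ t : ℝ, 2 ≤ t →
    ‖g t - partialSum n E C M t‖ ≤ K * t ^ (-M)

/-- A set of exponents consisting of negative numbers, finite above any `-M`. -/
def LocallyFiniteBelow (E : Set ℝ) : Prop :=
  E ⊆ Set.Iio 0 ∧ ∀ M : ℝ, {β ∈ E | -M ≤ β}.Finite

/-- The set `S(f)` of pairs `(α,k)` appearing with a nonzero coefficient in the asymptotic
expansion of `I(t;φ)` for amplitudes `φ` supported arbitrarily close to the origin. -/
def OscSet (U : Set (Fin n → ℝ)) (f : (Fin n → ℝ) → ℝ) : Set (ℝ × ℕ) :=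
  {p | ∀ V ∈ 𝓝 (0 : Fin n → ℝ), ∃ φ : (Fin n → ℝ) → ℂ, IsAmplitude U V φ ∧
      ∃ E C, LocallyFiniteBelow E ∧ HasAsympExpansion n (oscInt f φ) E C ∧ C p.1 p.2 ≠ 0}

/-- The cone spanned by the vectors `g j`, `j ∈ s`. -/
def coneSpanSub (g : Fin n → (Fin n → ℝ)) (s : Finset (Fin n)) : Set (Fin n → ℝ) :=
  {x | ∃ c : Fin n → ℝ, (∀ j, 0 ≤ c j) ∧ (∀ j ∉ s, c j = 0) ∧ x = ∑ j, c j • g j}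

/-- The cone spanned by all the vectors `g j`. -/
def coneSpan (g : Fin n → (Fin n → ℝ)) : Set (Fin n → ℝ) := coneSpanSub g Finset.univ

/-- `l(a) = min {⟨a,α⟩ : α ∈ Γ}`. -/
noncomputable def lval (Γ : Set (Fin n → ℝ)) (a : Fin n → ℝ) : ℝ := sInf (dot a '' Γ)

/-- Real matrix of skeleton vectors. -/
def genR (a : Fin n → (Fin n → ℕ)) : Fin n → (Fin n → ℝ) := fun j => natPt (a j)

/-- A simplicial subdivision `Σ` of the fan `Σ₀` associated with `Γ`, presented via the
skeletons of its `n`-dimensional cones: each maximal cone is unimodular (its skeleton can be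
completed to a basis of the lattice `ℤⁿ`), the cones cover `ℝ₊ⁿ`, each cone lies in a cone
`closure(γ*)` of the fan `Σ₀`, and two cones intersect in a common face. -/
structure SimplicialSubdivision (n : ℕ) (Γ : Set (Fin n → ℝ)) where
  ι : Type
  fin : Fintype ι
  gen : ι → Fin n → (Fin n → ℕ)
  unimodular : ∀ σ, (Matrix.det (Matrix.of fun j k => (gen σ j k : ℤ))).natAbs = 1
  covers : ∀ x ∈ octant n, ∃ σ, x ∈ coneSpan (genR (gen σ))
  subordinate : ∀ σ, ∃ γ, IsFaceOf Γ γ ∧ γ.Nonempty ∧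
      ∀ j, ∀ y ∈ γ, dot (natPt (gen σ j)) y = lval Γ (natPt (gen σ j))
  compatible : ∀ σ τ, ∃ s : Finset (Fin n),
      (∀ j ∈ s, gen σ j ∈ Set.range (gen τ)) ∧
      coneSpan (genR (gen σ)) ∩ coneSpan (genR (gen τ)) = coneSpanSub (genR (gen σ)) s

/-- The set `Σ^{(1)}` of primitive generators of the one-dimensional cones of `Σ`. -/
def sigma1 {n : ℕ} {Γ : Set (Fin n → ℝ)} (S : SimplicialSubdivision n Γ) :
    Set (Fin n → ℕ) :=
  {a | ∃ σ j, S.gen σ j = a}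

/-- The set `{-(⟨a⟩+ν)/l(a) : ν ∈ ℤ₊, a ∈ Σ̃^{(1)}}`. -/
noncomputable def expSetMain {n : ℕ} (Γ : Set (Fin n → ℝ))
    (S : SimplicialSubdivision n Γ) : Set ℝ :=
  {r | ∃ a ∈ sigma1 S, 0 < lval Γ (natPt a) ∧
        ∃ ν : ℕ, r = -((∑ i, (a i : ℝ)) + (ν : ℝ)) / lval Γ (natPt a)}

/-- The full candidate set `{-(⟨a⟩+ν)/l(a)} ∪ (-ℕ)`. -/
noncomputable def expSet {n : ℕ} (Γ : Set (Fin n → ℝ))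
    (S : SimplicialSubdivision n Γ) : Set ℝ :=
  expSetMain Γ S ∪ {r | ∃ m : ℕ, r = -((m : ℝ) + 1)}

/-- `G` has at `s₀` a pole of order at most `m` (in particular `G` may be analytic there). -/
def PoleOrderAtMost (G : ℂ → ℂ) (s₀ : ℂ) (m : ℕ) : Prop :=
  ∃ h : ℂ → ℂ, AnalyticAt ℂ h s₀ ∧ ∀ᶠ s in 𝓝[≠] s₀, (s - s₀) ^ m * G s = h s


open Classical in
/-- `A_V(N) = {α ∈ T_V(ℤ₊ⁿ) : ⟨α⟩ < N}`. -/
noncomputable def ASetF (n : ℕ) (V : Finset (Fin n)) (N : ℕ) : Finset (Fin n → ℕ) :=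
  (Fintype.piFinset fun _ : Fin n => Finset.range (N + 1)).filter
    (fun α => (∀ j ∈ V, α j = 0) ∧ ∑ i, α i < N)

open Classical in
/-- `B_V(N) = {α ∈ T_V(ℤ₊ⁿ) : ⟨α⟩ = N}`. -/
noncomputable def BSetF (n : ℕ) (V : Finset (Fin n)) (N : ℕ) : Finset (Fin n → ℕ) :=
  (Fintype.piFinset fun _ : Fin n => Finset.range (N + 1)).filter
    (fun α => (∀ j ∈ V, α j = 0) ∧ ∑ i, α i = N)

/-- `v` is a vertex (0-dimensional face) of `P`. -/
def IsVertex (P : Set (Fin n → ℝ)) (v : Fin n → ℝ) : Prop := IsFaceOf P {v}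

/-- Membership in the class `Ě[P](U)`: an element of `Ê[P](U)` expressible as
`Σ_{p∈S} x^p ψ_p(x)` with `S ⊆ P ∩ ℤ₊ⁿ` finite containing all vertices of `P`, and
`ψ_p(0) ≠ 0` for each vertex `p`. -/
def MemEcheck (P U : Set (Fin n → ℝ)) (f : (Fin n → ℝ) → ℝ) : Prop :=
  MemEhatP P U f ∧
  ∃ S : Finset (Fin n → ℕ), (∀ p ∈ S, natPt p ∈ P) ∧
    (∀ v, IsVertex P v → ∃ p ∈ S, natPt p = v) ∧
    ∃ ψ : (Fin n → ℕ) → (Fin n → ℝ) → ℝ,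
      (∀ p ∈ S, ContDiffOn ℝ (⊤ : ℕ∞) (ψ p) U) ∧
      (∀ p ∈ S, IsVertex P (natPt p) → ψ p 0 ≠ 0) ∧
      ∀ x ∈ U, f x = ∑ p ∈ S, (∏ i, x i ^ p i) * ψ p x

/-- Membership in the class `Ẽ(U)`: functions of the form `Σ_{p∈S} x^p ψ_p(x)` with
`ψ_p(0) ≠ 0` for all `p ∈ S`. -/
def MemEtilde (U : Set (Fin n → ℝ)) (f : (Fin n → ℝ) → ℝ) : Prop :=
  ∃ S : Finset (Fin n → ℕ), ∃ ψ : (Fin n → ℕ) → (Fin n → ℝ) → ℝ,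
    (∀ p ∈ S, ContDiffOn ℝ (⊤ : ℕ∞) (ψ p) U) ∧ (∀ p ∈ S, ψ p 0 ≠ 0) ∧
    ∀ x ∈ U, f x = ∑ p ∈ S, (∏ i, x i ^ p i) * ψ p x

/-- Membership in the Denjoy–Carleman class `ℰ_M(U)`. -/
def MemDC (M : ℕ → ℝ) (U : Set (Fin n → ℝ)) (f : (Fin n → ℝ) → ℝ) : Prop :=
  ContDiffOn ℝ (⊤ : ℕ∞) f U ∧
  ∀ K : Set (Fin n → ℝ), K ⊆ U → IsCompact K →
    ∃ A B : ℝ, 0 < A ∧ 0 < B ∧ ∀ x ∈ K, ∀ α : Fin n → ℕ,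
      |mderiv α f x| ≤ A * B ^ (∑ i, α i) * ((∏ i, Nat.factorial (α i) : ℕ) : ℝ) *
        M (∑ i, α i)

open Classical in
/-- The multi-index `α - 1` from the proof of Proposition 9.5:
`(α-1)_j = l_jλ - m_j` for `j ∈ B_λ`, `(α-1)_n = λ - 1`, and `0` otherwise. -/
noncomputable def alphaIdx (n lam : ℕ) (l m : Fin n → ℕ) (Bl : Finset (Fin n)) :
    Fin (n+1) → ℕ :=
  fun i => if h : i = Fin.last n then lam - 1
    else if i.castPred h ∈ Bl then l (i.castPred h) * lam - m (i.castPred h) else 0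

open Classical in
/-- The constant `C_λ` of Proposition 9.5. -/
noncomputable def Cval (n lam : ℕ) (l m : Fin n → ℕ) (Bl : Finset (Fin n))
    (η : (Fin (n+1) → ℝ) → ℝ) : ℝ :=
  (1 / (Nat.factorial (lam - 1) : ℝ)) *
  (∏ j ∈ Bl, ((l j : ℝ) *
      ∏ ν ∈ Finset.Icc 1 (l j * lam - m j),
        (((l j * lam : ℕ) : ℝ) - (m j : ℝ) + 1 - (ν : ℝ)))⁻¹) *
  (if Bl = Finset.univ then mderiv (alphaIdx n lam l m Bl) η 0
   else ∫ z : {j : Fin n // j ∉ Bl} → ℝ in {z | ∀ j, 0 ≤ z j},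
     mderiv (alphaIdx n lam l m Bl) η
       (fun i => if h : i = Fin.last n then 0
         else if hj : i.castPred h ∈ Bl then 0 else z ⟨i.castPred h, hj⟩))

/-- `∫₀^∞ t^(z-1) (e^{-rt} - 1) dt`, the regularised Gamma integral for `-1 < z < 0`. -/
noncomputable def regGamma (z : ℝ) (r : ℂ) : ℂ :=
  ∫ t in Ioi (0 : ℝ), ((t ^ (z - 1) : ℝ) : ℂ) * (Complex.exp (-(r * t)) - 1)

lemma norm_exp_neg_sub_one_le {w : ℂ} (hw : 0 ≤ w.re) :
    ‖Complex.exp (-w) - 1‖ ≤ min 2 ‖w‖ := by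
  refine le_min ?_ ?_
  · calc ‖Complex.exp (-w) - 1‖ ≤ ‖Complex.exp (-w)‖ + ‖(1 : ℂ)‖ := norm_sub_le _ _
      _ ≤ 1 + 1 := by
        gcongr
        · rw [Complex.norm_exp]; simpa using hw
        · simp
      _ = 2 := by norm_num
  · have h := Convex.norm_image_sub_le_of_norm_deriv_le (f := fun w : ℂ => Complex.exp (-w))
      (s := {w : ℂ | 0 ≤ w.re}) (C := 1) (x := 0) (y := w)
      (fun x _ => by fun_prop)
      (fun x hx => by
        have : deriv (fun w : ℂ => Complex.exp (-w)) x = -Complex.exp (-x) := by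
          simpa using (hasDerivAt_neg x).cexp.deriv
        rw [this, norm_neg, Complex.norm_exp]
        simpa using hx)
      (convex_halfSpace_re_ge 0) (by simp) hw
    simpa using h

lemma integrableOn_rpow_mul_min {z : ℝ} (hz : -1 < z) (hz0 : z < 0) {R : ℝ} (hR : 0 ≤ R) :
    IntegrableOn (fun t : ℝ => t ^ (z - 1) * min 2 (R * t)) (Ioi 0) := by
  rw [← Ioc_union_Ioi_eq_Ioi (zero_le_one' ℝ)]
  refine IntegrableOn.union ?_ ?_
  · have h1 : IntegrableOn (fun t : ℝ => R * t ^ z) (Ioc 0 1) :=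
      ((intervalIntegral.intervalIntegrable_rpow' hz).1).const_mul R
    refine Integrable.mono' h1 ?_ ?_
    · exact Measurable.aestronglyMeasurable (by fun_prop)
    · refine (ae_restrict_iff' measurableSet_Ioc).2 (.of_forall fun t ht => ?_)
      have ht0 : 0 < t := ht.1
      have : (0 : ℝ) ≤ t ^ (z - 1) := by positivity
      rw [Real.norm_of_nonneg (by positivity)]
      calc t ^ (z - 1) * min 2 (R * t) ≤ t ^ (z - 1) * (R * t) := by gcongr; exact min_le_right _ _
        _ = R * t ^ z := by
          rw [Real.rpow_sub_one ht0.ne']; field_simp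
  · have h1 : IntegrableOn (fun t : ℝ => 2 * t ^ (z - 1)) (Ioi 1) :=
      (integrableOn_Ioi_rpow_of_lt (by linarith) zero_lt_one).const_mul 2
    refine Integrable.mono' h1 ?_ ?_
    · exact Measurable.aestronglyMeasurable (by fun_prop)
    · refine (ae_restrict_iff' measurableSet_Ioi).2 (.of_forall fun t ht => ?_)
      have ht0 : 0 < t := lt_trans zero_lt_one ht
      have : (0 : ℝ) ≤ t ^ (z - 1) := by positivity
      rw [Real.norm_of_nonneg (by positivity), mul_comm 2]
      gcongr; exact min_le_left _ _

lemma norm_regGamma_integrand_le (z : ℝ) {r : ℂ} {R : ℝ} (hr : 0 ≤ r.re) (hR : ‖r‖ ≤ R)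
    {t : ℝ} (ht : 0 < t) :
    ‖((t ^ (z - 1) : ℝ) : ℂ) * (Complex.exp (-(r * t)) - 1)‖ ≤ t ^ (z - 1) * min 2 (R * t) := by
  rw [norm_mul, Complex.norm_real, Real.norm_of_nonneg (by positivity)]
  gcongr
  refine (norm_exp_neg_sub_one_le ?_).trans ?_
  · simpa using mul_nonneg hr ht.le
  · rw [norm_mul, Complex.norm_real, Real.norm_of_nonneg ht.le]; gcongr

lemma integrableOn_regGamma {z : ℝ} (hz : -1 < z) (hz0 : z < 0) {r : ℂ} (hr : 0 ≤ r.re) :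
    IntegrableOn (fun t : ℝ => ((t ^ (z - 1) : ℝ) : ℂ) * (Complex.exp (-(r * t)) - 1)) (Ioi 0) := by
  refine Integrable.mono' (integrableOn_rpow_mul_min hz hz0 (norm_nonneg r)) ?_ ?_
  · exact Measurable.aestronglyMeasurable (by fun_prop)
  · exact (ae_restrict_iff' measurableSet_Ioi).2
      (.of_forall fun t ht => norm_regGamma_integrand_le z hr le_rfl ht)

lemma continuousOn_regGamma {z : ℝ} (hz : -1 < z) (hz0 : z < 0) :
    ContinuousOn (regGamma z) {r | 0 ≤ r.re} := by
  intro r hr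
  refine tendsto_integral_filter_of_dominated_convergence
    (fun t => t ^ (z - 1) * min 2 ((‖r‖ + 1) * t)) ?_ ?_
    (integrableOn_rpow_mul_min hz hz0 (by positivity)) ?_
  · exact .of_forall fun _ => Measurable.aestronglyMeasurable (by fun_prop)
  · have h1 : ∀ᶠ r' in 𝓝[{r | 0 ≤ r.re}] r, ‖r'‖ < ‖r‖ + 1 :=
      nhdsWithin_le_nhds ((continuous_norm.tendsto r).eventually (gt_mem_nhds (by linarith)))
    filter_upwards [h1, self_mem_nhdsWithin] with r' h1 h2
    exact (ae_restrict_iff' measurableSet_Ioi).2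
      (.of_forall fun t ht => norm_regGamma_integrand_le z h2 h1.le ht)
  · refine .of_forall fun t => ?_
    have : Continuous fun r : ℂ => ((t ^ (z - 1) : ℝ) : ℂ) * (Complex.exp (-(r * t)) - 1) := by
      fun_prop
    exact (this.tendsto r).mono_left nhdsWithin_le_nhds

lemma hasDerivAt_regGamma {z : ℝ} (hz : -1 < z) (hz0 : z < 0) {r : ℂ} (hr : 0 < r.re) :
    HasDerivAt (regGamma z)
      (∫ t in Ioi (0 : ℝ), ((t ^ (z - 1) : ℝ) : ℂ) * (Complex.exp (-(r * t)) * (-t))) r := by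
  set c := r.re / 2 with hc
  have hc0 : 0 < c := by positivity
  have hs : {w : ℂ | c < w.re} ∈ 𝓝 r :=
    (isOpen_lt continuous_const Complex.continuous_re).mem_nhds (by simp [hc]; linarith)
  refine (hasDerivAt_integral_of_dominated_loc_of_deriv_le (μ := volume.restrict (Ioi 0))
    (F := fun (r : ℂ) (t : ℝ) => ((t ^ (z - 1) : ℝ) : ℂ) * (Complex.exp (-(r * t)) - 1))
    (F' := fun (r : ℂ) (t : ℝ) => ((t ^ (z - 1) : ℝ) : ℂ) * (Complex.exp (-(r * t)) * (-t)))
    (bound := fun t => t ^ z * Real.exp (-c * t)) hs ?_ ?_ ?_ ?_ ?_ ?_).2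
  · exact .of_forall fun _ => Measurable.aestronglyMeasurable (by fun_prop)
  · exact integrableOn_regGamma hz hz0 hr.le
  · exact Measurable.aestronglyMeasurable (by fun_prop)
  · refine (ae_restrict_iff' measurableSet_Ioi).2 (.of_forall fun t ht w hw => ?_)
    have ht0 : 0 < t := ht
    rw [norm_mul, norm_mul, Complex.norm_real, Real.norm_of_nonneg (by positivity), norm_neg,
      Complex.norm_real, Real.norm_of_nonneg ht0.le, Complex.norm_exp]
    have e : t ^ z = t ^ (z - 1) * t := by rw [Real.rpow_sub_one ht0.ne']; field_simp
    have : (-(w * t)).re ≤ -c * t := by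
      have : c < w.re := hw
      simp only [Complex.neg_re, Complex.mul_re, Complex.ofReal_re, Complex.ofReal_im]
      nlinarith
    calc t ^ (z - 1) * (Real.exp (-(w * t)).re * t)
        ≤ t ^ (z - 1) * (Real.exp (-c * t) * t) := by gcongr
      _ = _ := by rw [e]; ring
  · simpa [Real.rpow_one, IntegrableOn] using
      integrableOn_rpow_mul_exp_neg_mul_rpow (s := z) (p := 1) hz one_pos hc0
  · refine .of_forall fun t w hw => ?_
    have h1 : HasDerivAt (fun w : ℂ => -(w * (t : ℂ))) (-(1 * (t : ℂ))) w :=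
      ((hasDerivAt_id w).mul_const (t : ℂ)).neg
    have := ((h1.cexp.sub_const 1).const_mul (((t ^ (z - 1) : ℝ) : ℂ)))
    simpa using this

lemma regGamma_ofReal {z : ℝ} {r : ℝ} (hr : 0 < r) :
    regGamma z r = (r : ℂ) ^ (-(z : ℂ)) * regGamma z 1 := by
  have h := integral_comp_mul_left_Ioi
    (fun t : ℝ => ((t ^ (z - 1) : ℝ) : ℂ) * (Complex.exp (-((1 : ℂ) * t)) - 1)) 0 hr
  rw [mul_zero] at h
  have h2 : regGamma z 1 = r * ∫ t in Ioi (0 : ℝ), (((r * t) ^ (z - 1) : ℝ) : ℂ) *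
      (Complex.exp (-((1 : ℂ) * (r * t : ℝ))) - 1) := by
    rw [h, regGamma, Complex.real_smul, ← mul_assoc]
    push_cast
    rw [mul_inv_cancel₀ (by exact_mod_cast hr.ne'), one_mul]
  have h3 : ∫ t in Ioi (0 : ℝ), (((r * t) ^ (z - 1) : ℝ) : ℂ) *
      (Complex.exp (-((1 : ℂ) * (r * t : ℝ))) - 1) = ((r ^ (z - 1) : ℝ) : ℂ) * regGamma z r := by
    rw [regGamma, ← integral_const_mul]
    refine setIntegral_congr_fun measurableSet_Ioi fun t ht => ?_
    have ht0 : 0 < t := ht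
    rw [Real.mul_rpow hr.le ht0.le]
    push_cast
    ring_nf
  rw [h2, h3, ← Complex.ofReal_neg, ← Complex.ofReal_cpow hr.le, ← mul_assoc, ← mul_assoc,
    ← Complex.ofReal_mul, ← Complex.ofReal_mul]
  have : r ^ (-z) * r * r ^ (z - 1) = 1 := by
    rw [Real.rpow_neg hr.le, Real.rpow_sub_one hr.ne']; field_simp
  rw [this]; simp

lemma regGamma_one {z : ℝ} (hz : -1 < z) (hz0 : z < 0) : regGamma z 1 = Complex.Gamma z := by
  have h1 : HasDerivAt (fun r : ℝ => regGamma z r)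
      (∫ t in Ioi (0 : ℝ), ((t ^ (z - 1) : ℝ) : ℂ) * (Complex.exp (-((1 : ℂ) * t)) * (-t))) 1 := by
    have := (hasDerivAt_regGamma hz hz0 (r := ((1 : ℝ) : ℂ)) (by simp)).comp_ofReal
    simpa using this
  have h2 : HasDerivAt (fun r : ℝ => regGamma z r) (-(z : ℂ) * regGamma z 1) 1 := by
    have h3 : HasDerivAt (fun r : ℝ => (r : ℂ) ^ (-(z : ℂ)) * regGamma z 1)
        (-(z : ℂ) * regGamma z 1) 1 := by
      have := (hasDerivAt_id (𝕜 := ℂ) ((1 : ℝ) : ℂ)).cpow_const (c := -(z : ℂ)) (by simp)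
      have := this.comp_ofReal.mul_const (regGamma z 1)
      simpa using this
    refine h3.congr_of_eventuallyEq ?_
    filter_upwards [lt_mem_nhds (zero_lt_one' ℝ)] with r hr using regGamma_ofReal hr
  have h3 := h1.unique h2
  have h4 : ∫ t in Ioi (0 : ℝ), ((t ^ (z - 1) : ℝ) : ℂ) * (Complex.exp (-((1 : ℂ) * t)) * (-t))
      = -Complex.Gamma (z + 1) := by
    have := Complex.integral_cpow_mul_exp_neg_mul_Ioi (a := z + 1) (r := 1)
      (by simp; linarith) one_pos
    simp only [Complex.ofReal_one, div_one, Complex.one_cpow, one_mul] at this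
    rw [← this, ← integral_neg]
    refine setIntegral_congr_fun measurableSet_Ioi fun t ht => ?_
    have ht0 : 0 < t := ht
    rw [add_sub_cancel_right, ← Complex.ofReal_cpow ht0.le, Real.rpow_sub_one ht0.ne']
    push_cast
    have : (t : ℂ) ≠ 0 := by exact_mod_cast ht0.ne'
    field_simp
  have hzz : (z : ℂ) ≠ 0 := by exact_mod_cast hz0.ne
  rw [h4, Complex.Gamma_add_one _ hzz] at h3
  have : (z : ℂ) * Complex.Gamma z = z * regGamma z 1 := by linear_combination -h3
  exact (mul_left_cancel₀ hzz this).symm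

lemma regGamma_eq_of_re_pos {z : ℝ} (hz : -1 < z) (hz0 : z < 0) {r : ℂ} (hr : 0 < r.re) :
    regGamma z r = Complex.Gamma z * r ^ (-(z : ℂ)) := by
  have hopen : IsOpen {w : ℂ | 0 < w.re} := isOpen_lt continuous_const Complex.continuous_re
  have hA : AnalyticOnNhd ℂ (regGamma z) {w | 0 < w.re} :=
    DifferentiableOn.analyticOnNhd (fun w hw =>
      (hasDerivAt_regGamma hz hz0 hw).differentiableAt.differentiableWithinAt) hopen
  have hB : AnalyticOnNhd ℂ (fun w : ℂ => Complex.Gamma z * w ^ (-(z : ℂ))) {w | 0 < w.re} := by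
    refine DifferentiableOn.analyticOnNhd (fun w hw => ?_) hopen
    exact ((differentiableAt_id.cpow_const (Or.inl hw)).const_mul _).differentiableWithinAt
  refine hA.eqOn_of_preconnected_of_frequently_eq hB (convex_halfSpace_re_gt 0).isPreconnected
    (z₀ := 1) (by simp) ?_ hr
  have hseq : Tendsto (fun k : ℕ => ((1 + 1 / ((k : ℝ) + 1) : ℝ) : ℂ)) atTop (𝓝[≠] 1) := by
    refine tendsto_nhdsWithin_iff.2 ⟨?_, .of_forall fun k => ?_⟩
    · have := (tendsto_one_div_add_atTop_nhds_zero_nat (𝕜 := ℝ)).const_add 1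
      have := (Complex.continuous_ofReal.tendsto _).comp this
      simpa [Function.comp_def] using this
    · have : (0 : ℝ) < 1 / ((k : ℝ) + 1) := by positivity
      intro h
      have h2 : ((1 + 1 / ((k : ℝ) + 1) : ℝ) : ℂ) = 1 := h
      have h' : (1 + 1 / ((k : ℝ) + 1) : ℝ) = 1 := by exact_mod_cast h2
      linarith
  refine hseq.frequently (.of_forall fun k => ?_)
  rw [regGamma_ofReal (by positivity), regGamma_one hz hz0, mul_comm]

lemma regGamma_eq {z : ℝ} (hz : -1 < z) (hz0 : z < 0) {r : ℂ} (hr : 0 ≤ r.re) (hr0 : r ≠ 0) :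
    regGamma z r = Complex.Gamma z * r ^ (-(z : ℂ)) := by
  have hslit : r ∈ Complex.slitPlane := by
    rcases hr.lt_or_eq with h | h
    · exact Or.inl h
    · refine Or.inr fun him => hr0 (Complex.ext h.symm him)
  have hseq : Tendsto (fun e : ℝ => r + e) (𝓝[>] 0) (𝓝[{r | 0 ≤ r.re}] r) := by
    refine tendsto_nhdsWithin_iff.2 ⟨?_, ?_⟩
    · have : Continuous fun e : ℝ => r + e := by fun_prop
      simpa using (this.tendsto 0).mono_left nhdsWithin_le_nhds
    · filter_upwards [self_mem_nhdsWithin] with e he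
      have : (0 : ℝ) < e := he
      simp; linarith
  have h1 := ((continuousOn_regGamma hz hz0) r hr).tendsto.comp hseq
  have h2 : Tendsto (fun e : ℝ => Complex.Gamma z * (r + e) ^ (-(z : ℂ))) (𝓝[>] 0)
      (𝓝 (Complex.Gamma z * r ^ (-(z : ℂ)))) := by
    have : ContinuousAt (fun w : ℂ => Complex.Gamma z * w ^ (-(z : ℂ))) r :=
      (continuousAt_id.cpow continuousAt_const hslit).const_mul _
    exact this.tendsto.comp (hseq.mono_right nhdsWithin_le_nhds)
  refine tendsto_nhds_unique (h1.congr' ?_) h2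
  filter_upwards [self_mem_nhdsWithin] with e he
  have : (0 : ℝ) < e := he
  exact regGamma_eq_of_re_pos hz hz0 (by simp; linarith)

/-- The regularised Mellin transform of `t ↦ e^{itu}`. -/
lemma regGamma_imag {z : ℝ} (hz : -1 < z) (hz0 : z < 0) (u : ℝ) :
    regGamma z (-(Complex.I * u)) = Complex.Gamma z *
      (Complex.exp (Complex.I * Real.pi * z / 2) * ((max u 0 : ℝ) : ℂ) ^ (-(z : ℂ)) +
       Complex.exp (-(Complex.I * Real.pi * z / 2)) * ((max (-u) 0 : ℝ) : ℂ) ^ (-(z : ℂ))) := by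
  have hzz : (-(z : ℂ)) ≠ 0 := by
    rw [neg_ne_zero]; exact_mod_cast hz0.ne
  rcases lt_trichotomy u 0 with hu | hu | hu
  · rw [regGamma_eq hz hz0 (by simp) (by simp [hu.ne]), max_eq_right hu.le,
      max_eq_left (by linarith : (0 : ℝ) ≤ -u)]
    have e : -(Complex.I * u) = ((-u : ℝ) : ℂ) * Complex.I := by push_cast; ring
    have hu' : ((-u : ℝ) : ℂ) ≠ 0 := by exact_mod_cast (by linarith : (-u : ℝ) ≠ 0)
    rw [e, Complex.cpow_def_of_ne_zero (mul_ne_zero hu' Complex.I_ne_zero),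
      Complex.log_ofReal_mul (by linarith) Complex.I_ne_zero, Complex.log_I,
      Complex.ofReal_zero, Complex.zero_cpow hzz, mul_zero, zero_add,
      Complex.cpow_def_of_ne_zero hu', ← Complex.exp_add, ← Complex.ofReal_log (by linarith)]
    congr 2
    ring
  · subst hu
    simp [regGamma, hzz]
  · rw [regGamma_eq hz hz0 (by simp) (by simp [hu.ne']), max_eq_left hu.le,
      max_eq_right (by linarith : -u ≤ 0)]
    have e : -(Complex.I * u) = (u : ℂ) * (-Complex.I) := by ring
    have hu' : (u : ℂ) ≠ 0 := by exact_mod_cast hu.ne'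
    have hI : -Complex.I ≠ 0 := neg_ne_zero.2 Complex.I_ne_zero
    rw [e, Complex.cpow_def_of_ne_zero (mul_ne_zero hu' hI),
      Complex.log_ofReal_mul hu hI, Complex.log_neg_I,
      Complex.ofReal_zero, Complex.zero_cpow hzz, mul_zero, add_zero,
      Complex.cpow_def_of_ne_zero hu', ← Complex.exp_add, ← Complex.ofReal_log hu.le]
    congr 2
    ring

section
variable {f : (Fin n → ℝ) → ℝ} {φ : (Fin n → ℝ) → ℂ}

lemma exists_abs_le_of_hasCompactSupport (hf : Continuous f) (hc : HasCompactSupport φ) :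
    ∃ B : ℝ, 0 ≤ B ∧ ∀ x, φ x ≠ 0 → |f x| ≤ B := by
  obtain ⟨B, hB⟩ := hc.isCompact.exists_bound_of_continuousOn (f := f) hf.continuousOn
  refine ⟨max B 0, le_max_right _ _, fun x hx => ?_⟩
  exact (hB x (subset_tsupport _ hx)).trans (le_max_left _ _)

lemma norm_cexp_I_mul_mul (t u : ℝ) : ‖Complex.exp (Complex.I * t * u)‖ = 1 := by
  have : Complex.I * t * u = ((t * u : ℝ) : ℂ) * Complex.I := by push_cast; ring
  rw [this, Complex.norm_exp_ofReal_mul_I]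

lemma continuous_oscInt (hf : Continuous f) (hφ : Continuous φ) (hc : HasCompactSupport φ) :
    Continuous (oscInt f φ) := by
  refine continuous_of_dominated (bound := fun x => ‖φ x‖) ?_ ?_
    (hφ.integrable_of_hasCompactSupport hc).norm ?_
  · exact fun t => Continuous.aestronglyMeasurable (by fun_prop)
  · refine fun t => .of_forall fun x => ?_
    rw [norm_mul, norm_cexp_I_mul_mul, one_mul]
  · exact .of_forall fun x => by fun_prop

lemma oscInt_zero : oscInt f φ 0 = ∫ x, φ x := by simp [oscInt]

lemma integrable_cexp_mul (hf : Continuous f) (hφ : Continuous φ) (hc : HasCompactSupport φ)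
    (t : ℝ) : Integrable fun x => Complex.exp (Complex.I * t * f x) * φ x :=
  Continuous.integrable_of_hasCompactSupport (by fun_prop) hc.mul_left

lemma oscInt_sub_oscInt_zero (hf : Continuous f) (hφ : Continuous φ) (hc : HasCompactSupport φ)
    (t : ℝ) : oscInt f φ t - oscInt f φ 0 =
      ∫ x, (Complex.exp (-(-(Complex.I * f x) * t)) - 1) * φ x := by
  rw [oscInt_zero, oscInt, ← integral_sub (integrable_cexp_mul hf hφ hc t)
    (hφ.integrable_of_hasCompactSupport hc)]
  refine integral_congr_ae (.of_forall fun x => ?_)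
  have : -(-(Complex.I * f x) * t) = Complex.I * t * f x := by ring
  simp only [this]; ring

/-- The oscillatory integral, regularised at `t = 0`. -/
noncomputable def subOsc (f : (Fin n → ℝ) → ℝ) (φ : (Fin n → ℝ) → ℂ) (t : ℝ) : ℂ :=
  oscInt f φ t - oscInt f φ 0 * Complex.exp (-t)

lemma continuous_subOsc (hf : Continuous f) (hφ : Continuous φ) (hc : HasCompactSupport φ) :
    Continuous (subOsc f φ) := by
  have := continuous_oscInt hf hφ hc
  unfold subOsc
  fun_prop

lemma exists_norm_subOsc_le (hf : Continuous f) (hφ : Continuous φ) (hc : HasCompactSupport φ) :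
    ∃ C : ℝ, ∀ t : ℝ, 0 ≤ t → ‖subOsc f φ t‖ ≤ C * t := by
  obtain ⟨B, hB0, hB⟩ := exists_abs_le_of_hasCompactSupport hf hc
  refine ⟨B * (∫ x, ‖φ x‖) + ‖oscInt f φ 0‖, fun t ht => ?_⟩
  have e : subOsc f φ t = (oscInt f φ t - oscInt f φ 0) -
      oscInt f φ 0 * (Complex.exp (-t) - 1) := by rw [subOsc]; ring
  rw [e, add_mul]
  refine (norm_sub_le _ _).trans (add_le_add ?_ ?_)
  · rw [oscInt_sub_oscInt_zero hf hφ hc, mul_assoc, mul_comm _ t, ← mul_assoc,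
      ← integral_const_mul]
    refine norm_integral_le_of_norm_le
      ((hφ.integrable_of_hasCompactSupport hc).norm.const_mul _) (.of_forall fun x => ?_)
    rw [norm_mul]
    by_cases hx : φ x = 0
    · simp [hx]
    gcongr
    refine (norm_exp_neg_sub_one_le (by simp)).trans ((min_le_right _ _).trans ?_)
    rw [norm_mul, norm_neg, norm_mul, Complex.norm_I, Complex.norm_real, Complex.norm_real,
      Real.norm_of_nonneg ht, one_mul]
    gcongr
    exact hB x hx
  · rw [norm_mul]
    gcongr
    refine (norm_exp_neg_sub_one_le (by simpa using ht)).trans ((min_le_right _ _).trans ?_)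
    rw [Complex.norm_real, Real.norm_of_nonneg ht]

lemma integrable_zetaPlus (hf : Continuous f) (hφ : Continuous φ) (hc : HasCompactSupport φ)
    {s : ℂ} (hs : 0 < s.re) : Integrable fun x => ((max (f x) 0 : ℝ) : ℂ) ^ s * φ x := by
  refine Continuous.integrable_of_hasCompactSupport ?_ hc.mul_left
  exact ((Complex.continuous_ofReal_cpow_const hs).comp (hf.max continuous_const)).mul hφ

lemma mellin_subOsc (hf : Continuous f) (hφ : Continuous φ) (hc : HasCompactSupport φ)
    {z : ℝ} (hz : -1 < z) (hz0 : z < 0) :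
    mellin (subOsc f φ) z = Complex.Gamma z *
      (Complex.exp (Complex.I * Real.pi * z / 2) * zetaPlus f φ (-z) +
       Complex.exp (-(Complex.I * Real.pi * z / 2)) * zetaMinus f φ (-z) - oscInt f φ 0) := by
  obtain ⟨B, hB0, hB⟩ := exists_abs_le_of_hasCompactSupport hf hc
  have hφi := hφ.integrable_of_hasCompactSupport (μ := volume) hc
  have hs : 0 < (-(z : ℂ)).re := by simpa using hz0
  set F : ℝ → (Fin n → ℝ) → ℂ := fun t x =>
    ((t ^ (z - 1) : ℝ) : ℂ) * (Complex.exp (-(-(Complex.I * f x) * t)) - 1) * φ x with hF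
  have hFi : Integrable (Function.uncurry F) ((volume.restrict (Ioi 0)).prod volume) := by
    have hb := (integrableOn_rpow_mul_min hz hz0 hB0).mul_prod hφi.norm
    refine Integrable.mono' hb ?_ ?_
    · refine Measurable.aestronglyMeasurable ?_
      have h1 := hf.measurable
      have h2 := hφ.measurable
      simp only [hF, Function.uncurry_def]
      fun_prop
    · have : ∀ᵐ p : ℝ × (Fin n → ℝ) ∂((volume.restrict (Ioi 0)).prod volume), p.1 ∈ Ioi (0 : ℝ) :=
        Measure.quasiMeasurePreserving_fst.ae (ae_restrict_mem measurableSet_Ioi)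
      filter_upwards [this] with p hp
      simp only [hF, Function.uncurry_def, norm_mul _ (φ _)]
      by_cases hx : φ p.2 = 0
      · simp [hx]
      gcongr
      refine norm_regGamma_integrand_le z (by simp) ?_ hp
      simpa using hB _ hx
  have h1 : mellin (subOsc f φ) z = (∫ t in Ioi (0 : ℝ), ∫ x, F t x) -
      ∫ t in Ioi (0 : ℝ), oscInt f φ 0 *
        (((t ^ (z - 1) : ℝ) : ℂ) * (Complex.exp (-((1 : ℂ) * t)) - 1)) := by
    have h0 : Integrable (fun t => ∫ x, F t x) (volume.restrict (Ioi 0)) :=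
      hFi.integral_prod_left
    rw [mellin, ← integral_sub h0
      ((integrableOn_regGamma hz hz0 (by simp)).const_mul _)]
    refine setIntegral_congr_fun measurableSet_Ioi fun t ht => ?_
    have ht0 : 0 < t := ht
    have e : subOsc f φ t = (oscInt f φ t - oscInt f φ 0) -
      oscInt f φ 0 * (Complex.exp (-t) - 1) := by rw [subOsc]; ring
    simp only [hF, mul_assoc _ _ (φ _), one_mul]
    rw [integral_const_mul, ← oscInt_sub_oscInt_zero hf hφ hc, e, smul_eq_mul]
    have : (t : ℂ) ^ ((z : ℂ) - 1) = ((t ^ (z - 1) : ℝ) : ℂ) := by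
      rw [Complex.ofReal_cpow ht0.le]; push_cast; rfl
    rw [this]; ring
  rw [h1, integral_integral_swap hFi, integral_const_mul]
  change _ - oscInt f φ 0 * regGamma z 1 = _
  have h2 : ∀ x, ∫ t in Ioi (0 : ℝ), F t x = Complex.Gamma z *
      (Complex.exp (Complex.I * Real.pi * z / 2) *
          (((max (f x) 0 : ℝ) : ℂ) ^ (-(z : ℂ)) * φ x) +
        Complex.exp (-(Complex.I * Real.pi * z / 2)) *
          (((max (-f x) 0 : ℝ) : ℂ) ^ (-(z : ℂ)) * φ x)) := by
    intro x
    simp only [hF]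
    rw [integral_mul_const]
    change regGamma z (-(Complex.I * f x)) * _ = _
    rw [regGamma_imag hz hz0]; ring
  simp only [h2]
  have h3 : Integrable fun x => ((max (-f x) 0 : ℝ) : ℂ) ^ (-(z : ℂ)) * φ x :=
    integrable_zetaPlus hf.neg hφ hc hs
  rw [integral_const_mul, integral_add ((integrable_zetaPlus hf hφ hc hs).const_mul _)
    (h3.const_mul _), integral_const_mul, integral_const_mul,
    regGamma_one hz hz0, zetaPlus, zetaMinus]
  ring

end

lemma one_add_pow_le_exp (k : ℕ) {Y : ℝ} (hY : 0 ≤ Y) {c : ℝ} (hc : 0 < c) :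
    (1 + Y) ^ k ≤ k.factorial / c ^ k * Real.exp c * Real.exp (c * Y) := by
  have h := Real.pow_div_factorial_le_exp (c * (1 + Y)) (by positivity) k
  have hk : (0 : ℝ) < k.factorial := by positivity
  rw [div_le_iff₀ hk, mul_pow, mul_add, mul_one, Real.exp_add] at h
  have hc' : 0 < c ^ k := by positivity
  calc (1 + Y) ^ k = c ^ k * (1 + Y) ^ k / c ^ k := by field_simp
    _ ≤ (Real.exp c * Real.exp (c * Y) * k.factorial) / c ^ k := by gcongr
    _ = _ := by ring

section
variable {J : ℝ → ℂ} {κ : ℝ} {k : ℕ} {L : ℂ}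

lemma exists_bound_of_tendsto_rpow_log (hJ : Continuous J)
    (hL : Tendsto (fun t : ℝ => ((t ^ κ : ℝ) : ℂ) * (((Real.log t) ^ k : ℝ) : ℂ)⁻¹ * J t)
      atTop (𝓝 L)) :
    ∃ C : ℝ, 0 ≤ C ∧ ∀ t : ℝ, 1 ≤ t → t ^ κ * ‖J t‖ ≤ C * (1 + Real.log t) ^ k := by
  have h1 : ∀ᶠ t : ℝ in atTop,
      ‖((t ^ κ : ℝ) : ℂ) * (((Real.log t) ^ k : ℝ) : ℂ)⁻¹ * J t‖ < ‖L‖ + 1 :=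
    hL.norm.eventually (gt_mem_nhds (by linarith))
  obtain ⟨t0, ht0⟩ := eventually_atTop.1 (h1.and (eventually_gt_atTop 1))
  have hcont : ContinuousOn (fun t : ℝ => t ^ κ * ‖J t‖) (Icc 1 t0) := by
    refine ContinuousOn.mul (fun t ht => ?_) hJ.norm.continuousOn
    exact (Real.continuousAt_rpow_const _ _ (Or.inl (by linarith [ht.1]))).continuousWithinAt
  obtain ⟨B, hB⟩ := isCompact_Icc.exists_bound_of_continuousOn hcont
  refine ⟨max B 0 + (‖L‖ + 1), by positivity, fun t ht => ?_⟩
  have hlog : 0 ≤ Real.log t := Real.log_nonneg ht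
  rcases le_or_gt t0 t with h | h
  · obtain ⟨h2, h3⟩ := ht0 t h
    have hlog' : 0 < Real.log t := Real.log_pos h3
    have ht' : 0 < t := by linarith
    rw [norm_mul, norm_mul, norm_inv, Complex.norm_real, Complex.norm_real,
      Real.norm_of_nonneg (by positivity), Real.norm_of_nonneg (by positivity)] at h2
    have h4 : t ^ κ * ‖J t‖ = t ^ κ * (Real.log t ^ k)⁻¹ * ‖J t‖ * Real.log t ^ k := by
      field_simp
    rw [h4]
    gcongr
    · exact h2.le.trans (by linarith [le_max_right B 0])
    · linarith
  · have h2 := hB t ⟨ht, h.le⟩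
    rw [Real.norm_eq_abs] at h2
    calc t ^ κ * ‖J t‖ ≤ B := (le_abs_self _).trans h2
      _ ≤ (max B 0 + (‖L‖ + 1)) * 1 := by linarith [le_max_left B 0, norm_nonneg L]
      _ ≤ _ := by gcongr; exact one_le_pow₀ (by linarith)

lemma isBigO_rpow_of_tendsto_rpow_log (hJ : Continuous J)
    (hL : Tendsto (fun t : ℝ => ((t ^ κ : ℝ) : ℂ) * (((Real.log t) ^ k : ℝ) : ℂ)⁻¹ * J t)
      atTop (𝓝 L)) {a : ℝ} (ha' : a < κ) : J =O[atTop] (· ^ (-a)) := by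
  obtain ⟨C, hC0, hC⟩ := exists_bound_of_tendsto_rpow_log hJ hL
  have hd : 0 < κ - a := by linarith
  refine Asymptotics.IsBigO.of_bound (C * (k.factorial / (κ - a) ^ k * Real.exp (κ - a))) ?_
  filter_upwards [eventually_ge_atTop 1] with t ht
  have ht0 : 0 < t := by linarith
  have h1 := hC t ht
  have h2 := one_add_pow_le_exp k (Real.log_nonneg ht) hd
  have h3 : Real.exp ((κ - a) * Real.log t) = t ^ (-a) * t ^ κ := by
    rw [← Real.rpow_add ht0, Real.rpow_def_of_pos ht0]; ring_nf
  rw [h3] at h2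
  rw [Real.norm_of_nonneg (by positivity)]
  have h4 : 0 < t ^ κ := by positivity
  refine le_of_mul_le_mul_left (h1.trans ?_) h4
  calc C * (1 + Real.log t) ^ k ≤ C * _ := mul_le_mul_of_nonneg_left h2 hC0
    _ = _ := by ring

lemma isBigO_rpow_zero {C₀ : ℝ} (hJ0 : ∀ t, 0 ≤ t → ‖J t‖ ≤ C₀ * t) :
    J =O[𝓝[>] 0] (· ^ (-(-1 : ℝ))) := by
  refine Asymptotics.IsBigO.of_bound C₀ ?_
  filter_upwards [self_mem_nhdsWithin] with t ht
  have ht0 : 0 < t := ht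
  simpa [abs_of_pos ht0] using hJ0 t ht0.le

lemma differentiableAt_mellin_of_tendsto {C₀ : ℝ} (hJ : Continuous J)
    (hJ0 : ∀ t, 0 ≤ t → ‖J t‖ ≤ C₀ * t)
    (hL : Tendsto (fun t : ℝ => ((t ^ κ : ℝ) : ℂ) * (((Real.log t) ^ k : ℝ) : ℂ)⁻¹ * J t)
      atTop (𝓝 L)) {z : ℂ} (hz : -1 < z.re) (hz' : z.re < κ) :
    DifferentiableAt ℂ (mellin J) z := by
  obtain ⟨a, ha, ha'⟩ := exists_between hz'
  exact mellin_differentiableAt_of_isBigO_rpow (hJ.locallyIntegrable.locallyIntegrableOn _)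
    (isBigO_rpow_of_tendsto_rpow_log hJ hL ha') ha (isBigO_rpow_zero hJ0) hz

lemma integral_Ioi_one_rpow_mul {δ : ℝ} (hδ : 0 < δ) :
    (δ : ℂ) ^ (k + 1) * ∫ t in Ioi (1 : ℝ), ((t ^ (κ - δ - 1) : ℝ) : ℂ) * J t =
      ∫ Y in Ioi (0 : ℝ), ((Real.exp (-Y) : ℝ) : ℂ) *
        ((δ : ℂ) ^ k * ((Real.exp (Y / δ) ^ κ : ℝ) * J (Real.exp (Y / δ)))) := by
  have himg : (fun Y : ℝ => Real.exp (Y / δ)) '' Ioi 0 = Ioi 1 := by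
    ext t
    constructor
    · rintro ⟨Y, hY, rfl⟩
      have : 0 < Y := hY
      exact Real.one_lt_exp_iff.2 (by positivity)
    · intro ht
      have : (1 : ℝ) < t := ht
      have h2 := Real.log_pos this
      refine ⟨δ * Real.log t, mul_pos hδ h2, ?_⟩
      change Real.exp (δ * Real.log t / δ) = t
      rw [mul_div_cancel_left₀ _ hδ.ne', Real.exp_log (by linarith)]
  have hder : ∀ Y ∈ Ioi (0 : ℝ), HasDerivWithinAt (fun Y : ℝ => Real.exp (Y / δ))
      (Real.exp (Y / δ) * (1 / δ)) (Ioi 0) Y := fun Y _ =>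
    (((hasDerivAt_id Y).div_const δ).exp).hasDerivWithinAt
  have hinj : InjOn (fun Y : ℝ => Real.exp (Y / δ)) (Ioi 0) := by
    intro a _ b _ h
    have := Real.exp_injective h
    field_simp at this
    exact this
  rw [← himg, integral_image_eq_integral_abs_deriv_smul measurableSet_Ioi hder hinj,
    ← integral_const_mul]
  refine setIntegral_congr_fun measurableSet_Ioi fun Y hY => ?_
  have hE : 0 < Real.exp (Y / δ) := Real.exp_pos _
  rw [abs_of_pos (by positivity), Complex.real_smul]
  have h1 : Real.exp (Y / δ) ^ (κ - δ - 1) * Real.exp (Y / δ) =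
      Real.exp (Y / δ) ^ κ * Real.exp (-Y) := by
    rw [← Real.rpow_add_one hE.ne', ← Real.exp_mul, ← Real.exp_mul, ← Real.exp_add]
    congr 1; field_simp; ring
  have hδ' : (δ : ℂ) ≠ 0 := by exact_mod_cast hδ.ne'
  have h1' : ((Real.exp (Y / δ) ^ (κ - δ - 1) : ℝ) : ℂ) * (Real.exp (Y / δ) : ℝ) =
      ((Real.exp (Y / δ) ^ κ : ℝ) : ℂ) * (Real.exp (-Y) : ℝ) := by exact_mod_cast h1
  rw [Complex.ofReal_mul, Complex.ofReal_div, Complex.ofReal_one, pow_succ]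
  field_simp
  linear_combination (J (Real.exp (Y / δ))) * h1'

lemma tendsto_pow_mul_mellin {C₀ : ℝ} (hκ : 0 < κ) (hJ : Continuous J)
    (hJ0 : ∀ t, 0 ≤ t → ‖J t‖ ≤ C₀ * t)
    (hL : Tendsto (fun t : ℝ => ((t ^ κ : ℝ) : ℂ) * (((Real.log t) ^ k : ℝ) : ℂ)⁻¹ * J t)
      atTop (𝓝 L)) :
    Tendsto (fun δ : ℝ => (δ : ℂ) ^ (k + 1) * mellin J ((κ - δ : ℝ) : ℂ)) (𝓝[>] 0)
      (𝓝 (L * k.factorial)) := by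
  obtain ⟨C, hC0, hC⟩ := exists_bound_of_tendsto_rpow_log hJ hL
  have hev : ∀ᶠ δ : ℝ in 𝓝[>] 0, 0 < δ ∧ δ < 1 ∧ δ < κ := by
    filter_upwards [self_mem_nhdsWithin, nhdsWithin_le_nhds (gt_mem_nhds (zero_lt_one' ℝ)),
      nhdsWithin_le_nhds (gt_mem_nhds hκ)] with δ h1 h2 h3
    exact ⟨h1, h2, h3⟩
  have hsplit : ∀ᶠ δ : ℝ in 𝓝[>] 0,
      (δ : ℂ) ^ (k + 1) * (∫ t in Ioc (0 : ℝ) 1, ((t ^ (κ - δ - 1) : ℝ) : ℂ) * J t) +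
      (∫ Y in Ioi (0 : ℝ), ((Real.exp (-Y) : ℝ) : ℂ) *
        ((δ : ℂ) ^ k * ((Real.exp (Y / δ) ^ κ : ℝ) * J (Real.exp (Y / δ))))) =
      (δ : ℂ) ^ (k + 1) * mellin J ((κ - δ : ℝ) : ℂ) := by
    filter_upwards [hev] with δ hδ
    have hconv : MellinConvergent J ((κ - δ : ℝ) : ℂ) := by
      obtain ⟨a, ha, ha'⟩ := exists_between (show κ - δ < κ by linarith)
      exact mellinConvergent_of_isBigO_rpow (hJ.locallyIntegrable.locallyIntegrableOn _)
        (isBigO_rpow_of_tendsto_rpow_log hJ hL ha') (by simpa using ha) (isBigO_rpow_zero hJ0)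
        (by simp; linarith)
    have hcongr : ∀ t ∈ Ioi (0 : ℝ), (t : ℂ) ^ (((κ - δ : ℝ) : ℂ) - 1) • J t =
        ((t ^ (κ - δ - 1) : ℝ) : ℂ) * J t := by
      intro t ht
      have ht0 : 0 < t := ht
      rw [Complex.ofReal_cpow ht0.le, smul_eq_mul]
      push_cast
      rfl
    have hJint : IntegrableOn (fun t : ℝ => ((t ^ (κ - δ - 1) : ℝ) : ℂ) * J t) (Ioi 0) :=
      IntegrableOn.congr_fun hconv hcongr measurableSet_Ioi
    rw [← integral_Ioi_one_rpow_mul hδ.1, ← mul_add, mellin,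
      setIntegral_congr_fun measurableSet_Ioi hcongr, ← Ioc_union_Ioi_eq_Ioi (zero_le_one' ℝ),
      setIntegral_union Ioc_disjoint_Ioi_same measurableSet_Ioi
        (hJint.mono_set Ioc_subset_Ioi_self) (hJint.mono_set (Ioi_subset_Ioi zero_le_one))]
  refine Tendsto.congr' hsplit ?_
  rw [← zero_add (L * _)]
  refine Tendsto.add ?_ ?_
  · have hC₀ : 0 ≤ C₀ := by simpa using (norm_nonneg _).trans (hJ0 1 zero_le_one)
    have h0 : Tendsto (fun δ : ℝ => δ ^ (k + 1) * C₀) (𝓝[>] 0) (𝓝 0) := by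
      have : Continuous fun δ : ℝ => δ ^ (k + 1) * C₀ := by fun_prop
      simpa using (this.tendsto 0).mono_left nhdsWithin_le_nhds
    refine squeeze_zero_norm' ?_ h0
    filter_upwards [hev] with δ hδ
    rw [norm_mul, norm_pow, Complex.norm_real, Real.norm_of_nonneg hδ.1.le]
    have h2 : (0 : ℝ) ≤ δ ^ (k + 1) := pow_nonneg hδ.1.le _
    refine mul_le_mul_of_nonneg_left ?_ h2
    have := norm_setIntegral_le_of_norm_le_const (μ := volume) (s := Ioc (0 : ℝ) 1) (C := C₀)
      (f := fun t : ℝ => ((t ^ (κ - δ - 1) : ℝ) : ℂ) * J t) (by simp) (fun t ht => ?_)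
    · simpa using this
    · have ht0 : 0 < t := ht.1
      rw [norm_mul, Complex.norm_real, Real.norm_of_nonneg (by positivity)]
      calc t ^ (κ - δ - 1) * ‖J t‖ ≤ t ^ (κ - δ - 1) * (C₀ * t) := by gcongr; exact hJ0 t ht0.le
        _ = C₀ * t ^ (κ - δ) := by rw [Real.rpow_sub_one ht0.ne']; field_simp
        _ ≤ C₀ * 1 := by gcongr; exact Real.rpow_le_one ht0.le ht.2 (by linarith)
        _ = C₀ := mul_one _
  · have hfac : L * (k.factorial : ℂ) =
        ∫ Y in Ioi (0 : ℝ), ((Real.exp (-Y) : ℝ) : ℂ) * (((Y ^ k : ℝ) : ℂ) * L) := by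
      have h1 := Real.Gamma_eq_integral (s := (k : ℝ) + 1) (by positivity)
      rw [Real.Gamma_nat_eq_factorial] at h1
      have h2 : ((k.factorial : ℝ) : ℂ) =
          ∫ Y in Ioi (0 : ℝ), ((Real.exp (-Y) * Y ^ k : ℝ) : ℂ) := by
        rw [integral_complex_ofReal, h1]
        simp
      rw [Complex.ofReal_natCast] at h2
      rw [h2, mul_comm, ← integral_mul_const]
      congr 1; ext Y; push_cast; ring
    rw [hfac]
    refine tendsto_integral_filter_of_dominated_convergence
      (fun Y => C * (k.factorial / (1 / 2) ^ k * Real.exp (1 / 2)) * Real.exp (-(1 / 2) * Y))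
      ?_ ?_ ((exp_neg_integrableOn_Ioi 0 (by norm_num)).const_mul _) ?_
    · filter_upwards [hev] with δ hδ
      refine Continuous.aestronglyMeasurable ?_
      have : Continuous fun Y : ℝ => Real.exp (Y / δ) ^ κ :=
        Continuous.rpow_const (by fun_prop) fun Y => Or.inl (Real.exp_pos _).ne'
      fun_prop
    · filter_upwards [hev] with δ hδ
      refine (ae_restrict_iff' measurableSet_Ioi).2 (.of_forall fun Y hY => ?_)
      have hY0 : 0 < Y := hY
      have hE : 1 ≤ Real.exp (Y / δ) := Real.one_le_exp (div_nonneg hY0.le hδ.1.le)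
      have h1 := hC _ hE
      rw [Real.log_exp] at h1
      have h2 := one_add_pow_le_exp k hY0.le (show (0 : ℝ) < 1 / 2 by norm_num)
      have h3 : δ ^ k * (1 + Y / δ) ^ k ≤ (1 + Y) ^ k := by
        have : 0 ≤ Y / δ := div_nonneg hY0.le hδ.1.le
        rw [← mul_pow]
        have h5 : 0 ≤ δ * (1 + Y / δ) := mul_nonneg hδ.1.le (by linarith)
        gcongr
        rw [mul_add, mul_div_cancel₀ _ hδ.1.ne']; linarith [hδ.2.1]
      rw [norm_mul, norm_mul, norm_mul, norm_pow, Complex.norm_real, Complex.norm_real,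
        Complex.norm_real, Real.norm_of_nonneg (by positivity), Real.norm_of_nonneg hδ.1.le,
        Real.norm_of_nonneg (by positivity)]
      have hδk : 0 ≤ δ ^ k := pow_nonneg hδ.1.le _
      have h6 : Real.exp (-(1 / 2) * Y) = Real.exp (-Y) * Real.exp (1 / 2 * Y) := by
        rw [← Real.exp_add]; congr 1; ring
      calc _ ≤ Real.exp (-Y) * (δ ^ k * (C * (1 + Y / δ) ^ k)) := by gcongr
        _ = Real.exp (-Y) * (C * (δ ^ k * (1 + Y / δ) ^ k)) := by ring
        _ ≤ Real.exp (-Y) * (C * (k.factorial / (1 / 2) ^ k * Real.exp (1 / 2) *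
            Real.exp (1 / 2 * Y))) := by
              have := h3.trans h2
              have hE0 := Real.exp_pos (-Y)
              exact mul_le_mul_of_nonneg_left (mul_le_mul_of_nonneg_left this hC0) hE0.le
        _ = _ := by rw [h6]; ring
    · refine (ae_restrict_iff' measurableSet_Ioi).2 (.of_forall fun Y hY => ?_)
      have hY0 : 0 < Y := hY
      refine Tendsto.const_mul _ ?_
      have hexp : Tendsto (fun δ : ℝ => Real.exp (Y / δ)) (𝓝[>] 0) atTop :=
        Real.tendsto_exp_atTop.comp ((tendsto_inv_nhdsGT_zero).const_mul_atTop hY0)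
      refine ((hL.comp hexp).const_mul (((Y ^ k : ℝ) : ℂ))).congr' ?_
      filter_upwards [hev] with δ hδ
      simp only [Function.comp_apply, Real.log_exp]
      have hδ' : (δ : ℂ) ≠ 0 := by exact_mod_cast hδ.1.ne'
      have hY' : (Y : ℂ) ≠ 0 := by exact_mod_cast hY0.ne'
      push_cast
      rw [div_pow]
      field_simp

end

/-- A meromorphic function on a connected open set vanishing near one point vanishes at all
points where it is analytic. -/
lemma eq_zero_of_meromorphicOn {D : ℂ → ℂ} {Ω : Set ℂ} (hD : MeromorphicOn D Ω)
    (hΩ : IsPreconnected Ω) {w₀ z : ℂ} (hw₀ : w₀ ∈ Ω) (hfreq : ∃ᶠ w in 𝓝[≠] w₀, D w = 0)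
    (hz : z ∈ Ω) (hDz : ContinuousAt D z) : D z = 0 := by
  have h1 : ∀ᶠ w in 𝓝[≠] w₀, D w = 0 :=
    (hD w₀ hw₀).eventually_eq_zero_or_eventually_ne_zero.resolve_right
      (fun h => hfreq (h.mono fun w hw => hw))
  have h2 : meromorphicOrderAt D z = ⊤ := by
    by_contra h
    exact hD.meromorphicOrderAt_ne_top_of_isPreconnected hΩ hz hw₀ h
      (meromorphicOrderAt_eq_top_iff.2 h1)
  rw [meromorphicOrderAt_eq_top_iff] at h2
  refine tendsto_nhds_unique ((hDz.tendsto.mono_left nhdsWithin_le_nhds : Tendsto D (𝓝[≠] z) _))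
    (Tendsto.congr' (h2.mono fun w hw => hw.symm) tendsto_const_nhds)

theorem mellin_transfer {f : (Fin n → ℝ) → ℝ} {φ : (Fin n → ℝ) → ℂ} (hf : Continuous f)
    (hφ : Continuous φ) (hc : HasCompactSupport φ) {κ : ℝ} (hκ : 0 < κ) {k : ℕ}
    {Zp Zm : ℂ → ℂ}
    (hZp : MeromorphicOn Zp univ) (hZp' : ∀ s : ℂ, 0 < s.re → Zp s = zetaPlus f φ s)
    (hZm : MeromorphicOn Zm univ) (hZm' : ∀ s : ℂ, 0 < s.re → Zm s = zetaMinus f φ s)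
    {Cp Cm L : ℂ}
    (hCp : Tendsto (fun s : ℂ => (s + (κ : ℂ)) ^ (k + 1) * Zp s) (𝓝[≠] ((-κ : ℝ) : ℂ)) (𝓝 Cp))
    (hCm : Tendsto (fun s : ℂ => (s + (κ : ℂ)) ^ (k + 1) * Zm s) (𝓝[≠] ((-κ : ℝ) : ℂ)) (𝓝 Cm))
    (hL : Tendsto (fun t : ℝ => ((t ^ κ : ℝ) : ℂ) * (((Real.log t) ^ k : ℝ) : ℂ)⁻¹ *
      oscInt f φ t) atTop (𝓝 L)) :
    L = ((Real.Gamma κ / (k.factorial : ℝ) : ℝ) : ℂ) *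
      (Complex.exp (Complex.I * Real.pi * κ / 2) * Cp +
       Complex.exp (-(Complex.I * Real.pi * κ / 2)) * Cm) := by
  have hJc := continuous_subOsc hf hφ hc
  obtain ⟨C₀, hJ0⟩ := exists_norm_subOsc_le hf hφ hc
  have hLJ : Tendsto (fun t : ℝ => ((t ^ κ : ℝ) : ℂ) * (((Real.log t) ^ k : ℝ) : ℂ)⁻¹ *
      subOsc f φ t) atTop (𝓝 L) := by
    have h0 : Tendsto (fun t : ℝ => ((t ^ κ : ℝ) : ℂ) * (((Real.log t) ^ k : ℝ) : ℂ)⁻¹ *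
        (oscInt f φ 0 * Complex.exp (-t))) atTop (𝓝 0) := by
      have h1 := (tendsto_rpow_mul_exp_neg_mul_atTop_nhds_zero κ 1 one_pos).mul_const
        ‖oscInt f φ 0‖
      rw [zero_mul] at h1
      refine squeeze_zero_norm' ?_ h1
      filter_upwards [eventually_ge_atTop (Real.exp 1)] with t ht
      have ht0 : 0 < t := (Real.exp_pos 1).trans_le ht
      have hlog : 1 ≤ Real.log t := (Real.le_log_iff_exp_le ht0).2 ht
      have hlk : 1 ≤ Real.log t ^ k := one_le_pow₀ hlog
      rw [norm_mul, norm_mul, norm_mul, norm_inv, Complex.norm_real, Complex.norm_real,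
        Real.norm_of_nonneg (by positivity), Real.norm_of_nonneg (by positivity),
        Complex.norm_exp]
      simp only [Complex.neg_re, Complex.ofReal_re, neg_mul, one_mul]
      calc t ^ κ * (Real.log t ^ k)⁻¹ * (‖oscInt f φ 0‖ * Real.exp (-t))
          ≤ t ^ κ * 1 * (‖oscInt f φ 0‖ * Real.exp (-t)) := by
            gcongr; exact inv_le_one_of_one_le₀ hlk
        _ = _ := by ring
    have := hL.sub h0
    rw [sub_zero] at this
    refine this.congr fun t => ?_
    rw [subOsc]; ring
  set A : ℂ → ℂ := fun z => z * mellin (subOsc f φ) z with hA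
  set B : ℂ → ℂ := fun z => Complex.Gamma (z + 1) *
      (Complex.exp (Complex.I * Real.pi * z / 2) * Zp (-z) +
       Complex.exp (-(Complex.I * Real.pi * z / 2)) * Zm (-z) - oscInt f φ 0) with hB
  set Ω : Set ℂ := {z | -1 < z.re} ∩ {z | z.re < κ} with hΩ
  have hΩo : IsOpen Ω := (isOpen_lt continuous_const Complex.continuous_re).inter
    (isOpen_lt Complex.continuous_re continuous_const)
  have hΩc : IsPreconnected Ω :=
    ((convex_halfSpace_re_gt _).inter (convex_halfSpace_re_lt _)).isPreconnected
  have hAan : ∀ z ∈ Ω, AnalyticAt ℂ A z := by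
    have : DifferentiableOn ℂ A Ω := fun z hz =>
      (differentiableAt_id.mul
        (differentiableAt_mellin_of_tendsto hJc hJ0 hLJ hz.1 hz.2)).differentiableWithinAt
    exact fun z hz => this.analyticAt (hΩo.mem_nhds hz)
  have hGan : ∀ z : ℂ, -1 < z.re → AnalyticAt ℂ (fun z => Complex.Gamma (z + 1)) z := by
    have : DifferentiableOn ℂ (fun z => Complex.Gamma (z + 1)) {z | -1 < z.re} := by
      intro z hz
      have hz' : -1 < z.re := hz
      refine DifferentiableAt.differentiableWithinAt ?_
      refine (Complex.differentiableAt_Gamma (z + 1) fun m h => ?_).comp z (by fun_prop)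
      have := congrArg Complex.re h
      simp at this
      have hm : (0 : ℝ) ≤ m := by positivity
      linarith
    exact fun z hz => this.analyticAt
      ((isOpen_lt continuous_const Complex.continuous_re).mem_nhds hz)
  have hBmer : ∀ z : ℂ, -1 < z.re → MeromorphicAt B z := by
    intro z hz
    have h1 : MeromorphicAt (fun z => Zp (-z)) z :=
      (hZp (-z) (mem_univ _)).comp_analyticAt (g := fun z => -z) (by fun_prop)
    have h2 : MeromorphicAt (fun z => Zm (-z)) z :=
      (hZm (-z) (mem_univ _)).comp_analyticAt (g := fun z => -z) (by fun_prop)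
    have h3 : AnalyticAt ℂ (fun z => Complex.exp (Complex.I * Real.pi * z / 2)) z := by fun_prop
    have h4 : AnalyticAt ℂ (fun z => Complex.exp (-(Complex.I * Real.pi * z / 2))) z := by
      fun_prop
    exact (hGan z hz).meromorphicAt.mul
      (((h3.meromorphicAt.mul h1).add (h4.meromorphicAt.mul h2)).sub (MeromorphicAt.const _ _))
  have hDmer : MeromorphicOn (fun z => A z - B z) Ω := fun z hz =>
    (hAan z hz).meromorphicAt.sub (hBmer z hz.1)
  have hreal : ∀ z : ℝ, -1 < z → z < 0 → A z - B z = 0 := by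
    intro z hz hz0
    have hs : 0 < (-(z : ℂ)).re := by simpa using hz0
    have hzz : (z : ℂ) ≠ 0 := by exact_mod_cast hz0.ne
    simp only [hA, hB]
    rw [mellin_subOsc hf hφ hc hz hz0, hZp' _ hs, hZm' _ hs, Complex.Gamma_add_one _ hzz]
    ring
  have hAB : ∀ᶠ δ : ℝ in 𝓝[>] 0, A ((κ - δ : ℝ) : ℂ) = B ((κ - δ : ℝ) : ℂ) := by
    have hseq : Tendsto (fun δ : ℝ => ((κ - δ : ℝ) : ℂ)) (𝓝[>] 0) (𝓝[≠] (κ : ℂ)) := by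
      refine tendsto_nhdsWithin_iff.2 ⟨?_, ?_⟩
      · have : Continuous fun δ : ℝ => ((κ - δ : ℝ) : ℂ) := by fun_prop
        simpa using (this.tendsto 0).mono_left nhdsWithin_le_nhds
      · filter_upwards [self_mem_nhdsWithin] with δ hδ h
        have hδ0 : (0 : ℝ) < δ := hδ
        have h2 : ((κ - δ : ℝ) : ℂ) = (κ : ℂ) := h
        have h3 : κ - δ = κ := by exact_mod_cast h2
        linarith
    have hBan := hseq.eventually (hBmer κ (by simp; linarith)).eventually_analyticAt
    filter_upwards [hBan, self_mem_nhdsWithin, nhdsWithin_le_nhds (gt_mem_nhds hκ)]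
      with δ h1 h2 h3
    have h2' : (0 : ℝ) < δ := h2
    have hmem : ((κ - δ : ℝ) : ℂ) ∈ Ω := ⟨by simp; linarith, by simp; linarith⟩
    have hw₀ : ((-(1 / 2) : ℝ) : ℂ) ∈ Ω := by
      refine ⟨?_, ?_⟩
      · simp; norm_num
      · simp; linarith
    refine sub_eq_zero.1 (eq_zero_of_meromorphicOn hDmer hΩc hw₀ ?_ hmem
      ((hAan _ hmem).continuousAt.sub h1.continuousAt))
    have hs2 : Tendsto (fun e : ℝ => ((-(1 / 2) + e : ℝ) : ℂ)) (𝓝[>] 0)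
        (𝓝[≠] ((-(1 / 2) : ℝ) : ℂ)) := by
      refine tendsto_nhdsWithin_iff.2 ⟨?_, ?_⟩
      · have : Continuous fun e : ℝ => ((-(1 / 2) + e : ℝ) : ℂ) := by fun_prop
        simpa using (this.tendsto 0).mono_left nhdsWithin_le_nhds
      · filter_upwards [self_mem_nhdsWithin] with e he h
        have he0 : (0 : ℝ) < e := he
        have h3 : -(1 / 2) + e = -(1 / 2) := Complex.ofReal_injective h
        linarith
    refine hs2.frequently (Eventually.frequently ?_)
    filter_upwards [self_mem_nhdsWithin, nhdsWithin_le_nhds (gt_mem_nhds one_half_pos)]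
      with e he he2
    have he0 : (0 : ℝ) < e := he
    exact hreal _ (by linarith) (by linarith)
  have hlim1 : Tendsto (fun δ : ℝ => (δ : ℂ) ^ (k + 1) * A ((κ - δ : ℝ) : ℂ)) (𝓝[>] 0)
      (𝓝 (κ * (L * k.factorial))) := by
    have h1 : Tendsto (fun δ : ℝ => ((κ - δ : ℝ) : ℂ)) (𝓝[>] 0) (𝓝 (κ : ℂ)) := by
      have : Continuous fun δ : ℝ => ((κ - δ : ℝ) : ℂ) := by fun_prop
      simpa using (this.tendsto 0).mono_left nhdsWithin_le_nhds
    refine (h1.mul (tendsto_pow_mul_mellin hκ hJc hJ0 hLJ)).congr fun δ => ?_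
    simp only [hA]; ring
  have hlim2 : Tendsto (fun δ : ℝ => (δ : ℂ) ^ (k + 1) * B ((κ - δ : ℝ) : ℂ)) (𝓝[>] 0)
      (𝓝 (Complex.Gamma (κ + 1) * (Complex.exp (Complex.I * Real.pi * κ / 2) * Cp +
       Complex.exp (-(Complex.I * Real.pi * κ / 2)) * Cm - 0 * oscInt f φ 0))) := by
    have h1 : Tendsto (fun δ : ℝ => ((κ - δ : ℝ) : ℂ)) (𝓝[>] 0) (𝓝 (κ : ℂ)) := by
      have : Continuous fun δ : ℝ => ((κ - δ : ℝ) : ℂ) := by fun_prop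
      simpa using (this.tendsto 0).mono_left nhdsWithin_le_nhds
    have hs : Tendsto (fun δ : ℝ => -((κ - δ : ℝ) : ℂ)) (𝓝[>] 0) (𝓝[≠] ((-κ : ℝ) : ℂ)) := by
      refine tendsto_nhdsWithin_iff.2 ⟨by simpa using h1.neg, ?_⟩
      filter_upwards [self_mem_nhdsWithin] with δ hδ h
      have hδ0 : (0 : ℝ) < δ := hδ
      have h2 : ((-(κ - δ) : ℝ) : ℂ) = ((-κ : ℝ) : ℂ) := by rw [Complex.ofReal_neg]; exact h
      have h3 := Complex.ofReal_injective h2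
      linarith
    have hδ : Tendsto (fun δ : ℝ => (δ : ℂ) ^ (k + 1)) (𝓝[>] 0) (𝓝 0) := by
      have : Continuous fun δ : ℝ => (δ : ℂ) ^ (k + 1) := by fun_prop
      simpa using (this.tendsto 0).mono_left nhdsWithin_le_nhds
    have hG : Tendsto (fun z => Complex.Gamma (z + 1)) (𝓝 (κ : ℂ)) _ :=
      (hGan κ (by simp; linarith)).continuousAt.tendsto
    have hE1 : Continuous fun z : ℂ => Complex.exp (Complex.I * Real.pi * z / 2) := by fun_prop
    have hE2 : Continuous fun z : ℂ => Complex.exp (-(Complex.I * Real.pi * z / 2)) := by fun_prop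
    refine ((hG.comp h1).mul (((((hE1.tendsto _).comp h1).mul (hCp.comp hs)).add
      (((hE2.tendsto _).comp h1).mul (hCm.comp hs))).sub (hδ.mul_const _))).congr fun δ => ?_
    simp only [hB, Function.comp_apply]
    have e : -((κ - δ : ℝ) : ℂ) + (κ : ℂ) = δ := by push_cast; ring
    rw [e]; ring
  have hfin := tendsto_nhds_unique hlim1 (hlim2.congr' (by
    filter_upwards [hAB] with δ hδ
    rw [hδ]))
  have hκ' : (κ : ℂ) ≠ 0 := by exact_mod_cast hκ.ne'
  have hk : (k.factorial : ℂ) ≠ 0 := by exact_mod_cast k.factorial_ne_zero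
  rw [Complex.Gamma_add_one _ hκ', zero_mul, sub_zero, mul_assoc] at hfin
  have h5 := mul_left_cancel₀ hκ' hfin
  rw [Complex.ofReal_div, Complex.ofReal_natCast, ← Complex.Gamma_ofReal, div_mul_eq_mul_div, ← h5,
    mul_div_cancel_right₀ _ hk]

open scoped Pointwise in
/-- The polyhedron `conv(S) + ℝ₊ⁿ`. -/
def upperHull (S : Finset (Fin n → ℕ)) : Set (Fin n → ℝ) :=
  convexHull ℝ (natPt '' (S : Set (Fin n → ℕ))) + octant n

lemma octant_eq : octant n = Ici 0 := by
  ext x; simp [octant, Pi.le_def]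

lemma natPt_mono {p q : Fin n → ℕ} (h : p ≤ q) : natPt p ≤ natPt q :=
  fun i => by simpa [natPt] using h i

lemma isClosed_upperHull (S : Finset (Fin n → ℕ)) : IsClosed (upperHull S) := by
  refine IsClosed.add_left_of_isCompact ?_ ?_
  · rw [octant_eq]; exact isClosed_Ici
  · exact (S.finite_toSet.image _).isCompact_convexHull (𝕜 := ℝ)

lemma convex_upperHull (S : Finset (Fin n → ℕ)) : Convex ℝ (upperHull S) := by
  refine (convex_convexHull ℝ _).add ?_
  rw [octant_eq]; exact convex_Ici 0

lemma upperHull_upward {S : Finset (Fin n → ℕ)} {x y : Fin n → ℝ} (hx : x ∈ upperHull S)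
    (hxy : x ≤ y) : y ∈ upperHull S := by
  obtain ⟨u, hu, v, hv, rfl⟩ := hx
  refine ⟨u, hu, v + (y - (u + v)), ?_, by simp only; abel⟩
  rw [octant_eq] at hv ⊢
  exact add_nonneg hv (sub_nonneg.2 hxy)

lemma natPt_mem_upperHull {S : Finset (Fin n → ℕ)} {p : Fin n → ℕ} (hp : p ∈ S) :
    natPt p ∈ upperHull S :=
  ⟨natPt p, subset_convexHull _ _ ⟨p, hp, rfl⟩, 0, by simp [octant], by simp⟩

lemma upperHull_nonneg {S : Finset (Fin n → ℕ)} {x : Fin n → ℝ} (hx : x ∈ upperHull S) :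
    0 ≤ x := by
  obtain ⟨u, hu, v, hv, rfl⟩ := hx
  rw [octant_eq] at hv
  have : convexHull ℝ (natPt '' (S : Set (Fin n → ℕ))) ⊆ Ici 0 := by
    refine convexHull_min ?_ (convex_Ici 0)
    rintro _ ⟨p, -, rfl⟩ i
    simp [natPt]
  exact add_nonneg (this hu) hv

lemma dot_add (a x y : Fin n → ℝ) : dot a (x + y) = dot a x + dot a y := by
  simp [dot, mul_add, Finset.sum_add_distrib]

lemma dot_smul (a : Fin n → ℝ) (c : ℝ) (x : Fin n → ℝ) : dot a (c • x) = c * dot a x := by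
  simp only [dot, Finset.mul_sum, Pi.smul_apply, smul_eq_mul]
  exact Finset.sum_congr rfl fun i _ => by ring

lemma dot_sub (a x y : Fin n → ℝ) : dot a (x - y) = dot a x - dot a y := by
  simp [dot, mul_sub, Finset.sum_sub_distrib]

lemma dot_nonneg {a x : Fin n → ℝ} (ha : 0 ≤ a) (hx : 0 ≤ x) : 0 ≤ dot a x :=
  Finset.sum_nonneg fun i _ => mul_nonneg (ha i) (hx i)

lemma dot_mono {a x y : Fin n → ℝ} (ha : 0 ≤ a) (h : x ≤ y) : dot a x ≤ dot a y :=
  Finset.sum_le_sum fun i _ => mul_le_mul_of_nonneg_left (h i) (ha i)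

lemma convex_Hhalf (a : Fin n → ℝ) (l : ℝ) : Convex ℝ (Hhalf a l) := by
  intro x hx y hy s t hs ht hst
  simp only [Hhalf, mem_ofPred_eq, dot_add, dot_smul] at *
  calc l = s * l + t * l := by rw [← add_mul, hst, one_mul]
    _ ≤ _ := by gcongr

lemma upperHull_subset_Hhalf {S : Finset (Fin n → ℕ)} {a : Fin n → ℝ} (ha : 0 ≤ a) {l : ℝ}
    (h : ∀ p ∈ S, l ≤ dot a (natPt p)) : upperHull S ⊆ Hhalf a l := by
  rintro _ ⟨u, hu, v, hv, rfl⟩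
  rw [octant_eq] at hv
  have h1 : convexHull ℝ (natPt '' (S : Set (Fin n → ℕ))) ⊆ Hhalf a l := by
    refine convexHull_min ?_ (convex_Hhalf a l)
    rintro _ ⟨p, hp, rfl⟩
    exact h p hp
  have h2 : l ≤ dot a u := h1 hu
  change l ≤ dot a (u + v)
  rw [dot_add]
  linarith [dot_nonneg ha hv]

/-- Dickson's lemma: the Newton polyhedron is generated by finitely many exponents. -/
lemma exists_newton_generators (f : (Fin n → ℝ) → ℝ) :
    ∃ S : Finset (Fin n → ℕ), (∀ p ∈ S, taylorCoeff f p ≠ 0) ∧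
      (∀ α, taylorCoeff f α ≠ 0 → ∃ p ∈ S, p ≤ α) ∧ NewtonPolyhedron f = upperHull S := by
  set T : Set (Fin n → ℕ) := {α | taylorCoeff f α ≠ 0}
  have hfin : {p | Minimal (· ∈ T) p}.Finite :=
    WellQuasiOrderedLE.finite_of_isAntichain (setOfPred_minimal_antichain (· ∈ T))
  have h1 : ∀ p ∈ hfin.toFinset, taylorCoeff f p ≠ 0 := fun p hp => by
    rw [Finite.mem_toFinset] at hp
    exact hp.prop
  have h2 : ∀ α, taylorCoeff f α ≠ 0 → ∃ p ∈ hfin.toFinset, p ≤ α := fun α hα => by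
    obtain ⟨p, hp, hpm⟩ := exists_minimal_le_of_wellFoundedLT (· ∈ T) α hα
    exact ⟨p, by simpa using hpm, hp⟩
  refine ⟨hfin.toFinset, h1, h2, ?_⟩
  refine Subset.antisymm ?_ ?_
  · refine convexHull_min ?_ (convex_upperHull _)
    rintro x ⟨α, hα, hx⟩
    obtain ⟨p, hp, hpα⟩ := h2 α hα
    exact upperHull_upward (natPt_mem_upperHull hp) ((natPt_mono hpα).trans hx)
  · have hoct : octant n = convexHull ℝ (octant n) := by
      rw [octant_eq]; exact ((convex_Ici 0).convexHull_eq).symm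
    rw [upperHull, hoct, ← convexHull_add]
    refine convexHull_mono ?_
    rintro _ ⟨_, ⟨p, hp, rfl⟩, v, hv, rfl⟩
    exact ⟨p, h1 p hp, fun i => by simpa [natPt] using hv i⟩

lemma eventually_add_smul_mem {τ : Set (Fin n → ℝ)} {q w : Fin n → ℝ}
    (hq : q ∈ intrinsicInterior ℝ τ) (hw : w ∈ (affineSpan ℝ τ).direction) :
    ∀ᶠ t : ℝ in 𝓝 0, q + t • w ∈ τ := by
  obtain ⟨q', hq', rfl⟩ := hq
  have hmem : ∀ t : ℝ, (q' : Fin n → ℝ) + t • w ∈ affineSpan ℝ τ := fun t => by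
    rw [add_comm]
    exact AffineSubspace.vadd_mem_of_mem_direction (Submodule.smul_mem _ t hw) q'.2
  have hcont : Continuous fun t : ℝ => (⟨q' + t • w, hmem t⟩ : affineSpan ℝ τ) := by fun_prop
  have h0 : (⟨q' + (0 : ℝ) • w, hmem 0⟩ : affineSpan ℝ τ) = q' := by ext; simp
  have := hcont.tendsto 0
  rw [h0] at this
  exact (this.eventually (mem_interior_iff_mem_nhds.1 hq')).mono fun t ht => ht

/-! ### The diagonal point -/

section
variable {f : (Fin n → ℝ) → ℝ} {S : Finset (Fin n → ℕ)}

lemma diag_mem_upperHull (hS : S.Nonempty) : ∃ t : ℝ, (fun _ : Fin n => t) ∈ upperHull S := by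
  obtain ⟨p, hp⟩ := hS
  refine ⟨∑ i, (p i : ℝ), upperHull_upward (natPt_mem_upperHull hp) fun i => ?_⟩
  exact Finset.single_le_sum (f := fun i => (p i : ℝ)) (fun _ _ => by positivity)
    (Finset.mem_univ i)

lemma bddBelow_diag [NeZero n] (hΓ : NewtonPolyhedron f = upperHull S) :
    BddBelow {t : ℝ | (fun _ : Fin n => t) ∈ NewtonPolyhedron f} := by
  refine ⟨0, fun t ht => ?_⟩
  rw [mem_ofPred_eq, hΓ] at ht
  exact upperHull_nonneg ht 0

lemma newtonDist_mem [NeZero n] (hΓ : NewtonPolyhedron f = upperHull S)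
    (hS : S.Nonempty) :
    (fun _ : Fin n => newtonDist f) ∈ upperHull S := by
  have hcl : IsClosed {t : ℝ | (fun _ : Fin n => t) ∈ NewtonPolyhedron f} := by
    rw [hΓ]
    exact (isClosed_upperHull S).preimage (by fun_prop : Continuous fun (t : ℝ) (_ : Fin n) => t)
  have hne : {t : ℝ | (fun _ : Fin n => t) ∈ NewtonPolyhedron f}.Nonempty := by
    rw [hΓ]; exact diag_mem_upperHull hS
  have : (fun _ : Fin n => newtonDist f) ∈ NewtonPolyhedron f :=
    hcl.csInf_mem hne (bddBelow_diag hΓ)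
  rwa [hΓ] at this

lemma newtonDist_le_of_mem [NeZero n] (hΓ : NewtonPolyhedron f = upperHull S)
    {t : ℝ} (ht : (fun _ : Fin n => t) ∈ upperHull S) :
    newtonDist f ≤ t := by
  refine csInf_le (bddBelow_diag hΓ) ?_
  rw [mem_ofPred_eq, hΓ]; exact ht

lemma newtonDist_pos [NeZero n] (hΓ : NewtonPolyhedron f = upperHull S)
    (hS : S.Nonempty) (h0 : ∀ p ∈ S, p ≠ 0) : 0 < newtonDist f := by
  have h1 : upperHull S ⊆ Hhalf (fun _ => 1) 1 := by
    refine upperHull_subset_Hhalf (fun _ => zero_le_one) fun p hp => ?_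
    obtain ⟨i, hi⟩ := Function.ne_iff.1 (h0 p hp)
    have h2 : (1 : ℝ) ≤ p i := by exact_mod_cast Nat.one_le_iff_ne_zero.2 hi
    simp only [dot, one_mul, natPt]
    exact h2.trans (Finset.single_le_sum (f := fun i => (p i : ℝ)) (fun _ _ => by positivity)
      (Finset.mem_univ i))
  have h2 := h1 (newtonDist_mem hΓ hS)
  simp only [Hhalf, dot, mem_ofPred_eq, one_mul, Finset.sum_const, Finset.card_univ,
    Fintype.card_fin, nsmul_eq_mul] at h2
  by_contra h
  have : (n : ℝ) * newtonDist f ≤ 0 := mul_nonpos_of_nonneg_of_nonpos (by positivity) (by linarith)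
  linarith

/-- The structure of the principal face: a supporting hyperplane with nonnegative nonzero
normal, containing the diagonal point. -/
lemma IsPrincipalFace.exists_normal [NeZero n] (hΓ : NewtonPolyhedron f = upperHull S)
    {τ : Set (Fin n → ℝ)} (hS : S.Nonempty)
    (hτ : IsPrincipalFace f τ) :
    ∃ (a : Fin n → ℝ) (l : ℝ), 0 ≤ a ∧ (∃ i, 0 < a i) ∧ τ = upperHull S ∩ Hplane a l := by
  obtain ⟨⟨a, l, hv, rfl⟩, hmem⟩ := hτ
  rw [hΓ] at hv hmem ⊢
  have hv' : upperHull S ⊆ Hhalf (intPt a) l := hΓ ▸ hv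
  have hq : (fun _ : Fin n => newtonDist f) ∈ upperHull S ∩ Hplane (intPt a) l :=
    intrinsicInterior_subset hmem
  have ha : 0 ≤ intPt a := by
    intro i
    obtain ⟨p, hp⟩ := hS
    by_contra hneg
    simp only [Pi.zero_apply, not_le] at hneg
    obtain ⟨r, hr⟩ := exists_nat_gt ((dot (intPt a) (natPt p) - l) / (-intPt a i))
    have h1 : natPt p + (r : ℝ) • Pi.single i (1 : ℝ) ∈ upperHull S := by
      refine upperHull_upward (natPt_mem_upperHull hp) (le_add_of_nonneg_right ?_)
      exact smul_nonneg (by positivity) (Pi.single_nonneg.2 zero_le_one)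
    have h2 : (l : ℝ) ≤ dot (intPt a) (natPt p + (r : ℝ) • Pi.single i (1 : ℝ)) := hv' h1
    have h3 : dot (intPt a) (Pi.single i (1 : ℝ)) = intPt a i := by simp [dot, Pi.single_apply]
    rw [dot_add, dot_smul, h3] at h2
    rw [div_lt_iff₀ (by linarith)] at hr
    nlinarith
  refine ⟨intPt a, l, ha, ?_, rfl⟩
  by_contra hall
  push Not at hall
  have ha0 : intPt a = 0 := funext fun i => le_antisymm (hall i) (ha i)
  have hl : (l : ℝ) = 0 := by
    have := hq.2
    rw [ha0] at this
    simpa [Hplane, dot] using this.symm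
  have hτ' : upperHull S ∩ Hplane (intPt a) l = upperHull S := by
    refine inter_eq_left.2 fun x _ => ?_
    simp [Hplane, ha0, hl, dot]
  rw [hτ'] at hmem
  have hpos : ∀ i, (Pi.single i (1 : ℝ) : Fin n → ℝ) ∈ (affineSpan ℝ (upperHull S)).direction := by
    intro i
    have h1 : (fun _ : Fin n => newtonDist f) + Pi.single i (1 : ℝ) ∈ upperHull S :=
      upperHull_upward hq.1 (le_add_of_nonneg_right (Pi.single_nonneg.2 zero_le_one))
    have := AffineSubspace.vsub_mem_direction (subset_affineSpan ℝ _ h1)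
      (subset_affineSpan ℝ _ hq.1)
    simpa using this
  have htop : (affineSpan ℝ (upperHull S)).direction = ⊤ := by
    rw [eq_top_iff]
    intro x _
    have : x = ∑ i, x i • (Pi.single i (1 : ℝ) : Fin n → ℝ) := by
      ext j; simp [Finset.sum_apply, Pi.single_apply]
    rw [this]
    exact Submodule.sum_mem _ fun i _ => Submodule.smul_mem _ _ (hpos i)
  have hev := eventually_add_smul_mem hmem (w := fun _ => 1) (by rw [htop]; trivial)
  obtain ⟨t, ht, ht'⟩ := ((hev.filter_mono nhdsWithin_le_nhds).and
    (self_mem_nhdsWithin : Iio (0 : ℝ) ∈ 𝓝[<] 0)).exists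
  have ht2 : (fun _ : Fin n => newtonDist f + t) ∈ upperHull S := by
    convert ht using 1
    ext; simp
  have ht3 : t < 0 := ht'
  linarith [newtonDist_le_of_mem hΓ ht2]

end

lemma contDiff_integral_unit {E : Type*} [NormedAddCommGroup E] [NormedSpace ℝ E]
    {F : E → ℝ → ℝ} (hF : ContDiff ℝ (⊤ : ℕ∞) (fun q : E × ℝ => F q.1 q.2)) :
    ContDiff ℝ (⊤ : ℕ∞) (fun x => ∫ s in (0:ℝ)..1, F x s) := by
  let b : ContDiffBump (0 : ℝ) := ⟨2, 3, by norm_num, by norm_num⟩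
  let g : E → ℝ → ℝ := fun x s => b s * F x (-s)
  have key := contDiffOn_convolution_right_with_param_comp (n := ⊤) (μ := volume)
    (ContinuousLinearMap.mul ℝ ℝ) (s := (univ : Set E)) (v := fun _ => (0 : ℝ)) contDiffOn_const
    (f := indicator (Ioc (0:ℝ) 1) fun _ => (1:ℝ)) (g := g) (k := Metric.closedBall 0 3)
    isOpen_univ (isCompact_closedBall _ _) ?_ ?_ ?_
  · rw [contDiffOn_univ] at key
    convert key using 2 with x
    rw [intervalIntegral.integral_of_le zero_le_one, convolution_def, ← integral_indicator
      measurableSet_Ioc]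
    refine integral_congr_ae (ae_of_all _ fun s => ?_)
    by_cases hs : s ∈ Ioc (0:ℝ) 1
    · have hb : b (-s) = 1 := b.one_of_mem_closedBall (by
        simp only [mem_closedBall_zero_iff, norm_neg, Real.norm_eq_abs, abs_of_pos hs.1]
        exact hs.2.trans (by norm_num [b]))
      simp [hs, g, hb]
    · simp [hs]
  · intro p s _ hs
    have : b s = 0 := b.zero_of_le_dist (by
      simp only [Metric.mem_closedBall, not_le] at hs
      exact hs.le)
    simp [g, this]
  · exact ((integrable_indicator_iff measurableSet_Ioc).2 (by simp)).locallyIntegrable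
  · refine ContDiff.contDiffOn ?_
    refine (b.contDiff.comp contDiff_snd).mul ?_
    exact hF.comp (contDiff_fst.prodMk contDiff_snd.neg)

/-- `g` does not depend on the `i`-th coordinate. -/
def Indep (i : Fin n) (g : (Fin n → ℝ) → ℝ) : Prop :=
  ∀ x s, g (Function.update x i s) = g x

lemma contDiff_update (j : Fin n) :
    ContDiff ℝ (⊤ : ℕ∞) (fun q : (Fin n → ℝ) × ℝ => Function.update q.1 j q.2) := by
  rw [contDiff_pi]
  intro i
  by_cases h : i = j
  · subst h; simpa using contDiff_snd
  · simp only [Function.update_of_ne h]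
    exact (contDiff_apply ℝ ℝ i).comp contDiff_fst

lemma hasDerivAt_update (x : Fin n → ℝ) (j : Fin n) (s : ℝ) :
    HasDerivAt (fun s => Function.update x j s) (Pi.single j 1) s := by
  rw [hasDerivAt_pi]
  intro i
  by_cases h : i = j
  · subst h; simpa using hasDerivAt_id' s
  · simpa [h] using hasDerivAt_const s (x i)

/-- The Hadamard quotient `∫₀¹ ∂ⱼ g (x₁, …, s xⱼ, …, xₙ) ds`. -/
noncomputable def hadamard (j : Fin n) (g : (Fin n → ℝ) → ℝ) (x : Fin n → ℝ) : ℝ :=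
  ∫ s in (0:ℝ)..1, fderiv ℝ g (Function.update x j (s * x j)) (Pi.single j 1)

lemma contDiff_hadamard {g : (Fin n → ℝ) → ℝ} (hg : ContDiff ℝ (⊤ : ℕ∞) g) (j : Fin n) :
    ContDiff ℝ (⊤ : ℕ∞) (hadamard j g) := by
  refine contDiff_integral_unit
    (F := fun x s => fderiv ℝ g (Function.update x j (s * x j)) (Pi.single j 1)) ?_
  refine ContDiff.clm_apply (ContDiff.comp (g := fderiv ℝ g) (hg.fderiv_right (by simp)) ?_) contDiff_const
  exact (contDiff_update j).comp (contDiff_fst.prodMk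
    (contDiff_snd.mul ((contDiff_apply ℝ ℝ j).comp contDiff_fst)))

lemma hadamard_eq {g : (Fin n → ℝ) → ℝ} (hg : ContDiff ℝ (⊤ : ℕ∞) g) (j : Fin n)
    (x : Fin n → ℝ) : g x = g (Function.update x j 0) + x j * hadamard j g x := by
  have hd : ∀ s : ℝ, HasDerivAt (fun s => g (Function.update x j (s * x j)))
      (x j * fderiv ℝ g (Function.update x j (s * x j)) (Pi.single j 1)) s := by
    intro s
    have h1 := (hg.differentiable (by simp) (Function.update x j (s * x j))).hasFDerivAt
    have h2 : HasDerivAt (fun s => Function.update x j (s * x j)) (x j • Pi.single j 1) s :=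
      HasDerivAt.scomp (g₁ := fun r => Function.update x j r) s (hasDerivAt_update x j (s * x j))
        (hasDerivAt_mul_const (x j))
    have := h1.comp_hasDerivAt s h2
    rw [map_smul, smul_eq_mul] at this
    exact this
  have hc : Continuous fun s : ℝ =>
      x j * fderiv ℝ g (Function.update x j (s * x j)) (Pi.single j 1) := by
    refine continuous_const.mul (((hg.continuous_fderiv (by simp)).comp ?_).clm_apply
      continuous_const)
    exact (contDiff_update j).continuous.comp (continuous_const.prodMk (continuous_mul_const _))
  have := intervalIntegral.integral_eq_sub_of_hasDerivAt (a := 0) (b := 1) (fun s _ => hd s)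
    (hc.intervalIntegrable _ _)
  rw [intervalIntegral.integral_const_mul] at this
  simp only [one_mul, zero_mul, Function.update_eq_self] at this
  rw [hadamard, this]; ring

lemma Indep.fderiv {g : (Fin n → ℝ) → ℝ} {i : Fin n} (hi : Indep i g)
    (x : Fin n → ℝ) (s : ℝ) :
    fderiv ℝ g (Function.update x i s) = fderiv ℝ g x := by
  have h : g = fun y => g (y + (Function.update x i s - x)) := by
    funext y
    have : y + (Function.update x i s - x) = Function.update y i (y i + (s - x i)) := by
      ext k
      by_cases hk : k = i
      · subst hk; simp
      · simp [hk]
    rw [this, hi]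
  conv_rhs => rw [h]
  rw [fderiv_comp_add_right]
  congr 1
  abel

lemma Indep.hadamard {g : (Fin n → ℝ) → ℝ} {i : Fin n} (hi : Indep i g)
    {j : Fin n} (hij : i ≠ j) : Indep i (hadamard j g) := by
  intro x s
  unfold KN.hadamard
  refine intervalIntegral.integral_congr fun r _ => ?_
  rw [Function.update_of_ne hij.symm, Function.update_comm hij, hi.fderiv]

/-- Taylor expansion with remainder in one coordinate. -/
lemma exists_coordinate_expansion (j : Fin n) (M : ℕ) :
    ∀ {g : (Fin n → ℝ) → ℝ}, ContDiff ℝ (⊤ : ℕ∞) g →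
    ∃ c : ℕ → (Fin n → ℝ) → ℝ, (∀ k, ContDiff ℝ (⊤ : ℕ∞) (c k)) ∧
      (∀ k < M, Indep j (c k)) ∧ (∀ i, i ≠ j → Indep i g → ∀ k, Indep i (c k)) ∧
      ∀ x, g x = ∑ k ∈ Finset.range (M + 1), x j ^ k * c k x := by
  induction M with
  | zero =>
    intro g hg
    exact ⟨fun _ => g, fun _ => hg, by simp, fun i _ hi _ => hi, by simp⟩
  | succ M ih =>
    intro g hg
    obtain ⟨c, hc, hcj, hci, hce⟩ := ih (contDiff_hadamard hg j)
    refine ⟨fun k => Nat.casesOn k (fun x => g (Function.update x j 0)) c, ?_, ?_, ?_, ?_⟩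
    · rintro (_ | k)
      · exact hg.comp ((contDiff_update j).comp (contDiff_id.prodMk contDiff_const))
      · exact hc k
    · rintro (_ | k) hk
      · intro x s; simp
      · exact hcj k (by omega)
    · rintro i hij hi (_ | k)
      · intro x s
        change g (Function.update (Function.update x i s) j 0) = g (Function.update x j 0)
        rw [Function.update_comm hij, hi]
      · exact hci i hij (hi.hadamard hij) k
    · intro x
      rw [Finset.sum_range_succ', hadamard_eq hg j x, hce x, Finset.mul_sum, add_comm]
      simp only [pow_zero, one_mul]
      congr 1
      exact Finset.sum_congr rfl fun k _ => by ring

/-- The monomial `x^p`. -/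
def mon (p : Fin n → ℕ) (x : Fin n → ℝ) : ℝ := ∏ i, x i ^ p i

lemma contDiff_mon (p : Fin n → ℕ) : ContDiff ℝ (⊤ : ℕ∞) (mon p) :=
  contDiff_prod fun i _ => (contDiff_apply ℝ ℝ i).pow _

lemma mon_update {p : Fin n → ℕ} {j : Fin n} (hp : p j = 0) (k : ℕ) (x : Fin n → ℝ) :
    mon (Function.update p j k) x = x j ^ k * mon p x := by
  unfold mon
  rw [← Finset.mul_prod_erase _ _ (Finset.mem_univ j), ← Finset.mul_prod_erase (a := j) (f := fun i => x i ^ p i) _ (Finset.mem_univ j)]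
  simp only [Function.update_self, hp, pow_zero, one_mul]
  congr 1
  refine Finset.prod_congr rfl fun i hi => ?_
  rw [Function.update_of_ne (Finset.ne_of_mem_erase hi)]

open Classical in
/-- Multi-indices with entries at most `M` that vanish off `J`. -/
noncomputable def boxOn (J : Finset (Fin n)) (M : ℕ) : Finset (Fin n → ℕ) :=
  Fintype.piFinset fun i => if i ∈ J then Finset.range (M + 1) else {0}

lemma mem_boxOn_univ {M : ℕ} {p : Fin n → ℕ} :
    p ∈ boxOn Finset.univ M ↔ ∀ i, p i ≤ M := by
  simp [boxOn]

lemma exists_box_expansion_on {f : (Fin n → ℝ) → ℝ} (hf : ContDiff ℝ (⊤ : ℕ∞) f) (M : ℕ)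
    (J : Finset (Fin n)) :
    ∃ ψ : (Fin n → ℕ) → (Fin n → ℝ) → ℝ, (∀ p, ContDiff ℝ (⊤ : ℕ∞) (ψ p)) ∧
      (∀ p, ∀ j ∈ J, p j < M → Indep j (ψ p)) ∧
      ∀ x, f x = ∑ p ∈ boxOn J M, mon p x * ψ p x := by
  classical
  induction J using Finset.induction_on with
  | empty =>
    refine ⟨fun _ => f, fun _ => hf, by simp, fun x => ?_⟩
    have : boxOn (∅ : Finset (Fin n)) M = {0} := by
      ext p; simp [boxOn, funext_iff]
    simp [this, mon]
  | insert j J hj ih =>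
    obtain ⟨ψ, hψ, hi, he⟩ := ih
    choose c hc hcj hci hce using fun p => exists_coordinate_expansion j M (hψ p)
    refine ⟨fun p => c (Function.update p j 0) (p j), fun p => hc _ _, ?_, fun x => ?_⟩
    · intro p i hiJ hpi
      rcases Finset.mem_insert.1 hiJ with rfl | hiJ
      · exact hcj _ _ hpi
      · have hij : i ≠ j := fun h => hj (h ▸ hiJ)
        exact hci _ i hij (hi _ i hiJ (by rwa [Function.update_of_ne hij])) _
    · rw [he]
      simp_rw [hce _ x, Finset.mul_sum]
      rw [← Finset.sum_product']
      refine Finset.sum_bij' (fun q _ => Function.update q.1 j q.2)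
        (fun p _ => (Function.update p j 0, p j)) ?_ ?_ ?_ ?_ ?_
      · rintro ⟨p, k⟩ h
        simp only [Finset.mem_product, boxOn, Fintype.mem_piFinset, Finset.mem_range] at h ⊢
        intro i
        by_cases hij : i = j
        · subst hij; simpa using h.2
        · have := h.1 i
          simpa [Finset.mem_insert, hij] using this
      · intro p h
        simp only [Finset.mem_product, boxOn, Fintype.mem_piFinset, Finset.mem_range] at h ⊢
        refine ⟨fun i => ?_, ?_⟩
        · by_cases hij : i = j
          · subst hij; simp [hj]
          · have := h i
            simpa [Finset.mem_insert, hij] using this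
        · simpa using h j
      · rintro ⟨p, k⟩ h
        simp only [Finset.mem_product, boxOn, Fintype.mem_piFinset] at h
        have : p j = 0 := by simpa [hj] using h.1 j
        simp [← this]
      · intro p _
        simp
      · rintro ⟨p, k⟩ h
        simp only [Finset.mem_product, boxOn, Fintype.mem_piFinset] at h
        have hp : p j = 0 := by simpa [hj] using h.1 j
        have : Function.update p j 0 = p := by rw [← hp]; simp
        simp only [mon_update hp, Function.update_idem, this, Function.update_self]
        ring

lemma coeff_eq_zero_of_isBigO (l : ℕ) : ∀ c : ℕ → ℝ,
    (fun t : ℝ => ∑ k ∈ Finset.range l, c k * t ^ k) =O[𝓝[>] 0] (fun t => t ^ l) →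
    ∀ k < l, c k = 0 := by
  induction l with
  | zero => intro c _ k hk; omega
  | succ l ih =>
    intro c h
    have h0 : c 0 = 0 := by
      have h1 : Tendsto (fun t : ℝ => ∑ k ∈ Finset.range (l + 1), c k * t ^ k) (𝓝[>] 0)
          (𝓝 (∑ k ∈ Finset.range (l + 1), c k * 0 ^ k)) :=
        (Continuous.tendsto (by fun_prop) 0).mono_left nhdsWithin_le_nhds
      have h2 := h.trans_tendsto (((continuous_pow (l + 1)).tendsto' (0 : ℝ) 0 (by simp)).mono_left
        nhdsWithin_le_nhds)
      have := tendsto_nhds_unique h1 h2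
      rw [Finset.sum_range_succ'] at this
      simpa using this
    have hs : ∀ k < l, c (k + 1) = 0 := by
      refine ih (fun k => c (k + 1)) ?_
      have h3 : (fun t : ℝ => t * ∑ k ∈ Finset.range l, c (k + 1) * t ^ k) =O[𝓝[>] 0]
          (fun t => t * t ^ l) := by
        refine h.congr (fun t => ?_) fun t => by ring
        rw [Finset.sum_range_succ', h0, Finset.mul_sum]
        simp only [zero_mul, add_zero]
        exact Finset.sum_congr rfl fun k _ => by ring
      have h4 := (Asymptotics.isBigO_refl (fun t : ℝ => t⁻¹) (𝓝[>] 0)).mul h3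
      refine h4.congr' ?_ ?_ <;> filter_upwards [self_mem_nhdsWithin] with t ht <;>
        rw [← mul_assoc, inv_mul_cancel₀ (ne_of_gt ht), one_mul]
    rintro (_ | k) hk
    · exact h0
    · exact hs k (by omega)

lemma coordinate_expansion_unique {M : ℕ} {c : ℕ → ℝ} {G : ℝ → ℝ} {r : ℝ} (hr : 0 < r)
    (hG : Continuous G)
    (h : ∀ s, |s| < r → ∑ k ∈ Finset.range M, c k * s ^ k + s ^ M * G s = 0) :
    (∀ k < M, c k = 0) ∧ ∀ s, |s| < r → G s = 0 := by
  have hev : ∀ᶠ s : ℝ in 𝓝 0, |s| < r :=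
    (continuous_abs.tendsto' (0:ℝ) 0 (by simp)).eventually_lt_const hr
  have hc : ∀ k < M, c k = 0 := by
    refine coeff_eq_zero_of_isBigO M c ?_
    have h1 : (fun s => s ^ M * -G s) =O[𝓝[>] (0:ℝ)] fun s => s ^ M * (1:ℝ) :=
      (Asymptotics.isBigO_refl _ _).mul
        ((hG.neg.tendsto 0).isBigO_one ℝ |>.mono nhdsWithin_le_nhds)
    refine h1.congr' ?_ (by simp)
    filter_upwards [nhdsWithin_le_nhds hev] with s hs
    linarith [h s hs]
  refine ⟨hc, ?_⟩
  have hne : ∀ s, |s| < r → s ≠ 0 → G s = 0 := by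
    intro s hs hs0
    have := h s hs
    rw [Finset.sum_eq_zero fun k hk => by rw [hc k (Finset.mem_range.1 hk), zero_mul], zero_add]
      at this
    exact (mul_eq_zero.1 this).resolve_left (pow_ne_zero _ hs0)
  intro s hs
  by_cases hs0 : s = 0
  · subst hs0
    have h1 : Tendsto G (𝓝[≠] 0) (𝓝 (G 0)) := (hG.tendsto 0).mono_left nhdsWithin_le_nhds
    refine tendsto_nhds_unique h1 (tendsto_const_nhds.congr' ?_)
    filter_upwards [nhdsWithin_le_nhds hev, self_mem_nhdsWithin] with s hs h0
    exact (hne s hs h0).symm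
  · exact hne s hs hs0

lemma box_expansion_unique {M : ℕ} {ψ : (Fin n → ℕ) → (Fin n → ℝ) → ℝ}
    (hψ : ∀ p, Continuous (ψ p)) (hi : ∀ p j, p j < M → Indep j (ψ p)) {r : ℝ} (hr : 0 < r)
    (h : ∀ x, (∀ i, |x i| < r) → ∑ p ∈ boxOn Finset.univ M, mon p x * ψ p x = 0) :
    ∀ p ∈ boxOn Finset.univ M, ∀ x, (∀ i, |x i| < r) → ψ p x = 0 := by
  classical
  have key : ∀ (J : Finset (Fin n)) (κ : Fin n → ℕ) (x : Fin n → ℝ), (∀ i, |x i| < r) →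
      ∑ p ∈ (boxOn Finset.univ M).filter (fun p => ∀ j ∈ J, p j = κ j),
        (∏ i ∈ Jᶜ, x i ^ p i) * ψ p x = 0 := by
    intro J
    induction J using Finset.induction_on with
    | empty =>
      intro κ x hx
      simpa [mon] using h x hx
    | insert j J hj ih =>
      intro κ x hx
      let A : ℕ → Finset (Fin n → ℕ) := fun k => (boxOn Finset.univ M).filter
        (fun p => (∀ i ∈ J, p i = κ i) ∧ p j = k)
      let G : ℕ → (Fin n → ℝ) → ℝ := fun k y => ∑ p ∈ A k, (∏ i ∈ (insert j J)ᶜ, y i ^ p i) * ψ p y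
      have hcomp : ∀ (y : Fin n → ℝ) (p : Fin n → ℕ), ∏ i ∈ Jᶜ, y i ^ p i
          = y j ^ p j * ∏ i ∈ (insert j J)ᶜ, y i ^ p i := by
        intro y p
        rw [Finset.compl_insert, Finset.mul_prod_erase (a := j) (f := fun i => y i ^ p i) _ (by simpa using hj)]
      have hsum : ∀ y : Fin n → ℝ, (∀ i, |y i| < r) →
          ∑ k ∈ Finset.range (M + 1), y j ^ k * G k y = 0 := by
        intro y hy
        have hmaps : ∀ p ∈ (boxOn Finset.univ M).filter (fun p => ∀ i ∈ J, p i = κ i),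
            (fun p : Fin n → ℕ => p j) p ∈ Finset.range (M + 1) := by
          intro p hp
          have := mem_boxOn_univ.1 (Finset.mem_filter.1 hp).1 j
          exact Finset.mem_range.2 (Nat.lt_succ_of_le this)
        rw [← ih κ y hy, ← Finset.sum_fiberwise_of_maps_to hmaps]
        · refine Finset.sum_congr rfl fun k _ => ?_
          simp only [G, A, Finset.mul_sum, Finset.filter_filter]
          refine Finset.sum_congr rfl fun p hp => ?_
          rw [hcomp y p, (Finset.mem_filter.1 hp).2.2]; ring
      have hprod : ∀ (s : ℝ) (p : Fin n → ℕ),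
          ∏ i ∈ (insert j J)ᶜ, (Function.update x j s) i ^ p i = ∏ i ∈ (insert j J)ᶜ, x i ^ p i := by
        intro s p
        refine Finset.prod_congr rfl fun i hi => ?_
        rw [Function.update_of_ne]
        rintro rfl
        simp at hi
      have hGi : ∀ k < M, ∀ s, G k (Function.update x j s) = G k x := by
        intro k hk s
        refine Finset.sum_congr rfl fun p hp => ?_
        have hp' := (Finset.mem_filter.1 hp).2.2
        rw [hprod, hi p j (by omega)]
      have h1 := coordinate_expansion_unique (M := M) (c := fun k => G k x)
        (G := fun s => G M (Function.update x j s)) hr ?_ ?_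
      · have hGx : G (κ j) x = 0 := by
          rcases lt_trichotomy (κ j) M with hk | hk | hk
          · exact h1.1 _ hk
          · have := h1.2 (x j) (hx j)
            rw [Function.update_eq_self] at this
            rw [hk, this]
          · refine Finset.sum_eq_zero fun p hp => ?_
            have h2 := mem_boxOn_univ.1 (Finset.mem_filter.1 hp).1 j
            have h3 := (Finset.mem_filter.1 hp).2.2
            omega
        rw [← hGx]
        refine Finset.sum_congr ?_ fun _ _ => rfl
        ext p
        simp [A, and_comm]
      · refine continuous_finsetSum _ fun p _ => ?_
        have : Continuous fun s : ℝ => Function.update x j s :=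
          (contDiff_update j).continuous.comp (continuous_const.prodMk continuous_id)
        exact (continuous_finsetProd _ fun i _ => ((continuous_apply i).comp this).pow _).mul
          ((hψ p).comp this)
      · intro s hs
        have := hsum (Function.update x j s) (fun i => by
          by_cases hij : i = j
          · subst hij; simpa using hs
          · simpa [hij] using hx i)
        rw [Finset.sum_range_succ] at this
        simp only [Function.update_self] at this
        rw [← this]
        congr 1
        refine Finset.sum_congr rfl fun k hk => ?_
        rw [hGi k (Finset.mem_range.1 hk), mul_comm]
  intro p hp x hx
  have := key Finset.univ p x hx
  rw [Finset.sum_eq_single p] at this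
  · simpa using this
  · intro q hq hne
    exact absurd (funext fun j => (Finset.mem_filter.1 hq).2 j (Finset.mem_univ j)) hne
  · intro hn
    exact absurd (Finset.mem_filter.2 ⟨hp, fun _ _ => rfl⟩) hn

lemma exists_separating_normal {S : Finset (Fin n → ℕ)} (hS : S.Nonempty) {x : Fin n → ℝ}
    (hx : x ∉ upperHull S) :
    ∃ a : Fin n → ℝ, 0 ≤ a ∧ ∀ p ∈ S, dot a x < dot a (natPt p) := by
  obtain ⟨f, u, hfx, hf⟩ := geometric_hahn_banach_point_closed (convex_upperHull S)
    (isClosed_upperHull S) hx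
  have hdot : ∀ y, f y = dot (fun j => f (Pi.single j 1)) y := by
    intro y
    have := LinearMap.pi_apply_eq_sum_univ (f : (Fin n → ℝ) →ₗ[ℝ] ℝ) y
    simp only [ContinuousLinearMap.coe_coe, smul_eq_mul] at this
    rw [this, dot]
    refine Finset.sum_congr rfl fun i _ => ?_
    rw [mul_comm]
    congr 2
    ext j
    simp [Pi.single_apply, eq_comm]
  refine ⟨fun j => f (Pi.single j 1), fun i => ?_, fun p hp => ?_⟩
  · obtain ⟨p, hp⟩ := hS
    by_contra hneg
    simp only [Pi.zero_apply, not_le] at hneg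
    obtain ⟨r, hr⟩ := exists_nat_gt ((f (natPt p) - u) / (-f (Pi.single i 1)))
    have h1 : natPt p + (r : ℝ) • Pi.single i (1 : ℝ) ∈ upperHull S := by
      refine upperHull_upward (natPt_mem_upperHull hp) (le_add_of_nonneg_right ?_)
      exact smul_nonneg (by positivity) (Pi.single_nonneg.2 zero_le_one)
    have h2 := hf _ h1
    rw [map_add, map_smul, smul_eq_mul] at h2
    rw [div_lt_iff₀ (by linarith)] at hr
    nlinarith
  · rw [← hdot, ← hdot]
    exact hfx.trans (hf _ (natPt_mem_upperHull hp))

lemma exists_nat_weight {S : Finset (Fin n → ℕ)} (hS : S.Nonempty) {M : ℕ}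
    (hM : ∀ p ∈ S, ∀ j, p j ≤ M) {β : Fin n → ℕ} (hβ : natPt β ∉ upperHull S) :
    ∃ a : Fin n → ℕ, (∀ j, M ≤ β j → a j = 0) ∧ (∀ j, β j < M → 0 < a j) ∧
      ∀ p ∈ S, ∑ j, a j * β j < ∑ j, a j * p j := by
  classical
  let P : (Fin n → ℝ) →ₗ[ℝ] (Fin n → ℝ) :=
    { toFun := fun x j => if M ≤ β j then 0 else x j
      map_add' := fun x y => by ext j; by_cases h : M ≤ β j <;> simp [h]
      map_smul' := fun c x => by ext j; by_cases h : M ≤ β j <;> simp [h] }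
  let π : (Fin n → ℕ) → (Fin n → ℕ) := fun p j => if M ≤ β j then 0 else p j
  have hπ : ∀ p, natPt (π p) = P (natPt p) := by
    intro p; ext j; by_cases h : M ≤ β j <;> simp [π, P, natPt, h]
  have hle : ∀ u ∈ convexHull ℝ (natPt '' (S : Set (Fin n → ℕ))), ∀ j, u j ≤ M := by
    intro u hu j
    have : convexHull ℝ (natPt '' (S : Set (Fin n → ℕ))) ⊆ {x | x j ≤ M} := by
      refine convexHull_min ?_ (convex_halfSpace_le (f := fun x : Fin n → ℝ => x j)
        ⟨fun _ _ => rfl, fun _ _ => rfl⟩ _)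
      rintro _ ⟨p, hp, rfl⟩
      change ((p j : ℕ) : ℝ) ≤ M
      exact_mod_cast hM p hp j
    exact this hu
  have hβ' : natPt β ∉ upperHull (S.image π) := by
    rintro ⟨u, hu, v, hv, huv⟩
    rw [octant_eq] at hv
    have himg : natPt '' ((S.image π : Finset (Fin n → ℕ)) : Set (Fin n → ℕ))
        = P '' (natPt '' (S : Set (Fin n → ℕ))) := by
      rw [Finset.coe_image, image_image, image_image]
      exact image_congr fun p _ => hπ p
    rw [himg, ← LinearMap.image_convexHull] at hu
    obtain ⟨w, hw, rfl⟩ := hu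
    refine hβ (upperHull_upward (x := w) ⟨w, hw, 0, by simp [octant], by simp⟩ fun j => ?_)
    by_cases h : M ≤ β j
    · exact (hle w hw j).trans (by simpa [natPt] using h)
    · have h1 := congrFun huv j
      have h2 := hv j
      simp only [Pi.add_apply, P, LinearMap.coe_mk, AddHom.coe_mk, h, if_false, Pi.zero_apply]
        at h1 h2
      linarith
  obtain ⟨b, hb, hbS⟩ := exists_separating_normal (hS.image π) hβ'
  let a : ℕ → Fin n → ℕ := fun N j => if M ≤ β j then 0 else ⌊b j * N⌋₊ + 1
  have hlim : ∀ p : Fin n → ℕ, Tendsto (fun N : ℕ => (∑ j, (a N j : ℝ) * p j) / N) atTop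
      (𝓝 (dot b (natPt (π p)))) := by
    intro p
    simp_rw [Finset.sum_div, dot]
    refine tendsto_finsetSum _ fun j _ => ?_
    by_cases h : M ≤ β j
    · simp [a, h, natPt, π]
    · simp only [a, h, natPt, π, if_false]
      have h1 := (tendsto_nat_floor_mul_div_atTop (hb j)).comp
        (tendsto_natCast_atTop_atTop (R := ℝ))
      have h2 := tendsto_inv_atTop_zero.comp (tendsto_natCast_atTop_atTop (R := ℝ))
      have h3 := (h1.add h2).mul_const (p j : ℝ)
      rw [add_zero] at h3
      refine h3.congr fun N => ?_
      simp only [Function.comp_apply, Nat.cast_add, Nat.cast_one]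
      ring
  have hev : ∀ p ∈ S, ∀ᶠ N : ℕ in atTop,
      (∑ j, (a N j : ℝ) * β j) / N < (∑ j, (a N j : ℝ) * p j) / N := by
    intro p hp
    refine (hlim β).eventually_lt (hlim p) (lt_of_le_of_lt ?_ (hbS _ (Finset.mem_image_of_mem π hp)))
    refine dot_mono hb fun j => ?_
    by_cases h : M ≤ β j <;> simp [π, natPt, h]
  obtain ⟨N, hN, hN0⟩ := (((Finset.eventually_all S).2 hev).and (eventually_gt_atTop 0)).exists
  refine ⟨a N, fun j hj => by simp [a, hj], fun j hj => by simp [a, not_le.2 hj], fun p hp => ?_⟩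
  have := hN p hp
  rw [div_lt_div_iff_of_pos_right (by exact_mod_cast hN0)] at this
  exact_mod_cast this

lemma Indep.eq_of_eq_off {g : (Fin n → ℝ) → ℝ} {J : Finset (Fin n)} (hJ : ∀ j ∈ J, Indep j g)
    {x y : Fin n → ℝ} (h : ∀ i ∉ J, x i = y i) : g x = g y := by
  classical
  induction J using Finset.induction_on generalizing x with
  | empty => rw [funext fun i => h i (by simp)]
  | insert j J _ ih =>
    rw [← hJ j (Finset.mem_insert_self _ _) x (y j)]
    refine ih (fun i hi => hJ i (Finset.mem_insert_of_mem hi)) fun i hi => ?_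
    by_cases hij : i = j
    · subst hij; simp
    · rw [Function.update_of_ne hij]
      exact h i (by simp [hij, hi])

lemma isFaceOf_natPt {P : Set (Fin n → ℝ)} {a : Fin n → ℕ} {l : ℕ}
    (h : P ⊆ Hhalf (natPt a) l) : IsFaceOf P (P ∩ Hplane (natPt a) l) := by
  have ha : intPt (fun j => (a j : ℤ)) = natPt a := by ext; simp [intPt, natPt]
  have hl : (((l : ℕ) : ℤ) : ℝ) = l := by simp
  exact ⟨fun j => a j, l, by rwa [ValidPair, ha, hl], by rw [ha, hl]⟩

lemma mon_scaleAction (a p : Fin n → ℕ) (t : ℝ) (x : Fin n → ℝ) :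
    mon p (scaleAction a t x) = t ^ (∑ j, a j * p j) * mon p x := by
  simp only [mon, scaleAction, mul_pow, Finset.prod_mul_distrib, ← pow_mul,
    Finset.prod_pow_eq_pow_sum]

lemma continuous_scaleAction (a : Fin n → ℕ) (x : Fin n → ℝ) :
    Continuous fun t => scaleAction a t x :=
  continuous_pi fun i => (continuous_pow (a i)).mul continuous_const

lemma abs_scaleAction_lt {a : Fin n → ℕ} {t r : ℝ} {x : Fin n → ℝ} (hx : ∀ i, |x i| < r)
    (ht : 0 < t) (ht1 : t ≤ 1) (i : Fin n) : |scaleAction a t x i| < r := by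
  refine lt_of_le_of_lt ?_ (hx i)
  rw [scaleAction, abs_mul, abs_of_pos (pow_pos ht _)]
  exact mul_le_of_le_one_left (abs_nonneg _) (pow_le_one₀ ht.le ht1)

lemma box_coeff_eq_zero {f : (Fin n → ℝ) → ℝ} {M : ℕ} {ψ : (Fin n → ℕ) → (Fin n → ℝ) → ℝ}
    (hψ : ∀ p, Continuous (ψ p)) (hi : ∀ p j, p j < M → Indep j (ψ p)) {r : ℝ} (hr : 0 < r)
    (hf : ∀ x, (∀ i, |x i| < r) → f x = ∑ p ∈ boxOn Finset.univ M, mon p x * ψ p x)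
    {a : Fin n → ℕ} {k : ℕ} (hk : k < M)
    (hlim : ∀ x, (∀ i, |x i| < r) →
      ∃ c : ℝ, Tendsto (fun t : ℝ => f (scaleAction a t x) / t ^ (k + 1)) (𝓝[>] 0) (𝓝 c))
    {β : Fin n → ℕ} (hβ : β ∈ boxOn Finset.univ M) (hβk : ∑ j, a j * β j = k)
    {x : Fin n → ℝ} (hx : ∀ i, |x i| < r) : ψ β x = 0 := by
  classical
  let w : (Fin n → ℕ) → ℕ := fun p => ∑ j, a j * p j
  let B := boxOn (Finset.univ : Finset (Fin n)) M
  have hc : ∀ x : Fin n → ℝ, (∀ i, |x i| < r) → ∑ p ∈ B.filter (fun p => w p = k), mon p x * ψ p x = 0 := by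
    intro x hx
    have ht1 : ∀ᶠ t : ℝ in 𝓝[>] 0, t ≤ 1 :=
      nhdsWithin_le_nhds (eventually_le_nhds zero_lt_one)
    have hO : (fun t : ℝ => f (scaleAction a t x)) =O[𝓝[>] 0] fun t => t ^ (k + 1) := by
      obtain ⟨c, hc⟩ := hlim x hx
      have h1 := (hc.isBigO_one ℝ).mul
        (Asymptotics.isBigO_refl (fun t : ℝ => t ^ (k + 1)) (𝓝[>] 0))
      simp only [one_mul] at h1
      refine h1.congr' ?_ EventuallyEq.rfl
      filter_upwards [self_mem_nhdsWithin] with t ht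
      exact div_mul_cancel₀ _ (pow_ne_zero _ (ne_of_gt ht))
    have hO2 : (fun t : ℝ => ∑ p ∈ B.filter (fun p => ¬ w p < k + 1),
        t ^ w p * (mon p x * ψ p (scaleAction a t x))) =O[𝓝[>] 0] fun t => t ^ (k + 1) := by
      refine Asymptotics.IsBigO.fun_sum fun p hp => ?_
      have hp' : k + 1 ≤ w p := not_lt.1 (Finset.mem_filter.1 hp).2
      have h1 : (fun t : ℝ => t ^ w p) =O[𝓝[>] 0] fun t => t ^ (k + 1) := by
        refine Asymptotics.IsBigO.of_bound 1 ?_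
        filter_upwards [ht1, self_mem_nhdsWithin] with t ht ht0
        have ht0' : 0 < t := ht0
        rw [Real.norm_of_nonneg (by positivity), Real.norm_of_nonneg (by positivity), one_mul]
        exact pow_le_pow_of_le_one ht0'.le ht hp'
      have h2 : (fun t : ℝ => mon p x * ψ p (scaleAction a t x)) =O[𝓝[>] 0] fun _ => (1 : ℝ) :=
        (((continuous_const.mul ((hψ p).comp (continuous_scaleAction a x))).tendsto 0).isBigO_one
          ℝ).mono nhdsWithin_le_nhds
      simpa using h1.mul h2
    have hO3 := hO.sub hO2
    have h0 := coeff_eq_zero_of_isBigO (k + 1)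
      (fun i => ∑ p ∈ B.filter (fun p => w p = i), mon p x * ψ p x) ?_ k (Nat.lt_succ_self k)
    · exact h0
    · refine hO3.congr' ?_ EventuallyEq.rfl
      filter_upwards [ht1, self_mem_nhdsWithin] with t ht ht0
      rw [hf _ (abs_scaleAction_lt hx ht0 ht), sub_eq_iff_eq_add,
        ← Finset.sum_filter_add_sum_filter_not B (fun p => w p < k + 1)]
      congr 1
      · have hmaps : ∀ p ∈ B.filter (fun p => w p < k + 1), w p ∈ Finset.range (k + 1) :=
          fun p hp => Finset.mem_range.2 (Finset.mem_filter.1 hp).2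
        rw [← Finset.sum_fiberwise_of_maps_to hmaps]
        refine Finset.sum_congr rfl fun i hi' => ?_
        rw [Finset.filter_filter, Finset.sum_mul]
        refine Finset.sum_congr ?_ fun p hp => ?_
        · ext p
          simp only [Finset.mem_filter]
          have := Finset.mem_range.1 hi'
          constructor
          · rintro ⟨h1, -, h2⟩; exact ⟨h1, h2⟩
          · rintro ⟨h1, h2⟩; exact ⟨h1, h2 ▸ this, h2⟩
        · have hwp : w p = i := (Finset.mem_filter.1 hp).2
          have hψp : ψ p (scaleAction a t x) = ψ p x := by
            refine Indep.eq_of_eq_off (J := Finset.univ.filter fun j => 0 < a j) ?_ ?_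
            · intro j hj
              refine hi p j ?_
              have h1 : a j * p j ≤ w p :=
                Finset.single_le_sum (f := fun j => a j * p j) (fun _ _ => Nat.zero_le _)
                  (Finset.mem_univ j)
              have h2 := Finset.mem_range.1 hi'
              have h3 : p j ≤ a j * p j := Nat.le_mul_of_pos_left _ (Finset.mem_filter.1 hj).2
              omega
            · intro j hj
              have : a j = 0 := by simpa using hj
              simp [scaleAction, this]
          rw [mon_scaleAction, hψp, ← hwp]
          ring
      · refine Finset.sum_congr rfl fun p _ => ?_
        rw [mon_scaleAction]
        ring
  have := box_expansion_unique (M := M) (ψ := fun p => if w p = k then ψ p else 0) ?_ ?_ hr ?_ β hβ x hx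
  · simpa [w, hβk] using this
  · intro p
    by_cases h : w p = k <;> simp only [h, if_true, if_false]
    · exact hψ p
    · exact continuous_const
  · intro p j hpj
    by_cases h : w p = k <;> simp only [h, if_true, if_false]
    · exact hi p j hpj
    · intro _ _; rfl
  · intro y hy
    rw [← hc y hy, Finset.sum_filter]
    refine Finset.sum_congr rfl fun p _ => ?_
    by_cases h : w p = k <;> simp [h]

lemma exists_contDiff_eq_near_zero {f : (Fin n → ℝ) → ℝ} {U : Set (Fin n → ℝ)} (hU : IsOpen U)
    (hU0 : (0 : Fin n → ℝ) ∈ U) (hf : ContDiffOn ℝ (⊤ : ℕ∞) f U) :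
    ∃ g : (Fin n → ℝ) → ℝ, ContDiff ℝ (⊤ : ℕ∞) g ∧ ∃ r > 0, ∀ x, (∀ i, |x i| < r) →
      x ∈ U ∧ f x = g x := by
  obtain ⟨R, hR, hRU⟩ := Metric.nhds_basis_closedBall.mem_iff.1 (hU.mem_nhds hU0)
  let b : ContDiffBump (0 : Fin n → ℝ) := ⟨R / 2, R, by linarith, by linarith⟩
  refine ⟨fun x => b x * f x, ?_, R / 2, by linarith, fun x hx => ?_⟩
  · rw [contDiff_iff_contDiffAt]
    intro x
    by_cases hx : x ∈ tsupport b
    · rw [b.tsupport_eq] at hx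
      exact b.contDiffAt.mul (hf.contDiffAt (hU.mem_nhds (hRU hx)))
    · refine contDiffAt_const (c := (0 : ℝ)) |>.congr_of_eventuallyEq ?_
      filter_upwards [(notMem_tsupport_iff_eventuallyEq.1 hx)] with y hy
      simp [hy]
  · have hx' : ‖x‖ ≤ R / 2 := (pi_norm_le_iff_of_nonneg (by linarith)).2 fun i => (hx i).le
    have h1 : b x = 1 := b.one_of_mem_closedBall (by simpa using hx')
    exact ⟨hRU (by simp only [Metric.mem_closedBall, dist_zero_right]; linarith), by simp [h1]⟩

/-- A function of class `Ê(U)` lies near the origin in the ideal generated by the monomials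
of its Newton polyhedron. -/
theorem MemEhat.exists_expansion {f : (Fin n → ℝ) → ℝ} {U : Set (Fin n → ℝ)} (hU : IsOpen U)
    (hU0 : (0 : Fin n → ℝ) ∈ U) (hf : ContDiffOn ℝ (⊤ : ℕ∞) f U) (hE : MemEhat U f)
    {S : Finset (Fin n → ℕ)} (hS : S.Nonempty) (hΓ : NewtonPolyhedron f = upperHull S) :
    ∃ S' : Finset (Fin n → ℕ), S ⊆ S' ∧ (∀ p ∈ S', natPt p ∈ upperHull S) ∧
      ∃ ψ : (Fin n → ℕ) → (Fin n → ℝ) → ℝ, (∀ p, ContDiff ℝ (⊤ : ℕ∞) (ψ p)) ∧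
        ∃ r > 0, ∀ x, (∀ i, |x i| < r) → x ∈ U ∧ f x = ∑ p ∈ S', mon p x * ψ p x := by
  classical
  obtain ⟨p₀, hp₀⟩ := hS
  have hadm : ∀ γ, IsFaceOf (upperHull S) γ → AdmitsGammaPartOn f U (upperHull S) γ := by
    rcases hE with h | h
    · exact absurd (hΓ ▸ natPt_mem_upperHull hp₀ : natPt p₀ ∈ NewtonPolyhedron f) (by simp [h.1])
    · exact hΓ ▸ h.2.2.2
  obtain ⟨g, hg, r, hr, hfg⟩ := exists_contDiff_eq_near_zero hU hU0 hf
  let M : ℕ := S.sup fun p => Finset.univ.sup p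
  have hM : ∀ p ∈ S, ∀ j, p j ≤ M := fun p hp j =>
    (Finset.le_sup (f := p) (Finset.mem_univ j)).trans
      (Finset.le_sup (f := fun p : Fin n → ℕ => Finset.univ.sup p) hp)
  have hw : ∀ β : Fin n → ℕ, ∃ a : Fin n → ℕ, natPt β ∉ upperHull S →
      (∀ j, M ≤ β j → a j = 0) ∧ ∀ p ∈ S, ∑ j, a j * β j < ∑ j, a j * p j := by
    intro β
    by_cases hβ : natPt β ∈ upperHull S
    · exact ⟨0, fun h => absurd hβ h⟩
    · obtain ⟨a, h1, -, h2⟩ := exists_nat_weight ⟨p₀, hp₀⟩ hM hβ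
      exact ⟨a, fun _ => ⟨h1, h2⟩⟩
  choose a ha using hw
  let N : ℕ := max M ((boxOn Finset.univ M).sup fun β => ∑ j, a β j * β j + 1)
  obtain ⟨ψ, hψ, hi, hexp⟩ := exists_box_expansion_on hg N Finset.univ
  have hi' : ∀ p j, p j < N → Indep j (ψ p) := fun p j => hi p j (Finset.mem_univ j)
  have hzero : ∀ β ∈ boxOn Finset.univ N, natPt β ∉ upperHull S → ∀ x, (∀ i, |x i| < r) →
      ψ β x = 0 := by
    intro β hβ hβΓ x hx
    let β₀ : Fin n → ℕ := fun j => min (β j) M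
    have hβ₀ : natPt β₀ ∉ upperHull S := fun h =>
      hβΓ (upperHull_upward h (natPt_mono fun j => min_le_left _ _))
    obtain ⟨h1, h2⟩ := ha β₀ hβ₀
    have hsum : ∑ j, a β₀ j * β j = ∑ j, a β₀ j * β₀ j := by
      refine Finset.sum_congr rfl fun j _ => ?_
      rcases le_total M (β j) with h | h
      · rw [h1 j (by simp [β₀, h])]; simp
      · simp [β₀, h]
    have hkN : ∑ j, a β₀ j * β₀ j < N := by
      have h3 : β₀ ∈ boxOn (Finset.univ : Finset (Fin n)) M :=
        mem_boxOn_univ.2 fun j => min_le_right _ _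
      have h4 := Finset.le_sup (f := fun β : Fin n → ℕ => ∑ j, a β j * β j + 1) h3
      exact lt_of_lt_of_le (Nat.lt_succ_self _) (h4.trans (le_max_right _ _))
    refine box_coeff_eq_zero (f := g) (fun p => (hψ p).continuous) hi' hr (fun x _ => hexp x) hkN ?_ hβ hsum hx
    intro x hx
    have hval : upperHull S ⊆ Hhalf (natPt (a β₀)) ((∑ j, a β₀ j * β₀ j + 1 : ℕ) : ℝ) := by
      refine upperHull_subset_Hhalf (fun j => by simp [natPt]) fun p hp => ?_
      have := h2 p hp
      simp only [dot, natPt]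
      exact_mod_cast this
    obtain ⟨c, hc⟩ := hadm _ (isFaceOf_natPt hval) x (hfg x hx).1 (a β₀) _ ⟨hval, rfl⟩
    refine ⟨c, hc.congr' ?_⟩
    filter_upwards [self_mem_nhdsWithin, nhdsWithin_le_nhds (eventually_le_nhds zero_lt_one)]
      with t ht ht1
    rw [(hfg _ (abs_scaleAction_lt hx ht ht1)).2]
  refine ⟨(boxOn Finset.univ N).filter fun p => natPt p ∈ upperHull S, ?_, ?_, ψ, hψ, r, hr, ?_⟩
  · intro p hp
    exact Finset.mem_filter.2 ⟨mem_boxOn_univ.2 fun j => (hM p hp j).trans (le_max_left _ _),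
      natPt_mem_upperHull hp⟩
  · exact fun p hp => (Finset.mem_filter.1 hp).2
  · intro x hx
    refine ⟨(hfg x hx).1, ?_⟩
    rw [(hfg x hx).2, hexp, Finset.sum_filter]
    refine Finset.sum_congr rfl fun p hp => ?_
    by_cases h : natPt p ∈ upperHull S
    · simp [h]
    · simp [h, hzero p hp h x hx]

section
variable {f g u v : (Fin n → ℝ) → ℝ}

lemma contDiff_pderiv1 (hf : ContDiff ℝ (⊤ : ℕ∞) f) (i : Fin n) :
    ContDiff ℝ (⊤ : ℕ∞) (pderiv1 i f) :=
  (hf.fderiv_right (by simp)).clm_apply contDiff_const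

lemma contDiff_pderiv1_iterate (hf : ContDiff ℝ (⊤ : ℕ∞) f) (i : Fin n) (k : ℕ) :
    ContDiff ℝ (⊤ : ℕ∞) ((pderiv1 i)^[k] f) := by
  induction k with
  | zero => exact hf
  | succ k ih => rw [Function.iterate_succ_apply']; exact contDiff_pderiv1 ih i

/-- Iterated partial derivatives along the coordinates of a list. -/
noncomputable def listDeriv (α : Fin n → ℕ) (L : List (Fin n)) (f : (Fin n → ℝ) → ℝ) :
    (Fin n → ℝ) → ℝ := L.foldr (fun i g => (pderiv1 i)^[α i] g) f

lemma listDeriv_cons (α : Fin n → ℕ) (i : Fin n) (L : List (Fin n)) (f : (Fin n → ℝ) → ℝ) :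
    listDeriv α (i :: L) f = (pderiv1 i)^[α i] (listDeriv α L f) := rfl

lemma contDiff_listDeriv (hf : ContDiff ℝ (⊤ : ℕ∞) f) (α : Fin n → ℕ) (L : List (Fin n)) :
    ContDiff ℝ (⊤ : ℕ∞) (listDeriv α L f) := by
  induction L with
  | nil => exact hf
  | cons i L ih => exact contDiff_pderiv1_iterate ih i _

lemma pderiv1_add (hu : ContDiff ℝ (⊤ : ℕ∞) u) (hv : ContDiff ℝ (⊤ : ℕ∞) v) (i : Fin n) :
    pderiv1 i (fun x => u x + v x) = fun x => pderiv1 i u x + pderiv1 i v x := by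
  funext x
  rw [pderiv1, fderiv_fun_add (hu.differentiable (by simp) x) (hv.differentiable (by simp) x)]
  rfl

lemma pderiv1_const_mul (hu : ContDiff ℝ (⊤ : ℕ∞) u) (c : ℝ) (i : Fin n) :
    pderiv1 i (fun x => c * u x) = fun x => c * pderiv1 i u x := by
  funext x
  rw [pderiv1, fderiv_const_mul (hu.differentiable (by simp) x)]
  rfl

lemma pderiv1_mul (hu : ContDiff ℝ (⊤ : ℕ∞) u) (hv : ContDiff ℝ (⊤ : ℕ∞) v) (i : Fin n) :
    pderiv1 i (fun x => u x * v x) = fun x => u x * pderiv1 i v x + v x * pderiv1 i u x := by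
  funext x
  rw [pderiv1, fderiv_fun_mul (hu.differentiable (by simp) x) (hv.differentiable (by simp) x)]
  rfl

lemma pderiv1_coord (i j : Fin n) :
    pderiv1 i (fun x : Fin n → ℝ => x j) = fun _ => if i = j then 1 else 0 := by
  funext x
  rw [pderiv1]
  have h : HasFDerivAt (fun x : Fin n → ℝ => x j)
      (ContinuousLinearMap.proj (R := ℝ) (φ := fun _ : Fin n => ℝ) j) x :=
    (ContinuousLinearMap.proj (R := ℝ) (φ := fun _ : Fin n => ℝ) j).hasFDerivAt
  rw [h.fderiv]
  simp [Pi.single_apply, eq_comm]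

lemma pderiv1_coord_mul (hu : ContDiff ℝ (⊤ : ℕ∞) u) (i j : Fin n) :
    pderiv1 i (fun x => x j * u x) =
      fun x => x j * pderiv1 i u x + (if i = j then 1 else 0) * u x := by
  rw [pderiv1_mul (contDiff_apply ℝ ℝ j) hu, pderiv1_coord]
  funext x; ring

lemma pderiv1_iterate_coord_mul_add (hu : ContDiff ℝ (⊤ : ℕ∞) u) (hv : ContDiff ℝ (⊤ : ℕ∞) v)
    {i j : Fin n} (hij : i ≠ j) (c : ℝ) (k : ℕ) :
    (pderiv1 i)^[k] (fun x => x j * u x + c * v x) =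
      fun x => x j * (pderiv1 i)^[k] u x + c * (pderiv1 i)^[k] v x := by
  induction k with
  | zero => rfl
  | succ k ih =>
    have h1 := contDiff_pderiv1_iterate hu i k
    have h2 := contDiff_pderiv1_iterate hv i k
    rw [Function.iterate_succ_apply', ih, pderiv1_add ((contDiff_apply ℝ ℝ j).mul h1)
      (contDiff_const.mul h2), pderiv1_coord_mul h1, pderiv1_const_mul h2]
    simp [hij, Function.iterate_succ_apply']

lemma pderiv1_iterate_coord_mul_self (hu : ContDiff ℝ (⊤ : ℕ∞) u) (j : Fin n) (k : ℕ) :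
    (pderiv1 j)^[k] (fun x => x j * u x) =
      fun x => x j * (pderiv1 j)^[k] u x + k * (pderiv1 j)^[k - 1] u x := by
  induction k with
  | zero => simp
  | succ k ih =>
    have h1 := contDiff_pderiv1_iterate hu j k
    have h2 := contDiff_pderiv1_iterate hu j (k - 1)
    rw [Function.iterate_succ_apply', ih, pderiv1_add ((contDiff_apply ℝ ℝ j).mul h1)
      (contDiff_const.mul h2), pderiv1_coord_mul h1, pderiv1_const_mul h2]
    funext x
    rcases k with _ | k
    · simp
    · simp only [if_true, Function.iterate_succ_apply', Nat.add_sub_cancel]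
      push_cast; ring

lemma listDeriv_coord_mul (hu : ContDiff ℝ (⊤ : ℕ∞) u) (α : Fin n → ℕ) (j : Fin n)
    {L : List (Fin n)} (hL : L.Nodup) :
    listDeriv α L (fun x => x j * u x) = fun x => x j * listDeriv α L u x +
      (if j ∈ L then (α j : ℝ) else 0) * listDeriv (Function.update α j (α j - 1)) L u x := by
  induction L with
  | nil => funext x; simp [listDeriv]
  | cons i L ih =>
    rw [List.nodup_cons] at hL
    rw [listDeriv_cons, ih hL.2]
    by_cases hij : i = j
    · subst hij
      simp only [hL.1, if_false, zero_mul, add_zero, List.mem_cons, true_or, if_true]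
      rw [pderiv1_iterate_coord_mul_self (contDiff_listDeriv hu _ _)]
      funext x
      rw [listDeriv_cons, listDeriv_cons, Function.update_self]
      congr 3
      have : ∀ L : List (Fin n), i ∉ L →
          listDeriv α L u = listDeriv (Function.update α i (α i - 1)) L u := by
        intro L
        induction L with
        | nil => intro _; rfl
        | cons k L ih =>
          intro hk
          rw [List.mem_cons, not_or] at hk
          rw [listDeriv_cons, listDeriv_cons, ih hk.2, Function.update_of_ne (Ne.symm hk.1)]
      rw [this L hL.1]
    · rw [pderiv1_iterate_coord_mul_add (contDiff_listDeriv hu _ _) (contDiff_listDeriv hu _ _) hij]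
      funext x
      rw [listDeriv_cons, listDeriv_cons, Function.update_of_ne hij]
      simp [Ne.symm hij]

lemma taylorCoeff_coord_mul (hu : ContDiff ℝ (⊤ : ℕ∞) u) (α : Fin n → ℕ) (j : Fin n) :
    taylorCoeff (fun x => x j * u x) α =
      if α j = 0 then 0 else taylorCoeff u (Function.update α j (α j - 1)) := by
  have h := congrFun (listDeriv_coord_mul hu α j (List.nodup_finRange n)) 0
  have h' : mderiv α (fun x => x j * u x) 0 =
      (α j : ℝ) * mderiv (Function.update α j (α j - 1)) u 0 := by
    simpa [listDeriv, mderiv] using h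
  rw [taylorCoeff, h']
  split_ifs with h0
  · simp [h0]
  · rw [taylorCoeff]
    have hfac : ((∏ i, Nat.factorial (α i) : ℕ) : ℝ) =
        α j * ((∏ i, Nat.factorial (Function.update α j (α j - 1) i) : ℕ) : ℝ) := by
      rw [← Finset.mul_prod_erase _ _ (Finset.mem_univ j), ← Finset.mul_prod_erase (a := j)
        (f := fun i => Nat.factorial (Function.update α j (α j - 1) i)) _ (Finset.mem_univ j)]
      rw [Function.update_self, ← Nat.mul_factorial_pred h0]
      push_cast
      rw [mul_assoc]
      congr 2
      refine Finset.prod_congr rfl fun i hi => ?_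
      rw [Function.update_of_ne (Finset.ne_of_mem_erase hi)]
    rw [hfac, mul_div_mul_left _ _ (by exact_mod_cast h0)]

lemma taylorCoeff_mon_mul (hu : ContDiff ℝ (⊤ : ℕ∞) u) (p α : Fin n → ℕ) :
    (¬ p ≤ α → taylorCoeff (fun x => mon p x * u x) α = 0) ∧
      (p = α → taylorCoeff (fun x => mon p x * u x) α = u 0) := by
  induction hN : ∑ i, p i generalizing p α with
  | zero =>
    have hp : p = 0 := by
      funext i
      exact (Finset.sum_eq_zero_iff.1 hN) i (Finset.mem_univ i)
    subst hp
    refine ⟨fun h => absurd (fun i => Nat.zero_le _) h, fun h => ?_⟩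
    subst h
    simp [mon, taylorCoeff, mderiv]
  | succ N ih =>
    obtain ⟨j, hj⟩ : ∃ j, p j ≠ 0 := by
      by_contra hall
      push Not at hall
      simp [hall] at hN
    let q := Function.update p j (p j - 1)
    have hpq : p = Function.update q j (q j + 1) := by
      simp [q, Nat.sub_add_cancel (Nat.pos_of_ne_zero hj)]
    have hmon : (fun x => mon p x * u x) = fun x => x j * (mon q x * u x) := by
      funext x
      have h0 : (Function.update p j 0) j = 0 := by simp
      have h1 := mon_update h0 (p j) x
      have h2 := mon_update h0 (p j - 1) x
      simp only [Function.update_idem, Function.update_eq_self] at h1 h2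
      rw [h1, h2, ← mul_assoc, ← mul_assoc, ← pow_succ', Nat.sub_add_cancel (Nat.pos_of_ne_zero hj)]
    have hqN : ∑ i, q i = N := by
      have h3 : ∑ i, p i = ∑ i, q i + 1 := by
        rw [← Finset.add_sum_erase _ _ (Finset.mem_univ j), ← Finset.add_sum_erase (a := j)
          (f := q) _ (Finset.mem_univ j)]
        have : ∑ i ∈ Finset.univ.erase j, q i = ∑ i ∈ Finset.univ.erase j, p i :=
          Finset.sum_congr rfl fun i hi => Function.update_of_ne (Finset.ne_of_mem_erase hi) _ _
        rw [this]
        simp only [q, Function.update_self]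
        omega
      omega
    rw [hmon, taylorCoeff_coord_mul ((contDiff_mon q).mul hu)]
    by_cases hα : α j = 0
    · rw [if_pos hα]
      exact ⟨fun _ => rfl, fun h => absurd (h ▸ hα) hj⟩
    · rw [if_neg hα]
      obtain ⟨h1, h2⟩ := ih q (Function.update α j (α j - 1)) hqN
      refine ⟨fun hle => h1 fun h => hle fun i => ?_, fun h => h2 (by rw [← h])⟩
      have := h i
      by_cases hij : i = j
      · rw [hij] at this ⊢
        simp only [q, Function.update_self] at this
        have h3 : p j - 1 ≤ α j - 1 := this
        have h4 : 0 < α j := Nat.pos_of_ne_zero hα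
        change p j ≤ α j
        omega
      · simpa [q, hij] using this

lemma mderiv_congr {f g : (Fin n → ℝ) → ℝ} (h : f =ᶠ[𝓝 0] g) (α : Fin n → ℕ) :
    mderiv α f 0 = mderiv α g 0 := by
  have key : ∀ L : List (Fin n), listDeriv α L f =ᶠ[𝓝 0] listDeriv α L g := by
    intro L
    induction L with
    | nil => exact h
    | cons i L ih =>
      rw [listDeriv_cons, listDeriv_cons]
      induction α i with
      | zero => exact ih
      | succ k ih' =>
        rw [Function.iterate_succ_apply', Function.iterate_succ_apply']
        filter_upwards [Filter.EventuallyEq.fderiv (𝕜 := ℝ) ih'] with x hx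
        simp only [pderiv1]
        rw [hx]
  exact (key (List.finRange n)).eq_of_nhds

lemma taylorCoeff_sum {ι : Type*} (s : Finset ι) {F : ι → (Fin n → ℝ) → ℝ}
    (hF : ∀ i, ContDiff ℝ (⊤ : ℕ∞) (F i)) (α : Fin n → ℕ) :
    taylorCoeff (fun x => ∑ i ∈ s, F i x) α = ∑ i ∈ s, taylorCoeff (F i) α := by
  have hp : ∀ (G : ι → (Fin n → ℝ) → ℝ), (∀ i, ContDiff ℝ (⊤ : ℕ∞) (G i)) → ∀ j,
      pderiv1 j (fun x => ∑ i ∈ s, G i x) = fun x => ∑ i ∈ s, pderiv1 j (G i) x := by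
    intro G hG j
    funext x
    rw [pderiv1, fderiv_fun_sum fun i _ => (hG i).differentiable (by simp) x]
    simp [pderiv1]
  have hp' : ∀ (G : ι → (Fin n → ℝ) → ℝ), (∀ i, ContDiff ℝ (⊤ : ℕ∞) (G i)) → ∀ j k,
      (pderiv1 j)^[k] (fun x => ∑ i ∈ s, G i x) = fun x => ∑ i ∈ s, (pderiv1 j)^[k] (G i) x := by
    intro G hG j k
    induction k with
    | zero => rfl
    | succ k ih =>
      simp only [Function.iterate_succ_apply']
      rw [ih, hp _ fun i => contDiff_pderiv1_iterate (hG i) j k]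
  have key : ∀ L : List (Fin n), listDeriv α L (fun x => ∑ i ∈ s, F i x) =
      fun x => ∑ i ∈ s, listDeriv α L (F i) x := by
    intro L
    induction L with
    | nil => rfl
    | cons j L ih =>
      rw [listDeriv_cons, ih, hp' _ fun i => contDiff_listDeriv (hF i) α L]
      rfl
  have h := congrFun (key (List.finRange n)) 0
  simp only [taylorCoeff]
  rw [← Finset.sum_div]
  exact congrArg (· / _) h

end

lemma tendsto_intFloor_mul_div (x : ℝ) :
    Tendsto (fun N : ℕ => (⌊x * N⌋ : ℝ) / N) atTop (𝓝 x) := by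
  have h0 : Tendsto (fun N : ℕ => x - 1 / (N : ℝ)) atTop (𝓝 x) := by
    simpa using tendsto_const_nhds.sub (tendsto_const_div_atTop_nhds_zero_nat (1 : ℝ))
  refine tendsto_of_tendsto_of_tendsto_of_le_of_le' h0 tendsto_const_nhds ?_ ?_
  · filter_upwards [eventually_gt_atTop 0] with N hN
    have hN' : (0 : ℝ) < N := by exact_mod_cast hN
    rw [le_div_iff₀ hN', sub_mul, one_div, inv_mul_cancel₀ hN'.ne']
    exact (Int.sub_one_lt_floor _).le
  · filter_upwards [eventually_gt_atTop 0] with N hN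
    have hN' : (0 : ℝ) < N := by exact_mod_cast hN
    rw [div_le_iff₀ hN']
    exact Int.floor_le _

/-- Real numbers can be simultaneously approximated by rationals preserving all rational linear
relations. -/
lemma exists_rat_linear_approx :
    ∃ L : ℕ → ℝ →ₗ[ℚ] ℚ, ∀ x, Tendsto (fun N : ℕ => ((L N x : ℚ) : ℝ) / N) atTop (𝓝 x) := by
  let b := Module.Basis.ofVectorSpace ℚ ℝ
  refine ⟨fun N => b.constr ℚ fun i => (⌊b i * N⌋ : ℚ), fun x => ?_⟩
  have hx : x = (b.repr x).sum fun i c => (c : ℝ) * b i := by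
    conv_lhs => rw [← b.linearCombination_repr x, Finsupp.linearCombination_apply]
    simp [Rat.smul_def]
  have h : Tendsto (fun N : ℕ => ∑ i ∈ (b.repr x).support,
      ((b.repr x i : ℚ) : ℝ) * ((⌊b i * N⌋ : ℝ) / N)) atTop (𝓝 x) := by
    conv => arg 3; rw [hx]
    exact tendsto_finsetSum _ fun i _ => (tendsto_intFloor_mul_div (b i)).const_mul _
  refine h.congr fun N => ?_
  rw [Module.Basis.constr_apply, Finsupp.sum]
  push_cast
  rw [Finset.sum_div]
  exact Finset.sum_congr rfl fun i _ => by simp [mul_div_assoc]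

lemma exists_nat_vector_of_real (F G : Finset (Fin n → ℕ)) (q : Fin n → ℕ) {a : Fin n → ℝ}
    (ha : ∀ j, 0 < a j) (hF : ∀ p ∈ F, dot a (natPt p) = dot a (natPt q))
    (hG : ∀ p ∈ G, dot a (natPt q) < dot a (natPt p)) :
    ∃ b : Fin n → ℕ, (∀ j, 0 < b j) ∧ (∀ p ∈ F, ∑ j, b j * p j = ∑ j, b j * q j) ∧
      ∀ p ∈ G, ∑ j, b j * q j < ∑ j, b j * p j := by
  obtain ⟨L, hL⟩ := exists_rat_linear_approx
  have hlin : ∀ N p, L N (dot a (natPt p)) = ∑ j, L N (a j) * (p j : ℚ) := by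
    intro N p
    rw [dot, map_sum]
    refine Finset.sum_congr rfl fun j _ => ?_
    have : a j * natPt p j = (p j : ℚ) • a j := by
      simp [natPt, Rat.smul_def, mul_comm]
    rw [this, map_smul, smul_eq_mul, mul_comm]
  have hlt : ∀ x y : ℝ, x < y → ∀ᶠ N : ℕ in atTop, L N x < L N y := by
    intro x y hxy
    filter_upwards [(hL x).eventually_lt (hL y) hxy, eventually_gt_atTop 0] with N h hN
    rw [div_lt_div_iff_of_pos_right (by exact_mod_cast hN)] at h
    exact_mod_cast h
  obtain ⟨N, h1, h2⟩ := ((eventually_all.2 fun j => hlt 0 _ (ha j)).and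
    ((Finset.eventually_all G).2 fun p hp => hlt _ _ (hG p hp))).exists
  simp only [map_zero] at h1
  let D : ℕ := ∏ j, (L N (a j)).den
  have hD : 0 < D := Finset.prod_pos fun j _ => (L N (a j)).den_pos
  have hb : ∀ j, ∃ b : ℕ, (b : ℚ) = L N (a j) * D := by
    intro j
    obtain ⟨k, hk⟩ : (L N (a j)).den ∣ D := Finset.dvd_prod_of_mem _ (Finset.mem_univ j)
    refine ⟨(L N (a j)).num.toNat * k, ?_⟩
    have h3 : (((L N (a j)).num.toNat : ℕ) : ℚ) = ((L N (a j)).num : ℚ) := by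
      have : (((L N (a j)).num.toNat : ℕ) : ℤ) = (L N (a j)).num :=
        Int.toNat_of_nonneg (Rat.num_pos.2 (h1 j)).le
      exact_mod_cast this
    rw [hk]
    push_cast
    rw [h3, ← mul_assoc, Rat.mul_den_eq_num]
  choose b hb using hb
  have hsum : ∀ p : Fin n → ℕ, ((∑ j, b j * p j : ℕ) : ℚ) = L N (dot a (natPt p)) * D := by
    intro p
    rw [hlin]
    push_cast
    rw [Finset.sum_mul]
    exact Finset.sum_congr rfl fun j _ => by rw [hb]; ring
  have hD' : (0 : ℚ) < D := by exact_mod_cast hD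
  refine ⟨b, fun j => ?_, fun p hp => ?_, fun p hp => ?_⟩
  · have : (0 : ℚ) < b j := by rw [hb]; exact mul_pos (h1 j) hD'
    exact_mod_cast this
  · have : ((∑ j, b j * p j : ℕ) : ℚ) = ((∑ j, b j * q j : ℕ) : ℚ) := by
      rw [hsum, hsum, hF p hp]
    exact_mod_cast this
  · have : ((∑ j, b j * q j : ℕ) : ℚ) < ((∑ j, b j * p j : ℕ) : ℚ) := by
      rw [hsum, hsum]
      exact mul_lt_mul_of_pos_right (h2 p hp) hD'
    exact_mod_cast this

lemma exists_generalized_inverse {V W : Type*} [AddCommGroup V] [Module ℝ V] [AddCommGroup W]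
    [Module ℝ W] (A : V →ₗ[ℝ] W) : ∃ g : W →ₗ[ℝ] V, ∀ u, A (g (A u)) = A u := by
  obtain ⟨B, hB⟩ := A.rangeRestrict.exists_rightInverse_of_surjective A.range_rangeRestrict
  obtain ⟨g, hg⟩ := B.exists_extend
  refine ⟨g, fun u => ?_⟩
  have h1 : g (A u) = B (A.rangeRestrict u) := LinearMap.congr_fun hg (A.rangeRestrict u)
  have h2 := LinearMap.congr_fun hB (A.rangeRestrict u)
  rw [h1]
  exact congrArg Subtype.val h2

lemma abs_mon_eq_exp {x : Fin n → ℝ} (hx : ∀ j, x j ≠ 0) (p : Fin n → ℕ) :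
    |mon p x| = Real.exp (-dot (natPt p) fun j => -Real.log |x j|) := by
  rw [mon, Finset.abs_prod, dot, ← Finset.sum_neg_distrib, Real.exp_sum]
  refine Finset.prod_congr rfl fun j _ => ?_
  rw [abs_pow, natPt, mul_neg, neg_neg, mul_comm, Real.exp_mul, Real.exp_log (abs_pos.2 (hx j)),
    Real.rpow_natCast]

lemma mon_mul_exp (p : Fin n → ℕ) (x a : Fin n → ℝ) :
    mon p (fun j => x j * Real.exp (a j)) = mon p x * Real.exp (dot (natPt p) a) := by
  simp only [mon, mul_pow, Finset.prod_mul_distrib, dot, Real.exp_sum, natPt]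
  congr 1
  refine Finset.prod_congr rfl fun j _ => ?_
  rw [← Real.exp_nat_mul]

/-- The toric degeneration of a sequence of points in the torus tending to the origin. -/
lemma exists_degeneration {ι : Type*} (𝓤 : Ultrafilter ι) {x : ι → Fin n → ℝ}
    (hx0 : ∀ k j, x k j ≠ 0) (hx : ∀ j, Tendsto (fun k => x k j) 𝓤 (𝓝 0))
    (S : Finset (Fin n → ℕ)) {h : ι → ℝ} (hh : ∀ k, 0 < h k) {κ : (Fin n → ℕ) → ℝ}
    (hκ : ∀ p ∈ S, Tendsto (fun k => mon p (x k) / h k) 𝓤 (𝓝 (κ p)))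
    {q : Fin n → ℕ} (hq : q ∈ S) (hκq : κ q ≠ 0) :
    ∃ a y : Fin n → ℝ, (∀ j, 0 < a j) ∧ (∀ j, y j ≠ 0) ∧
      ∀ p ∈ S, (κ p ≠ 0 → dot a (natPt p) = dot a (natPt q)) ∧
        (κ p = 0 → dot a (natPt q) < dot a (natPt p)) ∧
        (κ p ≠ 0 → mon p y * κ q = κ p * mon q y) := by
  classical
  let u : ι → Fin n → ℝ := fun k j => -Real.log |x k j|
  have hu : ∀ j, Tendsto (fun k => u k j) 𝓤 atTop := by
    intro j
    have h1 : Tendsto (fun k => x k j) 𝓤 (𝓝[≠] 0) :=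
      tendsto_nhdsWithin_iff.2 ⟨hx j, Eventually.of_forall fun k => hx0 k j⟩
    refine (tendsto_neg_atBot_atTop.comp (Real.tendsto_log_nhdsNE_zero.comp h1)).congr fun k => ?_
    simp [u, Real.log_abs]
  have hratio : ∀ p ∈ S, Tendsto (fun k => |mon p (x k)| / |mon q (x k)|) 𝓤
      (𝓝 (|κ p| / |κ q|)) := by
    intro p hp
    refine ((hκ p hp).abs.div (hκ q hq).abs (abs_ne_zero.2 hκq)).congr fun k => ?_
    rw [Pi.div_apply, abs_div, abs_div, div_div_div_cancel_right₀ (abs_ne_zero.2 (hh k).ne')]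
  have hexp : ∀ p k, |mon p (x k)| / |mon q (x k)| =
      Real.exp (-(dot (natPt p) (u k) - dot (natPt q) (u k))) := by
    intro p k
    rw [abs_mon_eq_exp (hx0 k), abs_mon_eq_exp (hx0 k), ← Real.exp_sub]
    congr 1
    ring
  let A : (Fin n → ℝ) →ₗ[ℝ] (S → ℝ) :=
    { toFun := fun w p => if κ p.1 ≠ 0 then dot (natPt p.1) w - dot (natPt q) w else 0
      map_add' := fun v w => by
        ext p
        by_cases hp : κ p.1 = 0
        · simp [hp]
        · simp only [ne_eq, hp, not_false_eq_true, if_true, dot_add, Pi.add_apply]; ring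
      map_smul' := fun c w => by
        ext p
        by_cases hp : κ p.1 = 0
        · simp [hp]
        · simp only [ne_eq, hp, not_false_eq_true, if_true, dot_smul, Pi.smul_apply, smul_eq_mul,
            RingHom.id_apply]; ring }
  obtain ⟨g, hg⟩ := exists_generalized_inverse A
  have hAu : ∃ v, Tendsto (fun k => A (u k)) 𝓤 (𝓝 v) := by
    refine ⟨fun p => if κ p.1 ≠ 0 then -Real.log (|κ p.1| / |κ q|) else 0,
      tendsto_pi_nhds.2 fun p => ?_⟩
    by_cases hp : κ p.1 = 0
    · simp [A, hp]
    · have h1 := ((hratio p.1 p.2).log (div_pos (abs_pos.2 hp) (abs_pos.2 hκq)).ne').neg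
      simp only [hexp, Real.log_exp, neg_neg] at h1
      simpa [A, hp] using h1
  obtain ⟨v, hv⟩ := hAu
  have hgc : Continuous g := g.continuous_of_finiteDimensional
  have hgu : Tendsto (fun k => g (A (u k))) 𝓤 (𝓝 (g v)) := (hgc.tendsto v).comp hv
  let a : ι → Fin n → ℝ := fun k => u k - g (A (u k))
  have hAa : ∀ k, A (a k) = 0 := fun k => by simp [a, map_sub, hg]
  have hFa : ∀ k, ∀ p ∈ S, κ p ≠ 0 → dot (natPt p) (a k) = dot (natPt q) (a k) := by
    intro k p hp hκp
    have := congrFun (hAa k) ⟨p, hp⟩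
    simp only [A, LinearMap.coe_mk, AddHom.coe_mk, ne_eq, hκp, not_false_eq_true, if_true,
      Pi.zero_apply] at this
    linarith
  have ha : ∀ j, ∀ᶠ k in (𝓤 : Filter ι), 0 < a k j := by
    intro j
    have h1 := (hu j).atTop_add (((tendsto_pi_nhds.1 hgu) j).neg)
    filter_upwards [h1.eventually_gt_atTop 0] with k hk
    simpa [a, sub_eq_add_neg] using hk
  have hGa : ∀ p ∈ S, κ p = 0 →
      ∀ᶠ k in (𝓤 : Filter ι), dot (natPt q) (a k) < dot (natPt p) (a k) := by
    intro p hp hκp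
    have h1 : Tendsto (fun k => dot (natPt p) (u k) - dot (natPt q) (u k)) 𝓤 atTop := by
      have h2 := hratio p hp
      rw [hκp, abs_zero, zero_div] at h2
      have h3 : Tendsto (fun k => |mon p (x k)| / |mon q (x k)|) 𝓤 (𝓝[>] 0) :=
        tendsto_nhdsWithin_iff.2 ⟨h2, Eventually.of_forall fun k => by
          rw [hexp]; exact Real.exp_pos _⟩
      refine (tendsto_neg_atBot_atTop.comp (Real.tendsto_log_nhdsGT_zero.comp h3)).congr fun k => ?_
      simp only [Function.comp_apply, hexp, Real.log_exp, neg_neg]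
    have hc : ∀ p, Continuous (dot (natPt p) : (Fin n → ℝ) → ℝ) := fun p => by
      unfold dot; fun_prop
    have h4 : Tendsto (fun k => -(dot (natPt p) (g (A (u k))) - dot (natPt q) (g (A (u k))))) 𝓤
        (𝓝 (-(dot (natPt p) (g v) - dot (natPt q) (g v)))) :=
      ((((hc p).tendsto _).comp hgu).sub (((hc q).tendsto _).comp hgu)).neg
    filter_upwards [(h1.atTop_add h4).eventually_gt_atTop 0] with k hk
    simp only [a, dot_sub]
    linarith
  have hy : ∀ j, ∃ y : ℝ, y ≠ 0 ∧ Tendsto (fun k => x k j * Real.exp (a k j)) 𝓤 (𝓝 y) := by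
    intro j
    have h1 : Tendsto (fun k => Real.exp (-(g (A (u k)) j))) 𝓤 (𝓝 (Real.exp (-(g v j)))) :=
      (Real.continuous_exp.tendsto _).comp ((tendsto_pi_nhds.1 hgu) j).neg
    have h2 : ∀ k, |x k j| * Real.exp (a k j) = Real.exp (-(g (A (u k)) j)) := by
      intro k
      have : |x k j| = Real.exp (-u k j) := by
        simp only [u, neg_neg]; rw [Real.exp_log (abs_pos.2 (hx0 k j))]
      rw [this, ← Real.exp_add]
      congr 1
      simp only [a, Pi.sub_apply]
      ring
    rcases 𝓤.em fun k => 0 < x k j with hp | hp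
    · refine ⟨_, (Real.exp_pos (-(g v j))).ne', h1.congr' ?_⟩
      filter_upwards [hp] with k hk
      rw [← h2, abs_of_pos hk]
    · refine ⟨_, (neg_neg_of_pos (Real.exp_pos (-(g v j)))).ne, h1.neg.congr' ?_⟩
      filter_upwards [hp] with k hk
      rw [← h2, abs_of_nonpos (not_lt.1 hk)]
      ring
  choose y hy0 hy using hy
  have hmon : ∀ p, Tendsto (fun k => mon p (fun j => x k j * Real.exp (a k j))) 𝓤
      (𝓝 (mon p y)) := fun p =>
    ((contDiff_mon p).continuous.tendsto y).comp (tendsto_pi_nhds.2 hy)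
  have hcross : ∀ p ∈ S, κ p ≠ 0 → mon p y * κ q = κ p * mon q y := by
    intro p hp hκp
    refine tendsto_nhds_unique ((hmon p).mul (hκ q hq)) (((hκ p hp).mul (hmon q)).congr fun k => ?_)
    rw [mon_mul_exp, mon_mul_exp, hFa k p hp hκp]
    ring
  obtain ⟨k, h1, h2⟩ := ((eventually_all.2 ha).and ((Finset.eventually_all S).2 fun p hp =>
    (show ∀ᶠ k in (𝓤 : Filter ι), κ p = 0 → dot (natPt q) (a k) < dot (natPt p) (a k) by
      by_cases hκp : κ p = 0
      · filter_upwards [hGa p hp hκp] with k hk _ using hk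
      · exact Eventually.of_forall fun k hk => absurd hk hκp))).exists
  have hcomm : ∀ a b : Fin n → ℝ, dot a b = dot b a := fun a b => by
    simp [dot, mul_comm]
  refine ⟨a k, y, h1, hy0, fun p hp => ⟨fun h => ?_, fun h => ?_, hcross p hp⟩⟩
  · rw [hcomm, hFa k p hp h, hcomm]
  · rw [hcomm, hcomm _ (natPt p)]; exact h2 p hp h

/-- The Euler operator `x_j ∂_j`. -/
noncomputable def eul (j : Fin n) (g : (Fin n → ℝ) → ℝ) (x : Fin n → ℝ) : ℝ :=
  x j * pderiv1 j g x

lemma contDiff_eul {g : (Fin n → ℝ) → ℝ} (hg : ContDiff ℝ (⊤ : ℕ∞) g) (j : Fin n) :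
    ContDiff ℝ (⊤ : ℕ∞) (eul j g) :=
  (contDiff_apply ℝ ℝ j).mul (contDiff_pderiv1 hg j)

lemma eul_mul {u v : (Fin n → ℝ) → ℝ} (hu : ContDiff ℝ (⊤ : ℕ∞) u) (hv : ContDiff ℝ (⊤ : ℕ∞) v)
    (j : Fin n) (x : Fin n → ℝ) :
    eul j (fun x => u x * v x) x = u x * eul j v x + v x * eul j u x := by
  rw [eul, pderiv1_mul hu hv, eul, eul]
  ring

lemma eul_sum {ι : Type*} (s : Finset ι) {F : ι → (Fin n → ℝ) → ℝ}
    (hF : ∀ i, ContDiff ℝ (⊤ : ℕ∞) (F i)) (j : Fin n) (x : Fin n → ℝ) :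
    eul j (fun x => ∑ i ∈ s, F i x) x = ∑ i ∈ s, eul j (F i) x := by
  rw [eul, pderiv1, fderiv_fun_sum fun i _ => (hF i).differentiable (by simp) x]
  simp [eul, pderiv1, Finset.mul_sum]

lemma eul_mon (p : Fin n → ℕ) (j : Fin n) (x : Fin n → ℝ) : eul j (mon p) x = p j * mon p x := by
  have h0 : (Function.update p j 0) j = 0 := by simp
  have h1 : ∀ s, mon p (Function.update x j s) = s ^ p j * mon (Function.update p j 0) x := by
    intro s
    have h2 := mon_update h0 (p j) (Function.update x j s)
    simp only [Function.update_idem, Function.update_eq_self, Function.update_self] at h2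
    rw [h2]
    congr 1
    refine Finset.prod_congr rfl fun i _ => ?_
    by_cases hi : i = j
    · subst hi; simp
    · simp [hi]
  have h3 : HasDerivAt (fun s => mon p (Function.update x j s))
      (fderiv ℝ (mon p) (Function.update x j (x j)) (Pi.single j 1)) (x j) :=
    (((contDiff_mon p).differentiable (by simp) _).hasFDerivAt).comp_hasDerivAt (x j)
      (hasDerivAt_update x j (x j))
  rw [Function.update_eq_self] at h3
  have h4 : HasDerivAt (fun s => mon p (Function.update x j s))
      ((p j * x j ^ (p j - 1)) * mon (Function.update p j 0) x) (x j) := by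
    simp only [h1]
    exact (hasDerivAt_pow _ _).mul_const _
  have h5 := h3.unique h4
  have h6 := h1 (x j)
  rw [Function.update_eq_self] at h6
  rw [eul, pderiv1, h5, h6]
  rcases hp : p j with _ | k
  · simp
  · rw [Nat.add_sub_cancel, pow_succ]; ring

lemma eul_mon_mul {ψ : (Fin n → ℝ) → ℝ} (hψ : ContDiff ℝ (⊤ : ℕ∞) ψ) (p : Fin n → ℕ) (j : Fin n)
    (x : Fin n → ℝ) :
    eul j (fun x => mon p x * ψ x) x = mon p x * (p j * ψ x + eul j ψ x) := by
  rw [eul_mul (contDiff_mon p) hψ, eul_mon]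
  ring

lemma dense_torus : Dense {x : Fin n → ℝ | ∀ i, x i ≠ 0} := by
  have := dense_pi (α := fun _ : Fin n => ℝ) (s := fun _ => {0}ᶜ) univ
    fun i _ => dense_compl_singleton (0 : ℝ)
  refine this.mono fun x hx i => ?_
  exact hx i (mem_univ i)

lemma mon_ne_zero {x : Fin n → ℝ} (hx : ∀ i, x i ≠ 0) (p : Fin n → ℕ) : mon p x ≠ 0 :=
  Finset.prod_ne_zero_iff.2 fun i _ => pow_ne_zero _ (hx i)

section
variable {f : (Fin n → ℝ) → ℝ} {U : Set (Fin n → ℝ)} {S S' : Finset (Fin n → ℕ)}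
  {ψ : (Fin n → ℕ) → (Fin n → ℝ) → ℝ}

lemma taylorCoeff_expansion (hψ : ∀ p, ContDiff ℝ (⊤ : ℕ∞) (ψ p))
    (hfF : f =ᶠ[𝓝 0] fun x => ∑ p ∈ S', mon p x * ψ p x) {b : Fin n → ℕ} (hb : ∀ j, 0 < b j)
    {α : Fin n → ℕ} (hα : ∀ p ∈ S', ∑ j, b j * α j ≤ ∑ j, b j * p j) :
    taylorCoeff f α = if α ∈ S' then ψ α 0 else 0 := by
  rw [taylorCoeff, mderiv_congr hfF, ← taylorCoeff,
    taylorCoeff_sum S' (fun p => (contDiff_mon p).mul (hψ p))]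
  have h : ∀ p ∈ S', taylorCoeff (fun x => mon p x * ψ p x) α = if p = α then ψ α 0 else 0 := by
    intro p hp
    by_cases hpα : p = α
    · rw [if_pos hpα, (taylorCoeff_mon_mul (hψ p) p α).2 hpα, hpα]
    · rw [if_neg hpα]
      refine (taylorCoeff_mon_mul (hψ p) p α).1 fun hle => hpα ?_
      by_contra hne
      obtain ⟨i, hi⟩ : ∃ i, p i ≠ α i := by
        by_contra hall
        push Not at hall
        exact hne (funext hall)
      refine absurd (hα p hp) (not_le.2 (Finset.sum_lt_sum
        (fun j _ => Nat.mul_le_mul_left _ (hle j)) ⟨i, Finset.mem_univ i, ?_⟩))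
      exact Nat.mul_lt_mul_of_pos_left (lt_of_le_of_ne (hle i) hi) (hb i)
  rw [Finset.sum_congr rfl h, Finset.sum_ite_eq']

lemma no_degenerate_weight (hU : IsOpen U) (hU0 : (0 : Fin n → ℝ) ∈ U) (hND : Nondegenerate f U)
    (hΓ : NewtonPolyhedron f = upperHull S) (hSS : S ⊆ S')
    (hS' : ∀ p ∈ S', natPt p ∈ upperHull S) (hψ : ∀ p, ContDiff ℝ (⊤ : ℕ∞) (ψ p))
    (hfF : f =ᶠ[𝓝 0] fun x => ∑ p ∈ S', mon p x * ψ p x) {F : Finset (Fin n → ℕ)} (hF : F ⊆ S')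
    {q : Fin n → ℕ} (hq : q ∈ F) {b : Fin n → ℕ} (hb : ∀ j, 0 < b j)
    (hbF : ∀ p ∈ F, ∑ j, b j * p j = ∑ j, b j * q j)
    (hbG : ∀ p ∈ S', p ∉ F → ∑ j, b j * q j < ∑ j, b j * p j) {y : Fin n → ℝ}
    (hy : ∀ j, y j ≠ 0) (hsum : ∀ j, ∑ p ∈ F, (p j : ℝ) * ψ p 0 * mon p y = 0) : False := by
  classical
  set l := ∑ j, b j * q j with hl
  have hdot : ∀ p : Fin n → ℕ, dot (natPt b) (natPt p) = ((∑ j, b j * p j : ℕ) : ℝ) := by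
    intro p; simp [dot, natPt]
  have hle : ∀ p ∈ S', l ≤ ∑ j, b j * p j := by
    intro p hp
    by_cases h : p ∈ F
    · exact (hbF p h).ge
    · exact (hbG p hp h).le
  have hb0 : (0 : Fin n → ℝ) ≤ natPt b := fun j => Nat.cast_nonneg _
  have hhalf : NewtonPolyhedron f ⊆ Hhalf (natPt b) l := by
    rw [hΓ]
    refine upperHull_subset_Hhalf hb0 fun p hp => ?_
    rw [hdot]
    exact_mod_cast hle p (hSS hp)
  set γ := NewtonPolyhedron f ∩ Hplane (natPt b) l with hγ
  have hqγ : natPt q ∈ γ := ⟨hΓ ▸ hS' q (hF hq), hdot q⟩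
  have hcpt : IsCompact γ := by
    refine isCompact_Icc.of_isClosed_subset (s := Icc 0 fun _ => (l : ℝ)) ?_ ?_
    · rw [hγ, hΓ]
      refine (isClosed_upperHull S).inter (isClosed_eq ?_ continuous_const)
      unfold dot; fun_prop
    · rintro z ⟨hz, hz'⟩
      have hz0 : 0 ≤ z := upperHull_nonneg (hΓ ▸ hz)
      refine ⟨hz0, fun j => ?_⟩
      have h1 : natPt b j * z j ≤ dot (natPt b) z :=
        Finset.single_le_sum (f := fun i => natPt b i * z i)
          (fun i _ => mul_nonneg (hb0 i) (hz0 i)) (Finset.mem_univ j)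
      have h2 : (1 : ℝ) ≤ natPt b j := by
        change (1 : ℝ) ≤ ((b j : ℕ) : ℝ)
        exact_mod_cast hb j
      have h3 : dot (natPt b) z = l := hz'
      have h4 : 0 ≤ z j := hz0 j
      change z j ≤ l
      nlinarith
  have hmem : ∀ α : Fin n → ℕ, natPt α ∈ γ → ∑ j, b j * α j = l := by
    intro α hα
    have := hα.2
    change dot (natPt b) (natPt α) = l at this
    rw [hdot] at this
    exact_mod_cast this
  have hFγ : ∀ p ∈ F, natPt p ∈ γ := by
    intro p hp
    refine ⟨hΓ ▸ hS' p (hF hp), ?_⟩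
    change dot (natPt b) (natPt p) = l
    rw [hdot, hbF p hp]
  have hcoef : ∀ α : Fin n → ℕ, natPt α ∈ γ →
      taylorCoeff f α = if α ∈ F then ψ α 0 else 0 := by
    intro α hα
    have hαl := hmem α hα
    rw [taylorCoeff_expansion hψ hfF hb fun p hp => hαl ▸ hle p hp]
    by_cases h1 : α ∈ F
    · rw [if_pos h1, if_pos (hF h1)]
    · rw [if_neg h1, if_neg fun h2 => (hbG α h2 h1).ne' hαl]
  have hpoly : gammaPartPoly f γ = fun z => ∑ p ∈ F, mon p z * ψ p 0 := by
    funext z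
    have h1 := tsum_subtype {α : Fin n → ℕ | natPt α ∈ γ} fun α => taylorCoeff f α * mon α z
    refine h1.trans ?_
    rw [tsum_eq_sum (s := F) fun α hα => ?_]
    · refine Finset.sum_congr rfl fun p hp => ?_
      rw [indicator_of_mem (s := {α : Fin n → ℕ | natPt α ∈ γ}) (hFγ p hp) fun α =>
          taylorCoeff f α * mon α z,
        hcoef p (hFγ p hp), if_pos hp, mul_comm]
    · by_cases h2 : natPt α ∈ γ
      · rw [indicator_of_mem (s := {α : Fin n → ℕ | natPt α ∈ γ}) h2 fun α =>
          taylorCoeff f α * mon α z, hcoef α h2, if_neg hα, zero_mul]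
      · exact indicator_of_notMem (s := {α : Fin n → ℕ | natPt α ∈ γ}) h2 _
  obtain ⟨t, ht, htU⟩ : ∃ t : ℝ, 0 < t ∧ scaleAction b t y ∈ U := by
    have h1 : scaleAction b 0 y = 0 := by
      funext j; simp [scaleAction, (hb j).ne']
    have h2 : ∀ᶠ t in 𝓝 (0 : ℝ), scaleAction b t y ∈ U :=
      (continuous_scaleAction b y).continuousAt.eventually_mem (hU.mem_nhds (by rwa [h1]))
    obtain ⟨t, h3, h4⟩ := ((h2.filter_mono nhdsWithin_le_nhds).and
      (self_mem_nhdsWithin (s := Ioi (0 : ℝ)))).exists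
    exact ⟨t, h4, h3⟩
  set z := scaleAction b t y with hz
  have hz0 : ∀ j, z j ≠ 0 := fun j => mul_ne_zero (pow_pos ht _).ne' (hy j)
  refine hND γ (isFaceOf_natPt hhalf) ⟨_, hqγ⟩ hcpt z htU hz0 ?_
  have hpart : ∀ j, pderiv1 j (gammaPartPoly f γ) z = 0 := by
    intro j
    refine (mul_eq_zero.1 (?_ : z j * pderiv1 j (gammaPartPoly f γ) z = 0)).resolve_left (hz0 j)
    change eul j (gammaPartPoly f γ) z = 0
    rw [hpoly, eul_sum F (fun p => (contDiff_mon p).mul contDiff_const)]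
    have h1 : ∀ p ∈ F, eul j (fun x => mon p x * ψ p 0) z =
        t ^ l * ((p j : ℝ) * ψ p 0 * mon p y) := by
      intro p hp
      rw [eul_mon_mul contDiff_const, hz, mon_scaleAction, hbF p hp]
      simp only [eul, pderiv1, fderiv_const_apply, zero_apply]
      ring
    rw [Finset.sum_congr rfl h1, ← Finset.mul_sum, hsum, mul_zero]
  ext v
  have := LinearMap.pi_apply_eq_sum_univ
    (fderiv ℝ (gammaPartPoly f γ) z : (Fin n → ℝ) →ₗ[ℝ] ℝ) v
  simp only [ContinuousLinearMap.coe_coe, smul_eq_mul] at this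
  rw [this, zero_apply]
  refine Finset.sum_eq_zero fun i _ => ?_
  have h2 := hpart i
  have h3 : (fun j => if i = j then (1 : ℝ) else 0) = Pi.single i 1 := by
    ext j; simp [Pi.single_apply, eq_comm]
  rw [h3]
  rw [pderiv1] at h2
  rw [h2, mul_zero]

/-- The sum of the absolute values of the monomials. -/
def absSum (S : Finset (Fin n → ℕ)) (x : Fin n → ℝ) : ℝ := ∑ p ∈ S, |mon p x|

lemma continuous_absSum (S : Finset (Fin n → ℕ)) : Continuous (absSum S) :=
  continuous_finsetSum _ fun p _ => (contDiff_mon p).continuous.abs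

lemma absSum_nonneg (S : Finset (Fin n → ℕ)) (x : Fin n → ℝ) : 0 ≤ absSum S x :=
  Finset.sum_nonneg fun _ _ => abs_nonneg _

lemma abs_mon_le_absSum {p : Fin n → ℕ} (hp : p ∈ S) (x : Fin n → ℝ) :
    |mon p x| ≤ absSum S x :=
  Finset.single_le_sum (f := fun p => |mon p x|) (fun _ _ => abs_nonneg _) hp

theorem nondegeneracy_estimate (hU : IsOpen U) (hU0 : (0 : Fin n → ℝ) ∈ U)
    (hND : Nondegenerate f U) (hS : S.Nonempty)
    (hΓ : NewtonPolyhedron f = upperHull S) (hSS : S ⊆ S')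
    (hS' : ∀ p ∈ S', natPt p ∈ upperHull S) (hψ : ∀ p, ContDiff ℝ (⊤ : ℕ∞) (ψ p))
    (hfF : f =ᶠ[𝓝 0] fun x => ∑ p ∈ S', mon p x * ψ p x) :
    ∃ c > 0, ∃ r > 0, ∀ x : Fin n → ℝ, (∀ i, |x i| < r) →
      c * absSum S' x ^ 2 ≤ ∑ j, eul j (fun x => ∑ p ∈ S', mon p x * ψ p x) x ^ 2 := by
  classical
  by_contra hcon
  push Not at hcon
  set F : (Fin n → ℝ) → ℝ := fun x => ∑ p ∈ S', mon p x * ψ p x with hF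
  have hFs : ContDiff ℝ (⊤ : ℕ∞) F := ContDiff.sum fun p _ => (contDiff_mon p).mul (hψ p)
  have hseq : ∀ k : ℕ, ∃ x : Fin n → ℝ, (∀ i, x i ≠ 0) ∧ (∀ i, |x i| < 1 / ((k : ℝ) + 1)) ∧
      ∑ j, eul j F x ^ 2 < 1 / ((k : ℝ) + 1) * absSum S' x ^ 2 := by
    intro k
    have hk : 0 < 1 / ((k : ℝ) + 1) := Nat.one_div_pos_of_nat
    obtain ⟨x, hx1, hx2⟩ := hcon _ hk _ hk
    have hopen : IsOpen {x : Fin n → ℝ | (∀ i, |x i| < 1 / ((k : ℝ) + 1)) ∧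
        ∑ j, eul j F x ^ 2 < 1 / ((k : ℝ) + 1) * absSum S' x ^ 2} := by
      refine IsOpen.inter (s := {x : Fin n → ℝ | ∀ i, |x i| < 1 / ((k : ℝ) + 1)}) ?_
        (isOpen_lt ?_ (((continuous_absSum S').pow 2).const_mul _))
      · simp only [ofPred_forall]
        exact isOpen_iInter_of_finite fun i =>
          isOpen_lt (continuous_apply i).abs continuous_const
      · exact continuous_finsetSum _ fun j _ => (contDiff_eul hFs j).continuous.pow 2
    obtain ⟨z, hz1, hz2⟩ := dense_torus.inter_open_nonempty _ hopen ⟨x, hx1, hx2⟩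
    exact ⟨z, hz2, hz1.1, hz1.2⟩
  choose x hx0 hxk hxρ using hseq
  let 𝓤 : Ultrafilter ℕ := hyperfilter ℕ
  have hU𝓤 : (𝓤 : Filter ℕ) ≤ atTop := by
    rw [← Nat.cofinite_eq_atTop]; exact hyperfilter_le_cofinite
  have hsmall : Tendsto (fun k : ℕ => 1 / ((k : ℝ) + 1)) 𝓤 (𝓝 0) :=
    tendsto_one_div_add_atTop_nhds_zero_nat.mono_left hU𝓤
  have hxlim : ∀ j, Tendsto (fun k => x k j) 𝓤 (𝓝 0) := fun j =>
    squeeze_zero_norm (fun k => (hxk k j).le) hsmall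
  have hS'n : S'.Nonempty := hS.mono hSS
  have hh : ∀ k, 0 < absSum S' (x k) := fun k => by
    obtain ⟨p, hp⟩ := hS'n
    exact (abs_pos.2 (mon_ne_zero (hx0 k) p)).trans_le (abs_mon_le_absSum hp _)
  have hκ : ∀ p, ∃ κ, p ∈ S' → Tendsto (fun k => mon p (x k) / absSum S' (x k)) 𝓤 (𝓝 κ) := by
    intro p
    by_cases hp : p ∈ S'
    · have hle : (𝓤.map fun k => mon p (x k) / absSum S' (x k) : Filter ℝ) ≤ 𝓟 (Icc (-1) 1) := by
        refine tendsto_principal.2 (Eventually.of_forall fun k => ?_)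
        rw [mem_Icc, ← abs_le, abs_div, abs_of_pos (hh k), div_le_one (hh k)]
        exact abs_mon_le_absSum hp _
      obtain ⟨κ, -, hκ⟩ := (isCompact_Icc (a := (-1 : ℝ)) (b := 1)).ultrafilter_le_nhds _ hle
      exact ⟨κ, fun _ => hκ⟩
    · exact ⟨0, fun h => absurd h hp⟩
  choose κ hκ using hκ
  obtain ⟨q, hq, hκq⟩ : ∃ q ∈ S', κ q ≠ 0 := by
    by_contra hall
    push Not at hall
    have h1 : Tendsto (fun k => ∑ p ∈ S', |mon p (x k) / absSum S' (x k)|) 𝓤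
        (𝓝 (∑ p ∈ S', |κ p|)) := tendsto_finsetSum _ fun p hp => (hκ p hp).abs
    rw [Finset.sum_eq_zero fun p hp => by rw [hall p hp, abs_zero]] at h1
    have h2 : ∀ k, ∑ p ∈ S', |mon p (x k) / absSum S' (x k)| = 1 := by
      intro k
      simp only [abs_div, abs_of_pos (hh k)]
      rw [← Finset.sum_div]
      exact div_self (hh k).ne'
    simp only [h2] at h1
    exact one_ne_zero (tendsto_nhds_unique tendsto_const_nhds h1)
  have hx : Tendsto x 𝓤 (𝓝 0) := tendsto_pi_nhds.2 hxlim
  have heul : ∀ j, ∑ p ∈ S', κ p * (p j * ψ p 0) = 0 := by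
    intro j
    have h1 : Tendsto (fun k => ∑ p ∈ S', mon p (x k) / absSum S' (x k) *
        (p j * ψ p (x k) + eul j (ψ p) (x k))) 𝓤 (𝓝 (∑ p ∈ S', κ p * (p j * ψ p 0 +
          eul j (ψ p) 0))) := by
      refine tendsto_finsetSum _ fun p hp => (hκ p hp).mul ?_
      exact ((((hψ p).continuous.tendsto 0).comp hx).const_mul _).add
        (((contDiff_eul (hψ p) j).continuous.tendsto 0).comp hx)
    have h2 : ∀ k, ∑ p ∈ S', mon p (x k) / absSum S' (x k) *
        (p j * ψ p (x k) + eul j (ψ p) (x k)) = eul j F (x k) / absSum S' (x k) := by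
      intro k
      rw [hF, eul_sum S' (fun p => (contDiff_mon p).mul (hψ p)), Finset.sum_div]
      refine Finset.sum_congr rfl fun p _ => ?_
      rw [eul_mon_mul (hψ p)]
      ring
    have h3 : Tendsto (fun k => (eul j F (x k) / absSum S' (x k)) ^ 2) 𝓤 (𝓝 0) := by
      refine squeeze_zero (fun k => sq_nonneg _) (fun k => ?_) hsmall
      rw [div_pow, div_le_iff₀ (pow_pos (hh k) 2)]
      refine le_trans ?_ (hxρ k).le
      exact Finset.single_le_sum (f := fun j => eul j F (x k) ^ 2) (fun _ _ => sq_nonneg _)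
        (Finset.mem_univ j)
    simp only [h2] at h1
    have h4 := tendsto_nhds_unique h3 (h1.pow 2)
    have h5 := pow_eq_zero_iff two_ne_zero |>.1 h4.symm
    simpa [eul] using h5
  obtain ⟨a, y, ha, hy, hay⟩ := exists_degeneration 𝓤 hx0 hxlim S' hh hκ hq hκq
  let F0 := S'.filter fun p => κ p ≠ 0
  have hF0 : ∀ p, p ∈ F0 ↔ p ∈ S' ∧ κ p ≠ 0 := fun p => Finset.mem_filter
  obtain ⟨b, hb, hbF, hbG⟩ := exists_nat_vector_of_real F0 (S' \ F0) q ha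
    (fun p hp => (hay p ((hF0 p).1 hp).1).1 ((hF0 p).1 hp).2) (fun p hp => by
      rw [Finset.mem_sdiff, hF0] at hp
      refine (hay p hp.1).2.1 ?_
      by_contra h
      exact hp.2 ⟨hp.1, h⟩)
  refine no_degenerate_weight hU hU0 hND hΓ hSS hS' hψ hfF (Finset.filter_subset _ _)
    ((hF0 q).2 ⟨hq, hκq⟩) hb hbF (fun p hp hpF => hbG p (Finset.mem_sdiff.2 ⟨hp, hpF⟩)) hy
    fun j => ?_
  refine (mul_eq_zero.1 (?_ : κ q * _ = 0)).resolve_left hκq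
  have h6 : ∑ p ∈ S', κ p * (p j * ψ p 0) = ∑ p ∈ F0, κ p * (p j * ψ p 0) := by
    refine (Finset.sum_filter_of_ne fun p _ hp => ?_).symm
    exact left_ne_zero_of_mul hp
  have h7 : ∀ p ∈ F0, κ q * ((p j : ℝ) * ψ p 0 * mon p y) =
      mon q y * (κ p * (p j * ψ p 0)) := by
    intro p hp
    have := (hay p ((hF0 p).1 hp).1).2.2 ((hF0 p).1 hp).2
    linear_combination (p j : ℝ) * ψ p 0 * this
  rw [Finset.mul_sum, Finset.sum_congr rfl h7, ← Finset.mul_sum, ← h6, heul, mul_zero]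

end

/-- The Euler operator `x_j ∂_j` on complex valued functions. -/
noncomputable def ceul (j : Fin n) (g : (Fin n → ℝ) → ℂ) (x : Fin n → ℝ) : ℂ :=
  x j • fderiv ℝ g x (Pi.single j 1)

lemma contDiff_ceul {g : (Fin n → ℝ) → ℂ} (hg : ContDiff ℝ (⊤ : ℕ∞) g) (j : Fin n) :
    ContDiff ℝ (⊤ : ℕ∞) (ceul j g) :=
  (contDiff_apply ℝ ℝ j).smul ((hg.fderiv_right (by simp)).clm_apply contDiff_const)

lemma ceul_smul {u : (Fin n → ℝ) → ℝ} {a : (Fin n → ℝ) → ℂ} (hu : ContDiff ℝ (⊤ : ℕ∞) u)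
    (ha : ContDiff ℝ (⊤ : ℕ∞) a) (j : Fin n) (x : Fin n → ℝ) :
    ceul j (fun x => u x • a x) x = u x • ceul j a x + eul j u x • a x := by
  rw [ceul, fderiv_fun_smul (hu.differentiable (by simp) x) (ha.differentiable (by simp) x)]
  simp only [ceul, eul, pderiv1, FunLike.coe_add, FunLike.coe_smul, Pi.add_apply, Pi.smul_apply,
    ContinuousLinearMap.smulRight_apply, smul_add, smul_smul]
  rw [mul_comm (x j) (u x)]

lemma ceul_add {a b : (Fin n → ℝ) → ℂ} (ha : ContDiff ℝ (⊤ : ℕ∞) a)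
    (hb : ContDiff ℝ (⊤ : ℕ∞) b) (j : Fin n) (x : Fin n → ℝ) :
    ceul j (fun x => a x + b x) x = ceul j a x + ceul j b x := by
  rw [ceul, fderiv_fun_add (ha.differentiable (by simp) x) (hb.differentiable (by simp) x)]
  simp [ceul, smul_add]

lemma ceul_const_mul {a : (Fin n → ℝ) → ℂ} (ha : ContDiff ℝ (⊤ : ℕ∞) a) (c : ℂ) (j : Fin n)
    (x : Fin n → ℝ) : ceul j (fun x => c * a x) x = c * ceul j a x := by
  rw [ceul, fderiv_const_mul (ha.differentiable (by simp) x)]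
  simp only [ceul, FunLike.coe_smul, Pi.smul_apply, smul_eq_mul, Complex.real_smul]
  ring

lemma ceul_eq_zero {g : (Fin n → ℝ) → ℂ} {K : Set (Fin n → ℝ)} (hK : IsClosed K)
    (h0 : ∀ x ∉ K, g x = 0) (j : Fin n) : ∀ x ∉ K, ceul j g x = 0 := by
  intro x hx
  have h1 : g =ᶠ[𝓝 x] fun _ => 0 := by
    filter_upwards [hK.isOpen_compl.mem_nhds hx] with y hy using h0 y hy
  rw [ceul, h1.fderiv_eq]
  simp

/-- Functions of the form `∑ x^p ψ_p(x)` with smooth `ψ_p`. -/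
def MonForm (S : Finset (Fin n → ℕ)) (g : (Fin n → ℝ) → ℝ) : Prop :=
  ∃ ψ : (Fin n → ℕ) → (Fin n → ℝ) → ℝ, (∀ p, ContDiff ℝ (⊤ : ℕ∞) (ψ p)) ∧
    g = fun x => ∑ p ∈ S, mon p x * ψ p x

lemma MonForm.contDiff {S : Finset (Fin n → ℕ)} {g : (Fin n → ℝ) → ℝ} (h : MonForm S g) :
    ContDiff ℝ (⊤ : ℕ∞) g := by
  obtain ⟨ψ, hψ, rfl⟩ := h
  exact ContDiff.sum fun p _ => (contDiff_mon p).mul (hψ p)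

lemma MonForm.eul {S : Finset (Fin n → ℕ)} {g : (Fin n → ℝ) → ℝ} (h : MonForm S g) (j : Fin n) :
    MonForm S (eul j g) := by
  obtain ⟨ψ, hψ, rfl⟩ := h
  refine ⟨fun p x => p j * ψ p x + KN.eul j (ψ p) x,
    fun p => (contDiff_const.mul (hψ p)).add (contDiff_eul (hψ p) j), ?_⟩
  funext x
  rw [eul_sum S (fun p => (contDiff_mon p).mul (hψ p))]
  exact Finset.sum_congr rfl fun p _ => eul_mon_mul (hψ p) p j x

lemma MonForm.exists_bound {S : Finset (Fin n → ℕ)} {g : (Fin n → ℝ) → ℝ} (h : MonForm S g)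
    {K : Set (Fin n → ℝ)} (hK : IsCompact K) : ∃ C, 0 ≤ C ∧ ∀ x ∈ K, |g x| ≤ C * absSum S x := by
  obtain ⟨ψ, hψ, rfl⟩ := h
  have hb : ∀ p, ∃ C, ∀ x ∈ K, ‖ψ p x‖ ≤ C := fun p =>
    hK.exists_bound_of_continuousOn (hψ p).continuous.continuousOn
  choose C hC using hb
  refine ⟨∑ p ∈ S, |C p|, Finset.sum_nonneg fun _ _ => abs_nonneg _, fun x hx => ?_⟩
  refine (Finset.abs_sum_le_sum_abs _ _).trans ?_
  rw [Finset.sum_mul]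
  refine Finset.sum_le_sum fun p hp => ?_
  rw [abs_mul, mul_comm]
  exact mul_le_mul ((hC p x hx).trans (le_abs_self _)) (abs_mon_le_absSum hp x) (abs_nonneg _)
    (abs_nonneg _)

lemma MonForm.exists_tendsto {S : Finset (Fin n → ℕ)} {g : (Fin n → ℝ) → ℝ} (h : MonForm S g)
    {ι : Type*} {l : Filter ι} {t : ι → ℝ} {x : ι → Fin n → ℝ} {z : Fin n → ℝ}
    (hx : Tendsto x l (𝓝 z)) {m : (Fin n → ℕ) → ℝ}
    (hm : ∀ p ∈ S, Tendsto (fun k => t k * mon p (x k)) l (𝓝 (m p))) :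
    ∃ w, Tendsto (fun k => t k * g (x k)) l (𝓝 w) := by
  obtain ⟨ψ, hψ, rfl⟩ := h
  refine ⟨∑ p ∈ S, m p * ψ p z, ?_⟩
  simp only [Finset.mul_sum, ← mul_assoc]
  exact tendsto_finsetSum _ fun p hp => (hm p hp).mul (((hψ p).continuous.tendsto z).comp hx)

/-- The weight `1 + t² ∑ (x_j ∂_j F)²`. -/
noncomputable def wt (F : (Fin n → ℝ) → ℝ) (t : ℝ) (x : Fin n → ℝ) : ℝ :=
  1 + ∑ j, (t * eul j F x) ^ 2

lemma one_le_wt (F : (Fin n → ℝ) → ℝ) (t : ℝ) (x : Fin n → ℝ) : 1 ≤ wt F t x :=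
  le_add_of_nonneg_right (Finset.sum_nonneg fun _ _ => sq_nonneg _)

lemma wt_pos (F : (Fin n → ℝ) → ℝ) (t : ℝ) (x : Fin n → ℝ) : 0 < wt F t x :=
  zero_lt_one.trans_le (one_le_wt F t x)

lemma contDiff_wt {F : (Fin n → ℝ) → ℝ} (hF : ContDiff ℝ (⊤ : ℕ∞) F) (t : ℝ) :
    ContDiff ℝ (⊤ : ℕ∞) (wt F t) :=
  contDiff_const.add (ContDiff.sum fun j _ => (contDiff_const.mul (contDiff_eul hF j)).pow 2)

lemma contDiff_wt_inv {F : (Fin n → ℝ) → ℝ} (hF : ContDiff ℝ (⊤ : ℕ∞) F) (t : ℝ) :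
    ContDiff ℝ (⊤ : ℕ∞) fun x => (wt F t x)⁻¹ :=
  (contDiff_wt hF t).inv fun x => (wt_pos F t x).ne'

lemma eul_const_mul {u : (Fin n → ℝ) → ℝ} (hu : ContDiff ℝ (⊤ : ℕ∞) u) (c : ℝ) (j : Fin n)
    (x : Fin n → ℝ) : eul j (fun x => c * u x) x = c * eul j u x := by
  rw [eul, pderiv1_const_mul hu, eul]; ring

lemma eul_wt {F : (Fin n → ℝ) → ℝ} (hF : ContDiff ℝ (⊤ : ℕ∞) F) (t : ℝ) (j : Fin n)
    (x : Fin n → ℝ) :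
    eul j (wt F t) x = ∑ i, 2 * ((t * eul i F x) * (t * eul j (eul i F) x)) := by
  have h1 : ∀ i, ContDiff ℝ (⊤ : ℕ∞) fun x => t * eul i F x := fun i =>
    contDiff_const.mul (contDiff_eul hF i)
  have h2 : eul j (wt F t) x = eul j (fun x => ∑ i, (t * eul i F x) * (t * eul i F x)) x := by
    have : wt F t = fun x => 1 + ∑ i, (t * eul i F x) * (t * eul i F x) := by
      funext x; simp only [wt, sq]
    rw [this]
    change x j * fderiv ℝ _ x _ = x j * fderiv ℝ _ x _
    rw [fderiv_const_add]
  rw [h2, eul_sum _ fun i => (h1 i).mul (h1 i)]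
  refine Finset.sum_congr rfl fun i _ => ?_
  rw [eul_mul (h1 i) (h1 i), eul_const_mul (contDiff_eul hF i)]
  ring

lemma eul_wt_inv {F : (Fin n → ℝ) → ℝ} (hF : ContDiff ℝ (⊤ : ℕ∞) F) (t : ℝ) (j : Fin n)
    (x : Fin n → ℝ) :
    eul j (fun x => (wt F t x)⁻¹) x = -(eul j (wt F t) x * (wt F t x)⁻¹ * (wt F t x)⁻¹) := by
  have h1 := eul_mul (contDiff_wt hF t) (contDiff_wt_inv hF t) j x
  have h2 : (fun x => wt F t x * (wt F t x)⁻¹) = fun _ => 1 := by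
    funext x; exact mul_inv_cancel₀ (wt_pos F t x).ne'
  rw [h2] at h1
  have h3 : eul j (fun _ => (1 : ℝ)) x = 0 := by simp [eul, pderiv1]
  rw [h3] at h1
  have h4 := (wt_pos F t x).ne'
  field_simp
  field_simp at h1
  linear_combination -h1

/-- Symbols: the algebra of amplitudes `a(t,x)` generated by smooth functions supported in `K`,
multiplication by `t g` with `g` a combination of the monomials, and division by the weight. -/
inductive Sym (S : Finset (Fin n → ℕ)) (F : (Fin n → ℝ) → ℝ) (K : Set (Fin n → ℝ)) :
    ℤ → (ℝ → (Fin n → ℝ) → ℂ) → Prop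
  | zero (k : ℤ) : Sym S F K k (fun _ _ => 0)
  | base (g : (Fin n → ℝ) → ℂ) (hg : ContDiff ℝ (⊤ : ℕ∞) g) (h0 : ∀ x ∉ K, g x = 0) :
      Sym S F K 0 (fun _ => g)
  | mulf (k : ℤ) (a : ℝ → (Fin n → ℝ) → ℂ) (g : (Fin n → ℝ) → ℝ) (ha : Sym S F K k a)
      (hg : MonForm S g) : Sym S F K (k - 1) (fun t x => (t * g x) • a t x)
  | divw (k : ℤ) (a : ℝ → (Fin n → ℝ) → ℂ) (ha : Sym S F K k a) :
      Sym S F K (k + 2) (fun t x => (wt F t x)⁻¹ • a t x)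
  | add (k : ℤ) (a b : ℝ → (Fin n → ℝ) → ℂ) (ha : Sym S F K k a) (hb : Sym S F K k b) :
      Sym S F K k (fun t x => a t x + b t x)
  | const_mul (k : ℤ) (c : ℂ) (a : ℝ → (Fin n → ℝ) → ℂ) (ha : Sym S F K k a) :
      Sym S F K k (fun t x => c * a t x)
  | mono (k : ℤ) (a : ℝ → (Fin n → ℝ) → ℂ) (ha : Sym S F K (k + 1) a) : Sym S F K k a

namespace Sym
variable {S : Finset (Fin n → ℕ)} {F : (Fin n → ℝ) → ℝ} {K : Set (Fin n → ℝ)} {k : ℤ}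
  {a : ℝ → (Fin n → ℝ) → ℂ}

lemma sum {ι : Type*} (s : Finset ι) {b : ι → ℝ → (Fin n → ℝ) → ℂ}
    (hb : ∀ i ∈ s, Sym S F K k (b i)) : Sym S F K k (fun t x => ∑ i ∈ s, b i t x) := by
  classical
  induction s using Finset.induction_on with
  | empty => simpa using Sym.zero k
  | insert i s hi ih =>
    simp only [Finset.sum_insert hi]
    exact Sym.add k _ _ (hb i (Finset.mem_insert_self _ _))
      (ih fun j hj => hb j (Finset.mem_insert_of_mem hj))

lemma contDiff (ha : Sym S F K k a) (hF : ContDiff ℝ (⊤ : ℕ∞) F) (t : ℝ) :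
    ContDiff ℝ (⊤ : ℕ∞) (a t) := by
  induction ha with
  | zero k => exact contDiff_const
  | base g hg h0 => exact hg
  | mulf k a g ha hg ih => exact (contDiff_const.mul hg.contDiff).smul ih
  | divw k a ha ih => exact (contDiff_wt_inv hF t).smul ih
  | add k a b ha hb iha ihb => exact iha.add ihb
  | const_mul k c a ha ih => exact contDiff_const.mul ih
  | mono k a ha ih => exact ih

lemma eq_zero (ha : Sym S F K k a) (t : ℝ) : ∀ x ∉ K, a t x = 0 := by
  induction ha with
  | zero k => exact fun _ _ => rfl
  | base g hg h0 => exact h0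
  | mulf k a g ha hg ih => exact fun x hx => by simp [ih x hx]
  | divw k a ha ih => exact fun x hx => by simp [ih x hx]
  | add k a b ha hb iha ihb => exact fun x hx => by simp [iha x hx, ihb x hx]
  | const_mul k c a ha ih => exact fun x hx => by simp [ih x hx]
  | mono k a ha ih => exact ih

lemma eul (ha : Sym S F K k a) (hF : MonForm S F) (hK : IsClosed K) (j : Fin n) :
    Sym S F K k (fun t => ceul j (a t)) := by
  have hFs := hF.contDiff
  induction ha with
  | zero k =>
    have : (fun t : ℝ => ceul j fun _ : Fin n → ℝ => (0 : ℂ)) = fun _ _ => 0 := by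
      funext t x; simp [ceul]
    rw [this]; exact Sym.zero k
  | base g hg h0 => exact Sym.base _ (contDiff_ceul hg j) (ceul_eq_zero hK h0 j)
  | mulf k a g ha hg ih =>
    have h1 : (fun t => ceul j fun x => (t * g x) • a t x) = fun t x =>
        (t * g x) • ceul j (a t) x + (t * KN.eul j g x) • a t x := by
      funext t x
      rw [ceul_smul (contDiff_const.mul hg.contDiff) (ha.contDiff hFs t),
        eul_const_mul hg.contDiff]
    rw [h1]
    exact Sym.add _ _ _ (Sym.mulf _ _ _ ih hg) (Sym.mulf _ _ _ ha (hg.eul j))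
  | divw k a ha ih =>
    have h1 : (fun t => ceul j fun x => (wt F t x)⁻¹ • a t x) = fun t x =>
        (wt F t x)⁻¹ • ceul j (a t) x + ∑ i, (-2 : ℂ) * ((wt F t x)⁻¹ • ((wt F t x)⁻¹ •
          ((t * KN.eul i F x) • ((t * KN.eul j (KN.eul i F) x) • a t x)))) := by
      funext t x
      rw [ceul_smul (contDiff_wt_inv hFs t) (ha.contDiff hFs t), eul_wt_inv hFs, eul_wt hFs]
      simp only [Complex.real_smul, ← Finset.mul_sum]
      push_cast
      simp only [Finset.sum_mul, Finset.mul_sum, ← Finset.sum_neg_distrib]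
      congr 1
      exact Finset.sum_congr rfl fun i _ => by ring
    rw [h1]
    refine Sym.add _ _ _ (Sym.divw _ _ ih) (Sym.sum _ fun i _ => Sym.const_mul _ _ _ ?_)
    have h2 := Sym.divw _ _ (Sym.divw _ _ (Sym.mulf _ _ _ (Sym.mulf _ _ _ ha ((hF.eul i).eul j))
      (hF.eul i)))
    have h3 : k - 1 - 1 + 2 + 2 = k + 2 := by ring
    rwa [h3] at h2
  | add k a b ha hb iha ihb =>
    have h1 : (fun t => ceul j fun x => a t x + b t x) = fun t x =>
        ceul j (a t) x + ceul j (b t) x := by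
      funext t x
      rw [ceul_add (ha.contDiff hFs t) (hb.contDiff hFs t)]
    rw [h1]; exact Sym.add _ _ _ iha ihb
  | const_mul k c a ha ih =>
    have h1 : (fun t => ceul j fun x => c * a t x) = fun t x => c * ceul j (a t) x := by
      funext t x
      rw [ceul_const_mul (ha.contDiff hFs t)]
    rw [h1]; exact Sym.const_mul _ _ _ ih
  | mono k a ha ih => exact Sym.mono _ _ ih

lemma exists_bound (ha : Sym S F K k a) (hK : IsCompact K) {c : ℝ} (hc : 0 < c)
    (hest : ∀ x ∈ K, c * absSum S x ^ 2 ≤ ∑ j, KN.eul j F x ^ 2) :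
    ∃ C, 0 ≤ C ∧ ∀ t x, ‖a t x‖ ≤ C * √(wt F t x) ^ (-k) := by
  have hw : ∀ t x, 0 < √(wt F t x) := fun t x => Real.sqrt_pos.2 (wt_pos F t x)
  induction ha with
  | zero k => exact ⟨0, le_rfl, fun t x => by simp⟩
  | base g hg h0 =>
    obtain ⟨C, hC⟩ := hK.exists_bound_of_continuousOn hg.continuous.continuousOn
    refine ⟨|C|, abs_nonneg _, fun t x => ?_⟩
    rw [neg_zero, zpow_zero, mul_one]
    by_cases hx : x ∈ K
    · exact (hC x hx).trans (le_abs_self _)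
    · change ‖g x‖ ≤ _
      rw [h0 x hx, norm_zero]; exact abs_nonneg _
  | mulf k a g ha hg ih =>
    obtain ⟨C, hC0, hC⟩ := ih
    obtain ⟨D, hD0, hD⟩ := hg.exists_bound hK
    refine ⟨D * (√c)⁻¹ * C, by positivity, fun t x => ?_⟩
    by_cases hx : x ∈ K
    · have h1 : |t| * absSum S x ≤ (√c)⁻¹ * √(wt F t x) := by
        rw [inv_mul_eq_div, le_div_iff₀ (Real.sqrt_pos.2 hc)]
        refine Real.le_sqrt_of_sq_le ?_
        rw [mul_pow, Real.sq_sqrt hc.le, mul_pow, sq_abs, wt]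
        have h2 := mul_le_mul_of_nonneg_left (hest x hx) (sq_nonneg t)
        rw [Finset.mul_sum] at h2
        simp only [← mul_pow] at h2
        linarith
      have h3 : |t * g x| ≤ D * (√c)⁻¹ * √(wt F t x) := by
        rw [abs_mul]
        calc |t| * |g x| ≤ |t| * (D * absSum S x) :=
              mul_le_mul_of_nonneg_left (hD x hx) (abs_nonneg _)
          _ = D * (|t| * absSum S x) := by ring
          _ ≤ D * ((√c)⁻¹ * √(wt F t x)) := mul_le_mul_of_nonneg_left h1 hD0
          _ = _ := by ring
      rw [norm_smul, Real.norm_eq_abs]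
      calc |t * g x| * ‖a t x‖ ≤ (D * (√c)⁻¹ * √(wt F t x)) * (C * √(wt F t x) ^ (-k)) :=
            mul_le_mul h3 (hC t x) (norm_nonneg _) (by positivity)
        _ = D * (√c)⁻¹ * C * √(wt F t x) ^ (-(k - 1)) := by
            have : -(k - 1) = -k + 1 := by ring
            rw [this, zpow_add_one₀ (hw t x).ne']
            ring
    · change ‖(t * g x) • a t x‖ ≤ _
      rw [ha.eq_zero t x hx, smul_zero, norm_zero]
      have := hw t x
      positivity
  | divw k a ha ih =>
    obtain ⟨C, hC0, hC⟩ := ih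
    refine ⟨C, hC0, fun t x => ?_⟩
    rw [norm_smul, norm_inv, Real.norm_eq_abs, abs_of_pos (wt_pos F t x)]
    have h1 : -(k + 2) = -2 + -k := by ring
    have h2 : √(wt F t x) ^ (-2 : ℤ) = (wt F t x)⁻¹ := by
      rw [zpow_neg]
      congr 1
      exact_mod_cast Real.sq_sqrt (wt_pos F t x).le
    rw [h1, zpow_add₀ (hw t x).ne', h2, mul_left_comm]
    exact mul_le_mul_of_nonneg_left (hC t x) (inv_nonneg.2 (wt_pos F t x).le)
  | add k a b ha hb iha ihb =>
    obtain ⟨C, hC0, hC⟩ := iha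
    obtain ⟨D, hD0, hD⟩ := ihb
    refine ⟨C + D, by positivity, fun t x => (norm_add_le _ _).trans ?_⟩
    rw [add_mul]
    exact add_le_add (hC t x) (hD t x)
  | const_mul k c a ha ih =>
    obtain ⟨C, hC0, hC⟩ := ih
    refine ⟨‖c‖ * C, by positivity, fun t x => ?_⟩
    rw [norm_mul, mul_assoc]
    exact mul_le_mul_of_nonneg_left (hC t x) (norm_nonneg _)
  | mono k a ha ih =>
    obtain ⟨C, hC0, hC⟩ := ih
    refine ⟨C, hC0, fun t x => (hC t x).trans (mul_le_mul_of_nonneg_left ?_ hC0)⟩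
    exact zpow_le_zpow_right₀ (Real.one_le_sqrt.2 (one_le_wt F t x)) (by linarith)

lemma exists_tendsto (ha : Sym S F K k a) (hF : MonForm S F) {ι : Type*} {l : Filter ι}
    {t : ι → ℝ} {x : ι → Fin n → ℝ} {z : Fin n → ℝ} (hx : Tendsto x l (𝓝 z))
    {m : (Fin n → ℕ) → ℝ} (hm : ∀ p ∈ S, Tendsto (fun k => t k * mon p (x k)) l (𝓝 (m p))) :
    ∃ w, Tendsto (fun k => a (t k) (x k)) l (𝓝 w) := by
  induction ha with
  | zero k => exact ⟨0, tendsto_const_nhds⟩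
  | base g hg h0 => exact ⟨g z, (hg.continuous.tendsto z).comp hx⟩
  | mulf k a g ha hg ih =>
    obtain ⟨w, hw⟩ := ih
    obtain ⟨v, hv⟩ := hg.exists_tendsto hx hm
    exact ⟨v • w, hv.smul hw⟩
  | divw k a ha ih =>
    obtain ⟨w, hw⟩ := ih
    choose v hv using fun j => (hF.eul j).exists_tendsto hx hm
    have h1 : Tendsto (fun k => wt F (t k) (x k)) l (𝓝 (1 + ∑ j, v j ^ 2)) :=
      tendsto_const_nhds.add (tendsto_finsetSum _ fun j _ => (hv j).pow 2)
    have h2 : 1 + ∑ j, v j ^ 2 ≠ 0 :=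
      (add_pos_of_pos_of_nonneg one_pos (Finset.sum_nonneg fun _ _ => sq_nonneg _)).ne'
    exact ⟨_, (h1.inv₀ h2).smul hw⟩
  | add k a b ha hb iha ihb =>
    obtain ⟨v, hv⟩ := iha
    obtain ⟨w, hw⟩ := ihb
    exact ⟨v + w, hv.add hw⟩
  | const_mul k c a ha ih =>
    obtain ⟨w, hw⟩ := ih
    exact ⟨c * w, hw.const_mul c⟩
  | mono k a ha ih => exact ih

end Sym

lemma integrable_of_eq_zero_of_notMem {K : Set (Fin n → ℝ)} (hK : IsCompact K)
    {g : (Fin n → ℝ) → ℂ} (hg : Continuous g) (h0 : ∀ x ∉ K, g x = 0) : Integrable g :=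
  hg.integrable_of_hasCompactSupport (HasCompactSupport.intro hK h0)

lemma contDiff_cexp_phase {F : (Fin n → ℝ) → ℝ} (hF : ContDiff ℝ (⊤ : ℕ∞) F) (t : ℝ) :
    ContDiff ℝ (⊤ : ℕ∞) fun x => Complex.exp (Complex.I * t * F x) :=
  (contDiff_const.mul (Complex.ofRealCLM.contDiff.comp hF)).cexp

/-- Integration by parts for the Euler operator. -/
lemma integral_cexp_mul_ceul {F : (Fin n → ℝ) → ℝ} (hF : ContDiff ℝ (⊤ : ℕ∞) F)
    {K : Set (Fin n → ℝ)} (hK : IsCompact K) {b : (Fin n → ℝ) → ℂ} (hb : ContDiff ℝ (⊤ : ℕ∞) b)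
    (h0 : ∀ x ∉ K, b x = 0) (t : ℝ) (j : Fin n) :
    ∫ x, Complex.exp (Complex.I * t * F x) * (Complex.I * (ceul j b x + b x)) =
      ∫ x, Complex.exp (Complex.I * t * F x) * ((t * eul j F x) • b x) := by
  set e : (Fin n → ℝ) → ℂ := fun x => Complex.exp (Complex.I * t * F x) with he
  have hes : ContDiff ℝ (⊤ : ℕ∞) e := contDiff_cexp_phase hF t
  have hg : ContDiff ℝ (⊤ : ℕ∞) fun x : Fin n → ℝ => x j • b x := (contDiff_apply ℝ ℝ j).smul hb
  have hx : ContDiff ℝ (⊤ : ℕ∞) fun x : Fin n → ℝ => x j := contDiff_apply ℝ ℝ j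
  have hgd : ∀ x, fderiv ℝ (fun x : Fin n → ℝ => x j • b x) x (Pi.single j 1) =
      ceul j b x + b x := by
    intro x
    have h1 : fderiv ℝ (fun x : Fin n → ℝ => x j) x (Pi.single j 1) = 1 := by
      have : HasFDerivAt (fun x : Fin n → ℝ => x j)
          (ContinuousLinearMap.proj (R := ℝ) (φ := fun _ : Fin n => ℝ) j) x := hasFDerivAt_apply j x
      rw [this.fderiv]; simp
    rw [fderiv_fun_smul (hx.differentiable (by simp) x) (hb.differentiable (by simp) x)]
    simp only [FunLike.coe_add, FunLike.coe_smul, Pi.add_apply, Pi.smul_apply,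
      ContinuousLinearMap.smulRight_apply, h1, one_smul]
    rfl
  have hed : ∀ x, fderiv ℝ e x (Pi.single j 1) =
      Complex.I * t * (pderiv1 j F x : ℝ) * e x := by
    intro x
    have h1 : HasFDerivAt (fun x => ((F x : ℝ) : ℂ)) (Complex.ofRealCLM.comp (fderiv ℝ F x)) x :=
      Complex.ofRealCLM.hasFDerivAt.comp x (hF.differentiable (by simp) x).hasFDerivAt
    have h2 := (h1.const_mul (Complex.I * t)).cexp
    rw [h2.fderiv]
    simp only [FunLike.coe_smul, Pi.smul_apply, ContinuousLinearMap.comp_apply,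
      Complex.ofRealCLM_apply, smul_eq_mul, pderiv1, he]
    ring
  have hec : Continuous e := hes.continuous
  have h := integral_mul_fderiv_eq_neg_fderiv_mul_of_integrable (𝕜 := ℂ) (μ := volume) (f := e)
    (g := fun x : Fin n → ℝ => x j • b x) (v := Pi.single j 1)
    (integrable_of_eq_zero_of_notMem hK
      (((hes.fderiv_right (m := (⊤ : ℕ∞)) (by simp)).continuous.clm_apply continuous_const).mul
        hg.continuous) fun x hx => by simp [h0 x hx])
    (by
      simp only [hgd]
      exact integrable_of_eq_zero_of_notMem hK
        (hec.mul ((contDiff_ceul hb j).continuous.add hb.continuous))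
        fun x hx => by rw [ceul_eq_zero hK.isClosed h0 j x hx, h0 x hx]; simp)
    (integrable_of_eq_zero_of_notMem hK (hec.mul hg.continuous) fun x hx => by simp [h0 x hx])
    (fun x _ => hes.differentiable (by simp) x) (fun x _ => hg.differentiable (by simp) x)
  simp only [hgd, hed] at h
  have h' : ∀ x, e x * (Complex.I * (ceul j b x + b x)) =
      Complex.I * (e x * (ceul j b x + b x)) := fun x => by ring
  change ∫ x, e x * (Complex.I * (ceul j b x + b x)) = ∫ x, e x * ((t * eul j F x) • b x)
  simp only [h']
  rw [integral_const_mul, h, ← integral_neg, ← integral_const_mul]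
  refine integral_congr_ae (ae_of_all _ fun x => ?_)
  simp only [Complex.real_smul, eul]
  push_cast
  linear_combination (-(t : ℂ) * (pderiv1 j F x) * e x * x j * b x) * Complex.I_sq

namespace Sym
variable {S : Finset (Fin n → ℕ)} {F : (Fin n → ℝ) → ℝ} {K : Set (Fin n → ℝ)} {k : ℤ}
  {a : ℝ → (Fin n → ℝ) → ℂ}

lemma integrable (ha : Sym S F K k a) (hF : ContDiff ℝ (⊤ : ℕ∞) F) (hK : IsCompact K) (t : ℝ) :
    Integrable fun x => Complex.exp (Complex.I * t * F x) * a t x :=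
  integrable_of_eq_zero_of_notMem hK
    ((contDiff_cexp_phase hF t).continuous.mul (ha.contDiff hF t).continuous)
    fun x hx => by rw [ha.eq_zero t x hx, mul_zero]

lemma exists_gain (ha : Sym S F K k a) (hF : MonForm S F) (hK : IsCompact K) :
    ∃ b, Sym S F K (k + 1) b ∧ ∀ t : ℝ,
      ∫ x, Complex.exp (Complex.I * t * F x) * a t x =
        ∫ x, Complex.exp (Complex.I * t * F x) * b t x := by
  have hFs := hF.contDiff
  have h0 : Sym S F K (k + 1) fun t x => (wt F t x)⁻¹ • a t x :=
    Sym.mono _ _ (by have := Sym.divw _ _ ha; rwa [show k + 1 + 1 = k + 2 by ring])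
  have h1 : ∀ j, Sym S F K (k + 1) fun t x => (wt F t x)⁻¹ • ((t * KN.eul j F x) • a t x) :=
    fun j => by
      have := Sym.divw _ _ (Sym.mulf _ _ _ ha (hF.eul j))
      rwa [show k - 1 + 2 = k + 1 by ring] at this
  have h2 : ∀ j, Sym S F K (k + 1) fun t x => Complex.I *
      (ceul j (fun x => (wt F t x)⁻¹ • ((t * KN.eul j F x) • a t x)) x +
        (wt F t x)⁻¹ • ((t * KN.eul j F x) • a t x)) :=
    fun j => Sym.const_mul _ _ _ (Sym.add _ _ _ ((h1 j).eul hF hK.isClosed j) (h1 j))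
  refine ⟨_, Sym.add _ _ _ h0 (Sym.sum Finset.univ fun j _ => h2 j), fun t => ?_⟩
  simp only [mul_add, Finset.mul_sum]
  rw [integral_add (h0.integrable hFs hK t), integral_finsetSum]
  rotate_left
  · exact fun j _ => by simpa only [mul_add] using (h2 j).integrable hFs hK t
  · exact integrable_finsetSum _ fun j _ => by
      simpa only [mul_add] using (h2 j).integrable hFs hK t
  have h3 : ∀ j, ∫ x, (Complex.exp (Complex.I * t * F x) * (Complex.I *
      ceul j (fun x => (wt F t x)⁻¹ • ((t * KN.eul j F x) • a t x)) x) +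
      Complex.exp (Complex.I * t * F x) * (Complex.I *
        (wt F t x)⁻¹ • ((t * KN.eul j F x) • a t x))) =
      ∫ x, Complex.exp (Complex.I * t * F x) *
        ((t * KN.eul j F x) • (wt F t x)⁻¹ • ((t * KN.eul j F x) • a t x)) := fun j => by
    rw [← integral_cexp_mul_ceul hFs hK ((h1 j).contDiff hFs t) ((h1 j).eq_zero t) t j]
    simp only [mul_add]
  simp only [h3]
  have h4 := fun j => (Sym.mulf _ _ _ (h1 j) (hF.eul j)).integrable hFs hK t
  rw [← integral_finsetSum _ fun j _ => h4 j, ← integral_add (h0.integrable hFs hK t)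
    (integrable_finsetSum _ fun j _ => h4 j)]
  refine integral_congr_ae (ae_of_all _ fun x => ?_)
  have h5 : ((wt F t x : ℝ) : ℂ) * ((wt F t x : ℝ) : ℂ)⁻¹ = 1 :=
    mul_inv_cancel₀ (by exact_mod_cast (wt_pos F t x).ne')
  have h6 : ((wt F t x : ℝ) : ℂ) = 1 + ∑ j, ((t * KN.eul j F x : ℝ) : ℂ) ^ 2 := by
    rw [wt]; push_cast; rfl
  simp only [Complex.real_smul, Complex.ofReal_inv]
  have h7 : ∀ j, Complex.exp (Complex.I * t * F x) * (((t * KN.eul j F x : ℝ) : ℂ) *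
      (((wt F t x : ℝ) : ℂ)⁻¹ * (((t * KN.eul j F x : ℝ) : ℂ) * a t x))) =
      Complex.exp (Complex.I * t * F x) * ((wt F t x : ℝ) : ℂ)⁻¹ * a t x *
        ((t * KN.eul j F x : ℝ) : ℂ) ^ 2 := fun j => by ring
  simp only [h7, ← Finset.mul_sum]
  linear_combination (Complex.exp (Complex.I * t * F x) * a t x) *
    (((wt F t x : ℝ) : ℂ)⁻¹ * h6 - h5)

lemma exists_iterate (hF : MonForm S F) (hK : IsCompact K) {φ : (Fin n → ℝ) → ℂ}
    (hφ : ContDiff ℝ (⊤ : ℕ∞) φ) (h0 : ∀ x ∉ K, φ x = 0) (N : ℕ) :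
    ∃ a, Sym S F K N a ∧ ∀ t : ℝ, oscInt F φ t =
      ∫ x, Complex.exp (Complex.I * t * F x) * a t x := by
  induction N with
  | zero => exact ⟨_, Sym.base φ hφ h0, fun t => rfl⟩
  | succ N ih =>
    obtain ⟨a, ha, h1⟩ := ih
    obtain ⟨b, hb, h2⟩ := ha.exists_gain hF hK
    exact ⟨b, by exact_mod_cast hb, fun t => (h1 t).trans (h2 t)⟩

end Sym

lemma exists_basis_of_notMem (D : Submodule ℝ (Fin n → ℝ)) {v : Fin n → ℝ} (hv : v ∉ D) :
    ∃ (b : Module.Basis (Fin n) ℝ (Fin n → ℝ)) (i₀ : Fin n) (Z : Finset (Fin n)), i₀ ∉ Z ∧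
      Z.card + 1 = n - Module.finrank ℝ D ∧ b i₀ = v ∧ ∀ i ∉ Z, i ≠ i₀ → b i ∈ D := by
  classical
  set bD := Module.finBasis ℝ D
  have h1 : LinearIndependent ℝ (fun i => (bD i : Fin n → ℝ)) :=
    bD.linearIndependent.map' D.subtype D.ker_subtype
  have h2 : v ∉ Submodule.span ℝ (range fun i => (bD i : Fin n → ℝ)) := fun h =>
    hv (Submodule.span_le.2 (by rintro _ ⟨i, rfl⟩; exact (bD i).2) h)
  have h3 := h1.option h2
  set b' := Module.Basis.sumExtend h3 with hb'
  have hb'l : ∀ o, b' (Sum.inl o) = Option.casesOn' o v fun i => (bD i : Fin n → ℝ) := fun o => by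
    simp only [b', Module.Basis.sumExtend, Module.Basis.reindex_apply, Module.Basis.extend_apply_self]
    rfl
  set e := b'.indexEquiv (Pi.basisFun ℝ (Fin n))
  have hfin : Finite (Module.Basis.sumExtendIndex h3) :=
    Finite.of_injective (fun x => e (Sum.inr x)) fun x y h => Sum.inr_injective (e.injective h)
  have := Fintype.ofFinite (Module.Basis.sumExtendIndex h3)
  refine ⟨b'.reindex e, e (Sum.inl none), Finset.univ.map
    (Function.Embedding.inr.trans e.toEmbedding), ?_, ?_, ?_, ?_⟩
  · simp
  · have h4 := Fintype.card_congr e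
    simp only [Fintype.card_sum, Fintype.card_option, Fintype.card_fin] at h4
    rw [Finset.card_map, Finset.card_univ]
    omega
  · rw [Module.Basis.reindex_apply, Equiv.symm_apply_apply, hb'l]; rfl
  · intro i hi hi0
    rw [Module.Basis.reindex_apply]
    obtain ⟨o, rfl⟩ := e.surjective i
    rw [Equiv.symm_apply_apply]
    rcases o with (_ | o) | o
    · exact absurd rfl hi0
    · rw [hb'l]; exact (bD o).2
    · exact absurd (Finset.mem_map.2 ⟨o, Finset.mem_univ _, rfl⟩) hi

/-- The linear coordinates `u ↦ (⟨b_i, u⟩)_i`. -/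
lemma exists_linearEquiv_dot (b : Module.Basis (Fin n) ℝ (Fin n → ℝ)) :
    ∃ Φ : (Fin n → ℝ) ≃L[ℝ] (Fin n → ℝ), ∀ u i, Φ u i = dot (b i) u := by
  set L : (Fin n → ℝ) →ₗ[ℝ] (Fin n → ℝ) := Matrix.toLin' (Matrix.of fun i => b i)
  have hL : ∀ u i, L u i = dot (b i) u := fun u i => by
    simp [L, Matrix.mulVec, dotProduct, dot]
  have hinj : Function.Injective L := by
    rw [injective_iff_map_eq_zero]
    intro u hu
    have h1 : ∀ w, dot w u = 0 := fun w => by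
      have h2 := b.sum_repr w
      rw [← h2]
      simp only [dot, Finset.sum_apply, Finset.sum_mul]
      rw [Finset.sum_comm]
      refine Finset.sum_eq_zero fun i _ => ?_
      have h3 : dot (b i) u = 0 := by rw [← hL, hu]; rfl
      simp only [Pi.smul_apply, smul_eq_mul, mul_assoc]
      rw [← Finset.mul_sum]
      exact mul_eq_zero_of_right _ h3
    funext i
    have h4 := h1 (Pi.single i 1)
    simpa [dot, Pi.single_apply] using h4
  exact ⟨(LinearEquiv.ofInjectiveEndo L hinj).toContinuousLinearEquiv, fun u i => hL u i⟩

lemma dot_eq_zero_of_mem_direction {τ : Set (Fin n → ℝ)} {a : Fin n → ℝ} {l : ℝ}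
    (hτ : τ ⊆ Hplane a l) {w : Fin n → ℝ} (hw : w ∈ (affineSpan ℝ τ).direction) : dot a w = 0 := by
  rw [direction_affineSpan, vectorSpan_def] at hw
  induction hw using Submodule.span_induction with
  | mem x hx =>
    obtain ⟨y, hy, z, hz, rfl⟩ := hx
    have h1 : dot a y = l := hτ hy
    have h2 : dot a z = l := hτ hz
    change dot a (y - z) = 0
    rw [dot_sub, h1, h2, sub_self]
  | zero => simp [dot]
  | add x y _ _ hx hy => rw [dot_add, hx, hy, add_zero]
  | smul c x _ hx => rw [dot_smul, hx]; simp

lemma exists_exp_dot_le {S : Finset (Fin n → ℕ)} (hS : S.Nonempty) {u : Fin n → ℝ} (hu : 0 ≤ u) :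
    ∃ μ, (∀ q ∈ upperHull S, μ ≤ dot u q) ∧ Real.exp (-μ) ≤ ∑ p ∈ S, Real.exp (-dot u (natPt p)) := by
  obtain ⟨p, hp, hmin⟩ := S.exists_min_image (fun p => dot u (natPt p)) hS
  exact ⟨dot u (natPt p), fun q hq => upperHull_subset_Hhalf hu hmin hq,
    Finset.single_le_sum (f := fun p => Real.exp (-dot u (natPt p)))
      (fun _ _ => (Real.exp_pos _).le) hp⟩

/-- Linear coordinates adapted to the principal face. -/
lemma IsPrincipalFace.exists_coordinates [NeZero n] {f : (Fin n → ℝ) → ℝ}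
    {S : Finset (Fin n → ℕ)} (hΓ : NewtonPolyhedron f = upperHull S) (hS : S.Nonempty)
    {τ : Set (Fin n → ℝ)} (hτ : IsPrincipalFace f τ) :
    ∃ (Φ : (Fin n → ℝ) ≃L[ℝ] (Fin n → ℝ)) (i₀ : Fin n) (Z : Finset (Fin n)), i₀ ∉ Z ∧
      Z.card + 1 = n - setDim τ ∧ (∀ u, Φ u i₀ = ∑ i, u i) ∧ ∃ δ > 0, ∀ u : Fin n → ℝ, 0 ≤ u →
        Real.exp (-(newtonDist f * ∑ i, u i) + δ * ∑ i ∈ (insert i₀ Z)ᶜ, |Φ u i|) ≤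
          ∑ p ∈ S, Real.exp (-dot u (natPt p)) := by
  obtain ⟨a, l, ha0, ⟨k, hk⟩, hτa⟩ := hτ.exists_normal hΓ hS
  have h1 : (fun _ => 1 : Fin n → ℝ) ∉ (affineSpan ℝ τ).direction := fun h => by
    have h2 := dot_eq_zero_of_mem_direction (a := a) (l := l) (hτa ▸ inter_subset_right) h
    simp only [dot, mul_one] at h2
    exact hk.ne' ((Finset.sum_eq_zero_iff_of_nonneg fun i _ => ha0 i).1 h2 k (Finset.mem_univ k))
  obtain ⟨b, i₀, Z, hi₀, hcard, hb0, hbD⟩ := exists_basis_of_notMem _ h1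
  obtain ⟨Φ, hΦ⟩ := exists_linearEquiv_dot b
  refine ⟨Φ, i₀, Z, hi₀, hcard, fun u => by rw [hΦ, hb0]; simp [dot], ?_⟩
  have h2 : ∀ i ∈ (insert i₀ Z)ᶜ, ∀ᶠ t : ℝ in 𝓝 0,
      (fun _ : Fin n => newtonDist f) + t • b i ∈ upperHull S ∧
      (fun _ : Fin n => newtonDist f) + (-t) • b i ∈ upperHull S := fun i hi => by
    rw [Finset.mem_compl, Finset.mem_insert, not_or] at hi
    have hD := hbD i hi.2 hi.1
    have h3 := eventually_add_smul_mem hτ.2 hD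
    have h4 : Tendsto (fun t : ℝ => -t) (𝓝 0) (𝓝 0) := by
      simpa using (continuous_neg (G := ℝ)).tendsto 0
    have h5 : τ ⊆ upperHull S := hτa ▸ inter_subset_left
    filter_upwards [h3, h4.eventually h3] with t ht ht'
    exact ⟨h5 ht, h5 ht'⟩
  rw [← Filter.eventually_all_finset] at h2
  obtain ⟨δ, hδ, hδ0⟩ := ((h2.filter_mono nhdsWithin_le_nhds).and
    (self_mem_nhdsWithin (s := Ioi (0 : ℝ)))).exists
  have hn : (0 : ℝ) < n := by exact_mod_cast Nat.pos_of_ne_zero (NeZero.ne n)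
  refine ⟨δ / n, div_pos hδ0 hn, fun u hu => ?_⟩
  obtain ⟨μ, hμ, hle⟩ := exists_exp_dot_le hS hu
  refine (Real.exp_le_exp.2 ?_).trans hle
  have hq : dot u (fun _ => newtonDist f) = newtonDist f * ∑ i, u i := by
    simp only [dot]; rw [Finset.mul_sum]; exact Finset.sum_congr rfl fun i _ => mul_comm _ _
  have hq0 := hμ _ (newtonDist_mem hΓ hS)
  rw [hq] at hq0
  have hcomm : ∀ i, dot u (b i) = Φ u i := fun i => by
    rw [hΦ]; exact Finset.sum_congr rfl fun i _ => mul_comm _ _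
  have h6 : ∀ i ∈ (insert i₀ Z)ᶜ, δ * |Φ u i| ≤ newtonDist f * ∑ i, u i - μ := fun i hi => by
    obtain ⟨h7, h8⟩ := hδ i hi
    have h7' := hμ _ h7
    have h8' := hμ _ h8
    rw [dot_add, dot_smul, hq, hcomm] at h7' h8'
    rcases abs_cases (Φ u i) with ⟨h9, _⟩ | ⟨h9, _⟩ <;> rw [h9] <;> linarith
  have h7 := Finset.sum_le_sum h6
  rw [← Finset.mul_sum, Finset.sum_const, nsmul_eq_mul] at h7
  have h8 : (((insert i₀ Z)ᶜ.card : ℕ) : ℝ) ≤ n := by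
    exact_mod_cast (Finset.card_le_univ _).trans (Fintype.card_fin n).le
  have h9 := mul_le_mul_of_nonneg_right h8 (sub_nonneg.2 hq0)
  have h10 : δ / n * ∑ i ∈ (insert i₀ Z)ᶜ, |Φ u i| ≤ newtonDist f * ∑ i, u i - μ := by
    rw [div_mul_eq_mul_div, div_le_iff₀ hn]
    linarith
  linarith

/-- The diagonal map with entries `c`. -/
noncomputable def diagL (c : Fin n → ℝ) : (Fin n → ℝ) →L[ℝ] (Fin n → ℝ) :=
  ContinuousLinearMap.pi fun i =>
    (ContinuousLinearMap.toSpanSingleton ℝ (c i)).comp (ContinuousLinearMap.proj i)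

lemma diagL_apply (c v : Fin n → ℝ) (i : Fin n) : diagL c v i = v i * c i := rfl

lemma det_diagL (c : Fin n → ℝ) : (diagL c).det = ∏ i, c i := by
  rw [diagL, ContinuousLinearMap.det_pi]
  exact Finset.prod_congr rfl fun i _ => ContinuousLinearMap.det_toSpanSingleton _

lemma integral_eq_integral_affine (P : (Fin n → ℝ) ≃L[ℝ] (Fin n → ℝ)) {c : Fin n → ℝ}
    (hc : ∀ i, c i ≠ 0) (w : Fin n → ℝ) (h : (Fin n → ℝ) → ℂ) :
    ∫ u, h u = (|(P : (Fin n → ℝ) →L[ℝ] (Fin n → ℝ)).det| * |∏ i, c i|) •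
      ∫ v, h (P (diagL c v + w)) := by
  have hd : ∀ v ∈ (univ : Set (Fin n → ℝ)), HasFDerivWithinAt (fun v => P (diagL c v + w))
      ((P : (Fin n → ℝ) →L[ℝ] (Fin n → ℝ)).comp (diagL c)) univ v := fun v _ =>
    ((P : (Fin n → ℝ) →L[ℝ] (Fin n → ℝ)).hasFDerivAt.comp v
      ((diagL c).hasFDerivAt.add_const w)).hasFDerivWithinAt
  have hinj : InjOn (fun v => P (diagL c v + w)) univ := fun v _ v' _ hvv => by
    have h1 := add_right_cancel (P.injective hvv)
    funext i
    have h2 := congrFun h1 i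
    rw [diagL_apply, diagL_apply] at h2
    exact mul_right_cancel₀ (hc i) h2
  have hsurj : (fun v => P (diagL c v + w)) '' univ = univ := by
    rw [image_univ]
    refine Function.Surjective.range_eq fun u => ⟨fun i => (P.symm u - w) i / c i, ?_⟩
    have h1 : diagL c (fun i => (P.symm u - w) i / c i) = P.symm u - w := by
      funext i; rw [diagL_apply, div_mul_cancel₀ _ (hc i)]
    change P (diagL c _ + w) = u
    rw [h1, sub_add_cancel, P.apply_symm_apply]
  have h1 := integral_image_eq_integral_abs_det_fderiv_smul volume MeasurableSet.univ hd hinj h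
  rw [hsurj, setIntegral_univ, setIntegral_univ] at h1
  rw [h1, integral_smul]
  congr 1
  rw [← abs_mul, ← det_diagL]
  congr 1
  exact LinearMap.det_comp _ _

/-- The sign `±1` attached to a Boolean. -/
def bsign (b : Bool) : ℝ := if b then 1 else -1

lemma bsign_mul_self (b : Bool) : bsign b * bsign b = 1 := by cases b <;> simp [bsign]

lemma abs_bsign (b : Bool) : |bsign b| = 1 := by cases b <;> simp [bsign]

/-- Logarithmic coordinates in the orthant with signs `ε`. -/
noncomputable def expPt (ε : Fin n → Bool) (u : Fin n → ℝ) : Fin n → ℝ :=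
  fun i => bsign (ε i) * Real.exp (-u i)

lemma continuous_expPt (ε : Fin n → Bool) : Continuous (expPt ε) :=
  continuous_pi fun i => continuous_const.mul (Real.continuous_exp.comp (continuous_apply i).neg)

lemma abs_expPt (ε : Fin n → Bool) (u : Fin n → ℝ) (i : Fin n) : |expPt ε u i| = Real.exp (-u i) := by
  rw [expPt, abs_mul, abs_bsign, one_mul, abs_of_pos (Real.exp_pos _)]

lemma hasFDerivAt_expPt (ε : Fin n → Bool) (u : Fin n → ℝ) :
    HasFDerivAt (expPt ε) (diagL fun i => -expPt ε u i) u := by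
  refine hasFDerivAt_pi'' fun i => ?_
  have h1 : HasDerivAt (fun s : ℝ => bsign (ε i) * Real.exp (-s)) (-expPt ε u i) (u i) := by
    have := ((hasDerivAt_id (u i)).neg.exp).const_mul (bsign (ε i))
    simpa [expPt] using this
  have h2 := h1.hasFDerivAt.comp u (hasFDerivAt_apply (𝕜 := ℝ) i u)
  convert! h2 using 1

lemma image_expPt (ε : Fin n → Bool) : expPt ε '' univ = {x | ∀ i, 0 < bsign (ε i) * x i} := by
  ext x
  simp only [image_univ, mem_range, mem_ofPred_eq]
  constructor
  · rintro ⟨u, rfl⟩ i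
    rw [expPt, ← mul_assoc, bsign_mul_self, one_mul]
    exact Real.exp_pos _
  · intro h
    refine ⟨fun i => -Real.log (bsign (ε i) * x i), funext fun i => ?_⟩
    rw [expPt, neg_neg, Real.exp_log (h i), ← mul_assoc, bsign_mul_self, one_mul]

lemma injective_expPt (ε : Fin n → Bool) : Function.Injective (expPt ε) := fun u v h => by
  funext i
  have h1 := congrArg abs (congrFun h i)
  rw [abs_expPt, abs_expPt] at h1
  exact neg_injective (Real.exp_injective h1)

lemma integral_orthant (ε : Fin n → Bool) (g : (Fin n → ℝ) → ℂ) :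
    ∫ x in {x | ∀ i, 0 < bsign (ε i) * x i}, g x =
      ∫ u, Real.exp (-∑ i, u i) • g (expPt ε u) := by
  rw [← image_expPt, integral_image_eq_integral_abs_det_fderiv_smul volume MeasurableSet.univ
    (fun u _ => (hasFDerivAt_expPt ε u).hasFDerivWithinAt) (injective_expPt ε).injOn,
    setIntegral_univ]
  congr 1
  funext u
  rw [det_diagL, Finset.abs_prod, ← Finset.sum_neg_distrib, Real.exp_sum]
  congr 1
  exact Finset.prod_congr rfl fun i _ => by rw [abs_neg, abs_expPt]

lemma integral_eq_sum_orthants {g : (Fin n → ℝ) → ℂ} (hg : Integrable g) :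
    ∫ x, g x = ∑ ε : Fin n → Bool, ∫ u, Real.exp (-∑ i, u i) • g (expPt ε u) := by
  simp only [← integral_orthant]
  rw [← integral_iUnion_fintype]
  · have h1 : (⋃ ε : Fin n → Bool, {x : Fin n → ℝ | ∀ i, 0 < bsign (ε i) * x i}) =ᵐ[volume]
        (univ : Set (Fin n → ℝ)) := by
      have h2 : ∀ᵐ x : Fin n → ℝ, ∀ i, x i ≠ 0 := by
        rw [ae_all_iff]; intro i; rw [volume_pi]; exact Measure.ae_eval_ne (μ := fun _ : Fin n => volume) i 0
      refine eventuallyEq_univ.2 ?_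
      filter_upwards [h2] with x hx
      refine mem_iUnion.2 ⟨fun i => decide (0 < x i), fun i => ?_⟩
      rcases (hx i).lt_or_gt with h | h
      · simp [bsign, h, h.not_gt]
      · simp [bsign, h]
    rw [setIntegral_congr_set h1, setIntegral_univ]
  · intro ε
    simp only [ofPred_forall]
    exact MeasurableSet.iInter fun i =>
      measurableSet_lt measurable_const ((measurable_pi_apply i).const_mul _)
  · intro ε ε' hne
    obtain ⟨i, hi⟩ := Function.ne_iff.1 hne
    refine disjoint_left.2 fun x hx hx' => ?_
    have h1 := hx i
    have h2 := hx' i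
    cases h3 : ε i <;> cases h4 : ε' i <;> rw [h3] at h1 hi <;> rw [h4] at h2 hi <;>
      simp [bsign] at h1 h2 hi <;> linarith
  · exact fun ε => hg.integrableOn

lemma mon_expPt (p : Fin n → ℕ) (ε : Fin n → Bool) (u : Fin n → ℝ) :
    mon p (expPt ε u) = (∏ i, bsign (ε i) ^ p i) * Real.exp (-dot u (natPt p)) := by
  simp only [mon, expPt, mul_pow, Finset.prod_mul_distrib, dot, ← Finset.sum_neg_distrib,
    Real.exp_sum, natPt]
  congr 1
  refine Finset.prod_congr rfl fun i _ => ?_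
  rw [← Real.exp_nat_mul]
  congr 1
  ring

lemma absSum_expPt (S : Finset (Fin n → ℕ)) (ε : Fin n → Bool) (u : Fin n → ℝ) :
    absSum S (expPt ε u) = ∑ p ∈ S, Real.exp (-dot u (natPt p)) := by
  refine Finset.sum_congr rfl fun p _ => ?_
  rw [mon_expPt, abs_mul, Finset.abs_prod]
  simp [abs_pow, abs_bsign]

lemma exists_tendsto_exp_affine {α : ℝ} (hα : α ≤ 0) (β : ℝ) :
    ∃ m, Tendsto (fun T : ℝ => Real.exp (T * α + β)) atTop (𝓝 m) := by
  rcases hα.lt_or_eq with h | rfl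
  · exact ⟨0, Real.tendsto_exp_atBot.comp
      (tendsto_atBot_add_const_right _ _ (tendsto_id.atTop_mul_const_of_neg h))⟩
  · exact ⟨Real.exp β, by simp⟩

namespace Sym
variable {S : Finset (Fin n → ℕ)} {F : (Fin n → ℝ) → ℝ} {K : Set (Fin n → ℝ)}
  {a : ℝ → (Fin n → ℝ) → ℂ}

lemma exists_decay {N : ℕ} (ha : Sym S F K N a) (hK : IsCompact K) {c : ℝ} (hc : 0 < c)
    (hest : ∀ x ∈ K, c * absSum S x ^ 2 ≤ ∑ j, KN.eul j F x ^ 2) :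
    ∃ C, 0 ≤ C ∧ ∀ t x, ‖a t x‖ ≤ C * (max 1 (|t| * absSum S x) ^ N)⁻¹ := by
  obtain ⟨C, hC0, hC⟩ := ha.exists_bound hK hc hest
  set c₁ := min 1 (√c)
  have hc₁ : 0 < c₁ := lt_min one_pos (Real.sqrt_pos.2 hc)
  refine ⟨C * (c₁ ^ N)⁻¹, by positivity, fun t x => ?_⟩
  have hM : 0 < max 1 (|t| * absSum S x) := lt_max_of_lt_left one_pos
  by_cases hx : x ∈ K
  · refine (hC t x).trans ?_
    rw [mul_assoc, ← mul_inv, ← mul_pow, zpow_neg, zpow_natCast]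
    refine mul_le_mul_of_nonneg_left ?_ hC0
    refine inv_anti₀ (by positivity) (pow_le_pow_left₀ (by positivity) ?_ N)
    rw [mul_max_of_nonneg _ _ hc₁.le, max_le_iff]
    constructor
    · rw [mul_one]
      exact (min_le_left _ _).trans (Real.one_le_sqrt.2 (one_le_wt F t x))
    · have h0 : 0 ≤ |t| * absSum S x := mul_nonneg (abs_nonneg _) (absSum_nonneg _ _)
      refine (mul_le_mul_of_nonneg_right (min_le_right 1 (√c)) h0).trans ?_
      refine Real.le_sqrt_of_sq_le ?_
      rw [mul_pow, Real.sq_sqrt hc.le, mul_pow, sq_abs, wt]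
      have h2 := mul_le_mul_of_nonneg_left (hest x hx) (sq_nonneg t)
      rw [Finset.mul_sum] at h2
      simp only [← mul_pow] at h2
      linarith
  · rw [ha.eq_zero t x hx, norm_zero]
    positivity

/-- Along a line in logarithmic coordinates the integrand has a limit. -/
lemma exists_tendsto_line {N : ℕ} (hN : N ≠ 0) (ha : Sym S F K N a) (hF : MonForm S F)
    (hK : IsCompact K) (hK1 : ∀ x ∈ K, ∀ i, |x i| < 1) {c : ℝ} (hc : 0 < c)
    (hest : ∀ x ∈ K, c * absSum S x ^ 2 ≤ ∑ j, KN.eul j F x ^ 2) (ε : Fin n → Bool)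
    (w b : Fin n → ℝ) :
    ∃ g, Tendsto (fun T : ℝ => Complex.exp (Complex.I * (Real.exp T : ℝ) * F (expPt ε (T • w + b))) *
      a (Real.exp T) (expPt ε (T • w + b))) atTop (𝓝 g) := by
  have hlin : ∀ p (T : ℝ), Real.exp T * Real.exp (-dot (T • w + b) (natPt p)) =
      Real.exp (T * (1 - dot w (natPt p)) + -dot b (natPt p)) := fun p T => by
    rw [← Real.exp_add]
    congr 1
    simp only [dot, Pi.add_apply, Pi.smul_apply, smul_eq_mul, add_mul, Finset.sum_add_distrib,
      mul_assoc, ← Finset.mul_sum]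
    ring
  by_cases h1 : ∃ j, w j < 0
  · obtain ⟨j, hj⟩ := h1
    refine ⟨0, tendsto_const_nhds.congr' ?_⟩
    have h2 : Tendsto (fun T : ℝ => T * w j + b j) atTop atBot :=
      tendsto_atBot_add_const_right _ _ (tendsto_id.atTop_mul_const_of_neg hj)
    filter_upwards [h2.eventually_lt_atBot 0] with T hT
    rw [ha.eq_zero, mul_zero]
    intro hx
    have h3 := hK1 _ hx j
    rw [abs_expPt] at h3
    have h4 : 1 < Real.exp (-(T • w + b) j) := Real.one_lt_exp_iff.2 (neg_pos.2 hT)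
    exact h3.not_gt h4
  push Not at h1
  by_cases h2 : ∃ p ∈ S, dot w (natPt p) < 1
  · obtain ⟨p, hp, hlt⟩ := h2
    obtain ⟨C, hC0, hC⟩ := ha.exists_decay hK hc hest
    refine ⟨0, squeeze_zero_norm (a := fun T : ℝ => C *
      (Real.exp (T * (1 - dot w (natPt p)) + -dot b (natPt p)) ^ N)⁻¹) (fun T => ?_) ?_⟩
    · rw [norm_mul, norm_cexp_I_mul_mul, one_mul]
      refine (hC _ _).trans (mul_le_mul_of_nonneg_left ?_ hC0)
      refine inv_anti₀ (by positivity) (pow_le_pow_left₀ (Real.exp_pos _).le ?_ N)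
      refine le_max_of_le_right ?_
      rw [← hlin, abs_of_pos (Real.exp_pos _), absSum_expPt]
      exact mul_le_mul_of_nonneg_left (Finset.single_le_sum
        (f := fun p => Real.exp (-dot (T • w + b) (natPt p))) (fun _ _ => (Real.exp_pos _).le) hp)
        (Real.exp_pos _).le
    · have h3 : Tendsto (fun T : ℝ => Real.exp (T * (1 - dot w (natPt p)) + -dot b (natPt p)))
          atTop atTop := Real.tendsto_exp_atTop.comp
        (tendsto_atTop_add_const_right _ _ (tendsto_id.atTop_mul_const (sub_pos.2 hlt)))
      simpa using (((tendsto_pow_atTop hN).comp h3).inv_tendsto_atTop).const_mul C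
  push Not at h2
  have h3 : ∃ z, Tendsto (fun T : ℝ => expPt ε (T • w + b)) atTop (𝓝 z) := by
    choose z hz using fun i => exists_tendsto_exp_affine (neg_nonpos.2 (h1 i)) (-b i)
    refine ⟨fun i => bsign (ε i) * z i, tendsto_pi_nhds.2 fun i => ?_⟩
    refine ((hz i).const_mul (bsign (ε i))).congr fun T => ?_
    simp only [expPt, Pi.add_apply, Pi.smul_apply, smul_eq_mul]
    congr 2
    ring
  obtain ⟨z, hz⟩ := h3
  have h4 : ∀ p, ∃ m, p ∈ S → Tendsto (fun T => Real.exp T * mon p (expPt ε (T • w + b))) atTop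
      (𝓝 m) := fun p => by
    by_cases hp : p ∈ S
    · obtain ⟨m, hm⟩ := exists_tendsto_exp_affine (sub_nonpos.2 (h2 p hp)) (-dot b (natPt p))
      refine ⟨(∏ i, bsign (ε i) ^ p i) * m, fun _ => (hm.const_mul _).congr fun T => ?_⟩
      rw [mon_expPt, ← hlin]
      ring
    · exact ⟨0, fun h => absurd h hp⟩
  choose m hm using h4
  obtain ⟨g₁, hg₁⟩ := ha.exists_tendsto hF hz hm
  obtain ⟨g₂, hg₂⟩ := hF.exists_tendsto hz hm
  refine ⟨Complex.exp (Complex.I * (g₂ : ℝ)) * g₁, Tendsto.mul ?_ hg₁⟩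
  have hcont : Continuous fun r : ℝ => Complex.exp (Complex.I * r) := by fun_prop
  refine ((hcont.tendsto g₂).comp hg₂).congr fun T => ?_
  simp only [Function.comp_apply]
  push_cast
  rw [mul_assoc]

end Sym

lemma half_abs_add_le {d r σ : ℝ} {N : ℕ} (hd : 0 < d) (hN : 2 ≤ N * d) (hσ : 0 ≤ σ) :
    |r| / 2 + σ / (2 * d) ≤ r + N * max 0 (-(d * r) + σ) := by
  obtain ⟨s, rfl⟩ : ∃ s, σ = d * s := ⟨σ / d, by field_simp⟩
  have hs : 0 ≤ s := nonneg_of_mul_nonneg_right hσ hd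
  have h1 : d * s / (2 * d) = s / 2 := by field_simp
  have h2 : max 0 (-(d * r) + d * s) = d * max 0 (s - r) := by
    rw [mul_max_of_nonneg _ _ hd.le, mul_zero]
    congr 1
    ring
  have h3 : 2 * max 0 (s - r) ≤ N * (d * max 0 (s - r)) := by
    rw [← mul_assoc]
    exact mul_le_mul_of_nonneg_right hN (le_max_left _ _)
  rw [h1, h2]
  have h4 := le_max_left 0 (s - r)
  have h5 := le_max_right 0 (s - r)
  rcases abs_cases r with ⟨h, _⟩ | ⟨h, _⟩ <;> rw [h] <;> linarith

lemma exp_neg_le_rpow {A ρ y : ℝ} (hA : 0 < A) (hρ : 0 ≤ ρ) (hy : 0 ≤ y)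
    (h : 1 + y ≤ A * (1 + ρ)) (m : ℕ) :
    Real.exp (-ρ) ≤ (Real.exp 1 * m.factorial * A ^ m) * (1 + y) ^ (-(m : ℝ)) := by
  have h1 := Real.pow_div_factorial_le_exp (1 + ρ) (by positivity) m
  rw [div_le_iff₀ (by positivity)] at h1
  have h2 : (1 + y) ^ m ≤ A ^ m * (Real.exp (1 + ρ) * m.factorial) :=
    (pow_le_pow_left₀ (by positivity) h m).trans
      (by rw [mul_pow]; exact mul_le_mul_of_nonneg_left h1 (by positivity))
  rw [Real.rpow_neg (by positivity), Real.rpow_natCast, ← div_eq_mul_inv, le_div_iff₀ (by positivity)]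
  calc Real.exp (-ρ) * (1 + y) ^ m
      ≤ Real.exp (-ρ) * (A ^ m * (Real.exp (1 + ρ) * m.factorial)) :=
        mul_le_mul_of_nonneg_left h2 (Real.exp_pos _).le
    _ = (Real.exp (-ρ) * Real.exp (1 + ρ)) * m.factorial * A ^ m := by ring
    _ = Real.exp 1 * m.factorial * A ^ m := by
        rw [← Real.exp_add]
        congr 3
        ring

/-- The rescaled logarithmic coordinates adapted to the principal face. -/
noncomputable def scaledPt (Φ : (Fin n → ℝ) ≃L[ℝ] (Fin n → ℝ)) (i₀ : Fin n) (Z : Finset (Fin n))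
    (d T : ℝ) (v : Fin n → ℝ) : Fin n → ℝ :=
  Φ.symm (diagL (fun i => if i ∈ Z then T else 1) v + Pi.single i₀ (T / d))

section scaledPt
variable {Φ : (Fin n → ℝ) ≃L[ℝ] (Fin n → ℝ)} {i₀ : Fin n} {Z : Finset (Fin n)} {d : ℝ}

lemma apply_scaledPt (T : ℝ) (v : Fin n → ℝ) (i : Fin n) :
    Φ (scaledPt Φ i₀ Z d T v) i =
      v i * (if i ∈ Z then T else 1) + (if i = i₀ then T / d else 0) := by
  simp [scaledPt, diagL_apply, Pi.single_apply]

lemma sum_scaledPt (h0 : i₀ ∉ Z) (hΦ : ∀ u, Φ u i₀ = ∑ i, u i) (T : ℝ) (v : Fin n → ℝ) :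
    ∑ i, scaledPt Φ i₀ Z d T v i = v i₀ + T / d := by
  rw [← hΦ, apply_scaledPt]
  simp [h0]

lemma scaledPt_eq (T : ℝ) (v : Fin n → ℝ) :
    scaledPt Φ i₀ Z d T v =
      T • Φ.symm (fun i => (if i ∈ Z then v i else 0) + if i = i₀ then 1 / d else 0) +
        Φ.symm (fun i => if i ∈ Z then 0 else v i) := by
  rw [← map_smul, ← map_add, scaledPt]
  congr 1
  funext i
  simp only [Pi.add_apply, diagL_apply, Pi.single_apply, Pi.smul_apply, smul_eq_mul]
  split_ifs <;> ring

lemma continuous_scaledPt (T : ℝ) : Continuous (scaledPt Φ i₀ Z d T) :=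
  Φ.symm.continuous.comp ((diagL _).continuous.add continuous_const)

lemma norm_le_of_scaledPt (h0 : i₀ ∉ Z) (hΦ : ∀ u, Φ u i₀ = ∑ i, u i) (hd : 0 < d) {δ : ℝ}
    (hδ : 0 < δ) {T : ℝ} (hT : 1 ≤ T) {v : Fin n → ℝ} (hu : 0 ≤ scaledPt Φ i₀ Z d T v) :
    1 + ‖v‖ ≤ (1 + (2 + 2 * d / δ + ‖(Φ : (Fin n → ℝ) →L[ℝ] (Fin n → ℝ))‖ * (2 + 1 / d))) *
      (1 + (|v i₀| / 2 + δ * ∑ i ∈ (insert i₀ Z)ᶜ, |v i| / (2 * d))) := by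
  set u := scaledPt Φ i₀ Z d T v with hu_def
  set B := ‖(Φ : (Fin n → ℝ) →L[ℝ] (Fin n → ℝ))‖
  set s := ∑ i ∈ (insert i₀ Z)ᶜ, |v i| / (2 * d)
  have hB : 0 ≤ B := norm_nonneg _
  have hs : 0 ≤ s := Finset.sum_nonneg fun _ _ => by positivity
  set ρ := |v i₀| / 2 + δ * s
  have hr : |v i₀| ≤ 2 * ρ := by
    have : 0 ≤ δ * s := by positivity
    simp only [ρ]; linarith
  have hρ : 0 ≤ ρ := by positivity
  have hd1 : 0 ≤ 2 * d / δ := by positivity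
  have hd2 : 0 ≤ B * (2 + 1 / d) := by positivity
  have hun : ‖u‖ ≤ v i₀ + T / d := by
    rw [← sum_scaledPt (Φ := Φ) (Z := Z) h0 hΦ T v, ← hu_def]
    refine (pi_norm_le_iff_of_nonneg (Finset.sum_nonneg fun i _ => hu i)).2 fun i => ?_
    rw [Real.norm_eq_abs, abs_of_nonneg (hu i)]
    exact Finset.single_le_sum (fun i _ => hu i) (Finset.mem_univ i)
  have hv : ‖v‖ ≤ (2 + 2 * d / δ + B * (2 + 1 / d)) * (1 + ρ) := by
    refine (pi_norm_le_iff_of_nonneg (by positivity)).2 fun i => ?_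
    rw [Real.norm_eq_abs]
    by_cases hi : i = i₀
    · subst hi
      nlinarith [mul_nonneg hd1 hρ, mul_nonneg hd2 hρ]
    by_cases hZ : i ∈ Z
    · have h1 := apply_scaledPt (Φ := Φ) (i₀ := i₀) (Z := Z) (d := d) T v i
      rw [if_pos hZ, if_neg hi, add_zero, ← hu_def] at h1
      have h2 : |v i| * T ≤ B * (v i₀ + T / d) := by
        calc |v i| * T = |Φ u i| := by rw [h1, abs_mul, abs_of_pos (by linarith : 0 < T)]
          _ ≤ ‖Φ u‖ := norm_le_pi_norm (Φ u) i
          _ ≤ B * ‖u‖ := (Φ : (Fin n → ℝ) →L[ℝ] (Fin n → ℝ)).le_opNorm u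
          _ ≤ _ := mul_le_mul_of_nonneg_left hun hB
      have h3 : v i₀ + T / d ≤ (2 * ρ + 1 / d) * T := by
        have := le_abs_self (v i₀)
        have h4 : 2 * ρ ≤ 2 * ρ * T := le_mul_of_one_le_right (by positivity) hT
        rw [add_mul, one_div_mul_eq_div]
        linarith
      have h4 : |v i| ≤ B * (2 * ρ + 1 / d) := by
        refine le_of_mul_le_mul_right (h2.trans ?_) (by linarith : 0 < T)
        rw [mul_assoc]
        exact mul_le_mul_of_nonneg_left h3 hB
      refine h4.trans ?_
      have h5 : B * (2 * ρ + 1 / d) ≤ B * ((2 + 1 / d) * (1 + ρ)) := by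
        refine mul_le_mul_of_nonneg_left ?_ hB
        have : 0 ≤ 1 / d * ρ := by positivity
        nlinarith
      nlinarith [mul_nonneg hd1 hρ]
    · have h1 : |v i| / (2 * d) ≤ s :=
        Finset.single_le_sum (f := fun i => |v i| / (2 * d)) (fun _ _ => by positivity)
          (by simp [hi, hZ])
      rw [div_le_iff₀ (by positivity)] at h1
      have h2 : δ * s ≤ ρ := by simp only [ρ]; linarith [abs_nonneg (v i₀)]
      have h3 : s * (2 * d) ≤ 2 * d / δ * ρ := by
        rw [div_mul_eq_mul_div, le_div_iff₀ hδ]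
        nlinarith
      nlinarith [mul_nonneg hd2 hρ]
  linarith

end scaledPt

namespace Sym
variable {S : Finset (Fin n → ℕ)} {F : (Fin n → ℝ) → ℝ} {K : Set (Fin n → ℝ)}
  {a : ℝ → (Fin n → ℝ) → ℂ} {Φ : (Fin n → ℝ) ≃L[ℝ] (Fin n → ℝ)} {i₀ : Fin n}
  {Z : Finset (Fin n)} {d δ : ℝ}

lemma exists_scaledPt_bound {N : ℕ} (ha : Sym S F K N a)
    (hK : IsCompact K) (hK1 : ∀ x ∈ K, ∀ i, |x i| < 1) {c : ℝ} (hc : 0 < c)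
    (hest : ∀ x ∈ K, c * absSum S x ^ 2 ≤ ∑ j, KN.eul j F x ^ 2)
    (h0 : i₀ ∉ Z) (hΦ : ∀ u, Φ u i₀ = ∑ i, u i) (hd : 0 < d) (hδ : 0 < δ)
    (hlow : ∀ u, 0 ≤ u → Real.exp (-(d * ∑ i, u i) + δ * ∑ i ∈ (insert i₀ Z)ᶜ, |Φ u i|) ≤
      ∑ p ∈ S, Real.exp (-dot u (natPt p))) (hN : 2 ≤ N * d) (ε : Fin n → Bool) :
    ∃ C, ∀ T, 1 ≤ T → ∀ v,
      Real.exp (-v i₀) * ‖a (Real.exp T) (expPt ε (scaledPt Φ i₀ Z d T v))‖ ≤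
        C * (1 + ‖v‖) ^ (-((n + 1 : ℕ) : ℝ)) := by
  obtain ⟨C, hC0, hC⟩ := ha.exists_decay hK hc hest
  set A := 1 + (2 + 2 * d / δ + ‖(Φ : (Fin n → ℝ) →L[ℝ] (Fin n → ℝ))‖ * (2 + 1 / d))
  have hA : 0 < A := by positivity
  refine ⟨C * (Real.exp 1 * (n + 1).factorial * A ^ (n + 1)), fun T hT v => ?_⟩
  by_cases hx : expPt ε (scaledPt Φ i₀ Z d T v) ∈ K
  swap
  · rw [ha.eq_zero _ _ hx, norm_zero, mul_zero]
    positivity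
  set u := scaledPt Φ i₀ Z d T v with hu_def
  have hu : 0 ≤ u := fun i => by
    have h1 := hK1 _ hx i
    rw [abs_expPt, Real.exp_lt_one_iff] at h1
    exact (neg_lt_zero.1 h1).le
  set σ := δ * ∑ i ∈ (insert i₀ Z)ᶜ, |v i|
  have hσ : 0 ≤ σ := by positivity
  have hρ : |v i₀| / 2 + δ * ∑ i ∈ (insert i₀ Z)ᶜ, |v i| / (2 * d) = |v i₀| / 2 + σ / (2 * d) := by
    rw [← Finset.sum_div, ← mul_div_assoc]
  have h1 := norm_le_of_scaledPt h0 hΦ hd hδ hT hu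
  rw [hρ] at h1
  have h2 := exp_neg_le_rpow hA (by positivity : 0 ≤ |v i₀| / 2 + σ / (2 * d)) (norm_nonneg v) h1
    (n + 1)
  have h3 := half_abs_add_le (r := v i₀) hd hN hσ
  have h4 : Real.exp (-(d * v i₀) + σ) ≤ |Real.exp T| * absSum S (expPt ε u) := by
    rw [abs_of_pos (Real.exp_pos _), absSum_expPt]
    refine le_trans (le_of_eq ?_) (mul_le_mul_of_nonneg_left (hlow u hu) (Real.exp_pos _).le)
    rw [← Real.exp_add, hu_def, sum_scaledPt h0 hΦ]
    congr 1
    have h5 : ∑ i ∈ (insert i₀ Z)ᶜ, |Φ (scaledPt Φ i₀ Z d T v) i| = ∑ i ∈ (insert i₀ Z)ᶜ, |v i| := by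
      refine Finset.sum_congr rfl fun i hi => ?_
      simp only [Finset.mem_compl, Finset.mem_insert, not_or] at hi
      rw [apply_scaledPt, if_neg hi.1, if_neg hi.2]
      simp
    rw [h5]
    simp only [σ]
    field_simp
    ring
  have h6 : Real.exp (max 0 (-(d * v i₀) + σ)) ≤ max 1 (|Real.exp T| * absSum S (expPt ε u)) := by
    rw [Real.exp_monotone.map_max, Real.exp_zero]
    exact max_le_max le_rfl h4
  have h7 : ‖a (Real.exp T) (expPt ε u)‖ ≤ C * Real.exp (-(N * max 0 (-(d * v i₀) + σ))) := by
    refine (hC _ _).trans (mul_le_mul_of_nonneg_left ?_ hC0)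
    rw [Real.exp_neg, Real.exp_nat_mul]
    exact inv_anti₀ (by positivity) (pow_le_pow_left₀ (Real.exp_pos _).le h6 N)
  calc Real.exp (-v i₀) * ‖a (Real.exp T) (expPt ε u)‖
      ≤ Real.exp (-v i₀) * (C * Real.exp (-(N * max 0 (-(d * v i₀) + σ)))) :=
        mul_le_mul_of_nonneg_left h7 (Real.exp_pos _).le
    _ = C * Real.exp (-(v i₀ + N * max 0 (-(d * v i₀) + σ))) := by
        rw [neg_add, Real.exp_add]; ring
    _ ≤ C * Real.exp (-(|v i₀| / 2 + σ / (2 * d))) :=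
        mul_le_mul_of_nonneg_left (Real.exp_le_exp.2 (neg_le_neg h3)) hC0
    _ ≤ _ := by
        rw [mul_assoc C]
        exact mul_le_mul_of_nonneg_left h2 hC0

lemma exists_tendsto_integral_scaledPt {N : ℕ} (hN0 : N ≠ 0) (ha : Sym S F K N a)
    (hF : MonForm S F)
    (hK : IsCompact K) (hK1 : ∀ x ∈ K, ∀ i, |x i| < 1) {c : ℝ} (hc : 0 < c)
    (hest : ∀ x ∈ K, c * absSum S x ^ 2 ≤ ∑ j, KN.eul j F x ^ 2)
    (h0 : i₀ ∉ Z) (hΦ : ∀ u, Φ u i₀ = ∑ i, u i) (hd : 0 < d) (hδ : 0 < δ)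
    (hlow : ∀ u, 0 ≤ u → Real.exp (-(d * ∑ i, u i) + δ * ∑ i ∈ (insert i₀ Z)ᶜ, |Φ u i|) ≤
      ∑ p ∈ S, Real.exp (-dot u (natPt p))) (hN : 2 ≤ N * d) (ε : Fin n → Bool) :
    ∃ L, Tendsto (fun T : ℝ => ∫ v, Real.exp (-v i₀) •
      (Complex.exp (Complex.I * (Real.exp T : ℝ) * F (expPt ε (scaledPt Φ i₀ Z d T v))) *
        a (Real.exp T) (expPt ε (scaledPt Φ i₀ Z d T v)))) atTop (𝓝 L) := by
  obtain ⟨C, hC⟩ := ha.exists_scaledPt_bound hK hK1 hc hest h0 hΦ hd hδ hlow hN ε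
  have hlim := fun v : Fin n → ℝ => ha.exists_tendsto_line hN0 hF hK hK1 hc hest ε
    (Φ.symm (fun i => (if i ∈ Z then v i else 0) + if i = i₀ then 1 / d else 0))
    (Φ.symm (fun i => if i ∈ Z then 0 else v i))
  choose g hg using hlim
  refine ⟨∫ v, Real.exp (-v i₀) • g v, tendsto_integral_filter_of_dominated_convergence
    (fun v => C * (1 + ‖v‖) ^ (-((n + 1 : ℕ) : ℝ))) (Eventually.of_forall fun T => ?_) ?_ ?_
    (Eventually.of_forall fun v => ?_)⟩
  · refine Continuous.aestronglyMeasurable ?_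
    have h1 : Continuous fun v => expPt ε (scaledPt Φ i₀ Z d T v) :=
      (continuous_expPt ε).comp (continuous_scaledPt T)
    have h2 := hF.contDiff.continuous.comp h1
    have h3 := (ha.contDiff hF.contDiff (Real.exp T)).continuous.comp h1
    have h4 : Continuous fun v : Fin n → ℝ => Real.exp (-v i₀) := by fun_prop
    refine h4.smul (Continuous.mul ?_ h3)
    exact Complex.continuous_exp.comp (continuous_const.mul (Complex.continuous_ofReal.comp h2))
  · filter_upwards [eventually_ge_atTop 1] with T hT
    refine Eventually.of_forall fun v => ?_
    rw [norm_smul, norm_mul, norm_cexp_I_mul_mul, one_mul, Real.norm_eq_abs,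
      abs_of_pos (Real.exp_pos _)]
    exact hC T hT v
  · refine (integrable_one_add_norm ?_).const_mul C
    simp
  · refine Tendsto.const_smul ?_ _
    refine (hg v).congr fun T => ?_
    rw [scaledPt_eq]

end Sym

/-- The leading asymptotics of an oscillatory integral whose phase is controlled from below by its
Newton polyhedron. -/
lemma exists_tendsto_oscInt {S : Finset (Fin n → ℕ)} {F : (Fin n → ℝ) → ℝ} (hF : MonForm S F)
    {K : Set (Fin n → ℝ)} (hK : IsCompact K) (hK1 : ∀ x ∈ K, ∀ i, |x i| < 1) {c : ℝ} (hc : 0 < c)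
    (hest : ∀ x ∈ K, c * absSum S x ^ 2 ≤ ∑ j, KN.eul j F x ^ 2)
    {Φ : (Fin n → ℝ) ≃L[ℝ] (Fin n → ℝ)} {i₀ : Fin n} {Z : Finset (Fin n)} {d δ : ℝ}
    (h0 : i₀ ∉ Z) (hΦ : ∀ u, Φ u i₀ = ∑ i, u i) (hd : 0 < d) (hδ : 0 < δ)
    (hlow : ∀ u, 0 ≤ u → Real.exp (-(d * ∑ i, u i) + δ * ∑ i ∈ (insert i₀ Z)ᶜ, |Φ u i|) ≤
      ∑ p ∈ S, Real.exp (-dot u (natPt p)))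
    {φ : (Fin n → ℝ) → ℂ} (hφ : ContDiff ℝ (⊤ : ℕ∞) φ) (hφ0 : ∀ x ∉ K, φ x = 0) :
    ∃ L, Tendsto (fun t : ℝ => ((t ^ (1 / d) : ℝ) : ℂ) * (((Real.log t) ^ Z.card : ℝ) : ℂ)⁻¹ *
      oscInt F φ t) atTop (𝓝 L) := by
  set N := ⌈2 / d⌉₊
  have hN : 2 ≤ N * d := by
    rw [← div_le_iff₀ hd]
    exact Nat.le_ceil _
  have hN0 : N ≠ 0 := (Nat.ceil_pos.2 (by positivity)).ne'
  obtain ⟨a, ha, hosc⟩ := Sym.exists_iterate hF hK hφ hφ0 N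
  have hL := fun ε => ha.exists_tendsto_integral_scaledPt hN0 hF hK hK1 hc hest h0 hΦ hd hδ hlow hN ε
  choose L hL using hL
  set D := |((Φ.symm : (Fin n → ℝ) ≃L[ℝ] (Fin n → ℝ)) : (Fin n → ℝ) →L[ℝ] (Fin n → ℝ)).det|
  refine ⟨∑ ε, D • L ε, ?_⟩
  refine ((tendsto_finsetSum Finset.univ fun ε _ => (hL ε).const_smul D).comp
    Real.tendsto_log_atTop).congr' ?_
  filter_upwards [eventually_gt_atTop (1 : ℝ)] with t ht
  have ht0 : 0 < t := one_pos.trans ht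
  have hlog : 0 < Real.log t := Real.log_pos ht
  rw [hosc, integral_eq_sum_orthants (ha.integrable hF.contDiff hK t), Finset.mul_sum]
  refine Finset.sum_congr rfl fun ε _ => ?_
  rw [integral_eq_integral_affine Φ.symm (c := fun i => if i ∈ Z then Real.log t else 1)
    (fun i => by split_ifs <;> simp [hlog.ne']) (Pi.single i₀ (Real.log t / d))
    fun u => Real.exp (-∑ i, u i) •
      (Complex.exp (Complex.I * t * F (expPt ε u)) * a t (expPt ε u))]
  have h1 : ∏ i, (if i ∈ Z then Real.log t else 1) = Real.log t ^ Z.card := by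
    rw [Finset.prod_ite_mem]
    simp
  have h2 : ∀ v, Real.exp (-∑ i, scaledPt Φ i₀ Z d (Real.log t) v i) =
      (t ^ (1 / d))⁻¹ * Real.exp (-v i₀) := fun v => by
    rw [sum_scaledPt h0 hΦ, Real.rpow_def_of_pos ht0, ← Real.exp_neg, ← Real.exp_add]
    congr 1
    ring
  change _ = _ * ((_ : ℝ) • ∫ v, Real.exp (-∑ i, scaledPt Φ i₀ Z d (Real.log t) v i) •
    (Complex.exp (Complex.I * t * F (expPt ε (scaledPt Φ i₀ Z d (Real.log t) v))) *
        a t (expPt ε (scaledPt Φ i₀ Z d (Real.log t) v))))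
  simp only [h1, h2, mul_smul, integral_smul, Real.exp_log ht0]
  rw [abs_of_pos (pow_pos hlog _)]
  simp only [Complex.real_smul]
  have h3 : ((t ^ (1 / d) : ℝ) : ℂ) ≠ 0 := Complex.ofReal_ne_zero.2 (Real.rpow_pos_of_pos ht0 _).ne'
  have h4 : ((Real.log t ^ Z.card : ℝ) : ℂ) ≠ 0 := Complex.ofReal_ne_zero.2 (pow_pos hlog _).ne'
  rw [Complex.ofReal_inv]
  change (D : ℂ) * _ = _ * ((D : ℂ) * _)
  field_simp

lemma taylorCoeff_zero (f : (Fin n → ℝ) → ℝ) : taylorCoeff f 0 = f 0 := by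
  have h : mderiv 0 f = f := by
    rw [mderiv]
    induction List.finRange n with
    | nil => rfl
    | cons i l ih => simp
  simp [taylorCoeff, h]

/-- The leading asymptotics of the oscillatory integrals of a nondegenerate phase. -/
theorem ConditionC.exists_tendsto_oscInt {U : Set (Fin n → ℝ)} (hU : IsOpen U)
    (hU0 : (0 : Fin n → ℝ) ∈ U) {f : (Fin n → ℝ) → ℝ} (hf : ContDiffOn ℝ (⊤ : ℕ∞) f U)
    (hf0 : f 0 = 0) (hΓ : (NewtonPolyhedron f).Nonempty) (hC : ConditionC U f)
    {τ : Set (Fin n → ℝ)} (hτ : IsPrincipalFace f τ) :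
    0 < newtonDist f ∧ ∃ k, n - setDim τ = k + 1 ∧ ∃ F : (Fin n → ℝ) → ℝ, Continuous F ∧
      ∃ V ∈ 𝓝 (0 : Fin n → ℝ), (∀ x ∈ V, f x = F x) ∧
        ∀ φ : (Fin n → ℝ) → ℂ, ContDiff ℝ (⊤ : ℕ∞) φ → (∀ x ∉ V, φ x = 0) →
          ∃ L, Tendsto (fun t : ℝ => ((t ^ (1 / newtonDist f) : ℝ) : ℂ) *
            (((Real.log t) ^ k : ℝ) : ℂ)⁻¹ * oscInt F φ t) atTop (𝓝 L) := by
  obtain ⟨S, hS1, hS2, hΓS⟩ := exists_newton_generators f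
  have hSne : S.Nonempty := by
    obtain ⟨x, α, hα, -⟩ := convexHull_nonempty_iff.1 hΓ
    obtain ⟨p, hp, -⟩ := hS2 α hα
    exact ⟨p, hp⟩
  have hS0 : ∀ p ∈ S, p ≠ 0 := by
    rintro p hp rfl
    exact hS1 0 hp (by rw [taylorCoeff_zero, hf0])
  have : NeZero n := ⟨by
    rintro rfl
    obtain ⟨p, hp⟩ := hSne
    exact hS0 p hp (Subsingleton.elim _ _)⟩
  have hd := newtonDist_pos hΓS hSne hS0
  obtain ⟨Φ, i₀, Z, h0, hZ, hΦ, δ, hδ, hlow⟩ := hτ.exists_coordinates hΓS hSne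
  obtain ⟨S', hSS, hS', ψ, hψ, r, hr, hfr⟩ := hC.1.exists_expansion hU hU0 hf hSne hΓS
  set F : (Fin n → ℝ) → ℝ := fun x => ∑ p ∈ S', mon p x * ψ p x with hF_def
  have hF : MonForm S' F := ⟨ψ, hψ, rfl⟩
  have hbox : ∀ {ρ : ℝ} {x : Fin n → ℝ}, x ∈ Metric.closedBall 0 ρ → ∀ i, |x i| ≤ ρ :=
    fun hx i => (norm_le_pi_norm _ i).trans (mem_closedBall_zero_iff.1 hx)
  have hfF : f =ᶠ[𝓝 0] F := by
    filter_upwards [Metric.ball_mem_nhds 0 hr] with x hx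
    exact (hfr x fun i => (norm_le_pi_norm x i).trans_lt (mem_ball_zero_iff.1 hx)).2
  obtain ⟨c, hc, r', hr', hest⟩ :=
    nondegeneracy_estimate hU hU0 hC.2 hSne hΓS hSS hS' hψ hfF
  set ρ := min (min r r') 1 / 2
  have hm : 0 < min (min r r') 1 := lt_min (lt_min hr hr') one_pos
  have hρ : 0 < ρ := by positivity
  have hρm : ρ < min (min r r') 1 := half_lt_self hm
  have hρr : ρ < r := hρm.trans_le ((min_le_left _ _).trans (min_le_left _ _))
  have hρr' : ρ < r' := hρm.trans_le ((min_le_left _ _).trans (min_le_right _ _))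
  have hρ1 : ρ < 1 := hρm.trans_le (min_le_right _ _)
  refine ⟨hd, Z.card, hZ.symm, F, hF.contDiff.continuous, Metric.closedBall 0 ρ,
    Metric.closedBall_mem_nhds _ hρ, fun x hx => (hfr x fun i => (hbox hx i).trans_lt hρr).2,
    fun φ hφ hφ0 => ?_⟩
  exact KN.exists_tendsto_oscInt hF (isCompact_closedBall 0 ρ)
    (fun x hx i => (hbox hx i).trans_lt hρ1) hc
    (fun x hx => hest x fun i => (hbox hx i).trans_lt hρr') h0 hΦ hd hδ
    (fun u hu => (hlow u hu).trans
      (Finset.sum_le_sum_of_subset_of_nonneg hSS fun _ _ _ => (Real.exp_pos _).le)) hφ hφ0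

/-- Theorem 10.1: under condition (C) and one of the conditions (a), (b),
(c), for `φ` supported in a sufficiently small neighborhood of the origin,
`lim_{t→∞} t^{1/d(f)} (log t)^{-m(f)+1} I(t;φ)
  = (Γ(1/d(f))/(m(f)-1)!) [e^{iπ/(2d(f))} C_+ + e^{-iπ/(2d(f))} C_-]`. -/
theorem statement6 {n : ℕ} (U : Set (Fin n → ℝ)) (hUopen : IsOpen U)
    (hU0 : (0 : Fin n → ℝ) ∈ U)
    (f : (Fin n → ℝ) → ℝ) (hf : ContDiffOn ℝ (⊤ : ℕ∞) f U)
    (hf0 : f 0 = 0) (hdf0 : fderiv ℝ f 0 = 0)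
    (hΓ : (NewtonPolyhedron f).Nonempty)
    (hC : ConditionC U f)
    (τ : Set (Fin n → ℝ)) (hτ : IsPrincipalFace f τ)
    (hcase : 1 < newtonDist f ∨ ((∀ x ∈ U, 0 ≤ f x) ∨ (∀ x ∈ U, f x ≤ 0)) ∨
      ((¬ ∃ k : ℕ, Odd k ∧ 1 / newtonDist f = (k : ℝ)) ∧
        ∀ x ∈ U, (∀ i, x i ≠ 0) → gammaFn f τ x ≠ 0)) :
    ∃ V ∈ 𝓝 (0 : Fin n → ℝ), ∀ φ : (Fin n → ℝ) → ℂ, IsAmplitude U V φ →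
      ∀ Zp Zm : ℂ → ℂ,
        MeromorphicOn Zp Set.univ → (∀ s : ℂ, 0 < s.re → Zp s = zetaPlus f φ s) →
        MeromorphicOn Zm Set.univ → (∀ s : ℂ, 0 < s.re → Zm s = zetaMinus f φ s) →
        ∀ Cp Cm : ℂ,
          Tendsto
            (fun s : ℂ => (s + ((1 / newtonDist f : ℝ) : ℂ)) ^ (n - setDim τ) * Zp s)
            (𝓝[≠] ((-(1 / newtonDist f) : ℝ) : ℂ)) (𝓝 Cp) →
          Tendsto
            (fun s : ℂ => (s + ((1 / newtonDist f : ℝ) : ℂ)) ^ (n - setDim τ) * Zm s)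
            (𝓝[≠] ((-(1 / newtonDist f) : ℝ) : ℂ)) (𝓝 Cm) →
          Tendsto (fun t : ℝ =>
              ((t ^ (1 / newtonDist f) : ℝ) : ℂ) *
              (((Real.log t ^ ((1 : ℤ) - ((n - setDim τ : ℕ) : ℤ)) : ℝ)) : ℂ) *
              oscInt f φ t)
            atTop
            (𝓝 (((Real.Gamma (1 / newtonDist f) /
                    (Nat.factorial (n - setDim τ - 1) : ℝ) : ℝ)) *
              (Complex.exp (Complex.I * (Real.pi : ℂ) /
                  (2 * ((newtonDist f : ℝ) : ℂ))) * Cp +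
               Complex.exp (-(Complex.I * (Real.pi : ℂ) /
                  (2 * ((newtonDist f : ℝ) : ℂ)))) * Cm))) := by
  obtain ⟨hd, k, hk, F, hF, V, hV, hfF, hlim⟩ :=
    hC.exists_tendsto_oscInt hUopen hU0 hf hf0 hΓ hτ
  refine ⟨V, hV, fun φ ⟨hφ, hc, hsub⟩ Zp Zm hZp hZp' hZm hZm' Cp Cm hCp hCm => ?_⟩
  have hφ0 : ∀ x ∉ V, φ x = 0 := fun x hx =>
    image_eq_zero_of_notMem_tsupport fun h => hx (hsub h).2
  have heq : ∀ w : ℝ → ℂ, (fun x => w (f x) * φ x) = fun x => w (F x) * φ x := fun w => by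
    funext x
    by_cases hx : x ∈ V
    · rw [hfF x hx]
    · rw [hφ0 x hx, mul_zero, mul_zero]
  have hosc : oscInt f φ = oscInt F φ := funext fun t =>
    congrArg (fun g : (Fin n → ℝ) → ℂ => ∫ x, g x) (heq fun y => Complex.exp (Complex.I * t * y))
  have hzp : zetaPlus f φ = zetaPlus F φ := funext fun s =>
    congrArg (fun g : (Fin n → ℝ) → ℂ => ∫ x, g x) (heq fun y => ((max y 0 : ℝ) : ℂ) ^ s)
  have hzm : zetaMinus f φ = zetaMinus F φ := funext fun s =>
    congrArg (fun g : (Fin n → ℝ) → ℂ => ∫ x, g x) (heq fun y => ((max (-y) 0 : ℝ) : ℂ) ^ s)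
  obtain ⟨L, hL⟩ := hlim φ hφ hφ0
  rw [hk] at hCp hCm ⊢
  rw [hzp] at hZp'
  rw [hzm] at hZm'
  have hLeq := mellin_transfer hF hφ.continuous hc (one_div_pos.2 hd) hZp hZp' hZm hZm' hCp hCm hL
  have hexp : Complex.I * (Real.pi : ℂ) / (2 * ((newtonDist f : ℝ) : ℂ)) =
      Complex.I * Real.pi * ((1 / newtonDist f : ℝ) : ℂ) / 2 := by
    have : ((newtonDist f : ℝ) : ℂ) ≠ 0 := Complex.ofReal_ne_zero.2 hd.ne'
    push_cast
    field_simp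
  rw [hexp, Nat.add_sub_cancel, ← hLeq, hosc]
  refine hL.congr fun t => ?_
  rw [← Complex.ofReal_inv, ← zpow_natCast, ← zpow_neg]
  congr 4
  push_cast
  ring

end KN
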